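/- Let K be an imaginary quadratic field with a fixed embedding K ↪ ℂ, 𝔑 a nonzero ideal of O_K, l ≥ 1 an integer, and ψ an algebraic Hecke character of K modulo 𝔑 of infinity type l. For each prime ideal 𝔭 of O_K coprime to 𝔑, set x_𝔭 := ψ(𝔭)/N(𝔭)^{l/2}, which lies on the unit circle. Then the sequence (x_{𝔭_i})_{i≥1}, where (𝔭_i) is an enumeration of the primes coprime to 𝔑 ordered by norm, is equidistributed on the unit circle with respect to its Haar probability measure: for every continuous f : circle → ℂ, (1/n)∑_{i=1}^n f(x_{𝔭_i}) → ∫ f dμ_Haar. -/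

import Mathlib

open Filter MeasureTheory NumberField

open scoped Topology

/-- The (unnormalised) Fejér kernel on the real line. -/
noncomputable def fejer (x : ℝ) : ℝ := 2 * (1 - Real.cos x) / x ^ 2

lemma fejer_nonneg (x : ℝ) : 0 ≤ fejer x := by
  have := Real.cos_le_one x
  unfold fejer; apply div_nonneg <;> nlinarith [sq_nonneg x]

lemma fejer_le (x : ℝ) : fejer x ≤ 5 * (1 + x ^ 2)⁻¹ := by
  have h1 := Real.cos_le_one x
  have h2 := Real.neg_one_le_cos x
  have h3 := Real.one_sub_sq_div_two_le_cos (x := x)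
  unfold fejer
  rcases eq_or_ne x 0 with rfl | hx
  · simp
  have : 0 < x ^ 2 := by positivity
  rw [← div_eq_mul_inv, div_le_div_iff₀ this (by positivity)]
  nlinarith

lemma measurable_fejer : Measurable fejer := by
  unfold fejer; fun_prop

lemma integrable_fejer : Integrable fejer := by
  refine (integrable_inv_one_add_sq.const_mul 5).mono' measurable_fejer.aestronglyMeasurable ?_
  filter_upwards with x
  rw [Real.norm_of_nonneg (fejer_nonneg x)]
  exact fejer_le x

lemma integral_fejer_pos : 0 < ∫ x, fejer x := by
  rw [integral_pos_iff_support_of_nonneg fejer_nonneg integrable_fejer]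
  refine lt_of_lt_of_le ?_ (measure_mono (?_ : Set.Ioo (0:ℝ) 1 ⊆ _))
  · simp
  · intro x hx
    have : Real.cos x < 1 := by
      have := Real.cos_lt_cos_of_nonneg_of_le_pi_div_two (x := 0) (y := x) le_rfl
        (by linarith [Real.pi_gt_three, hx.2]) hx.1
      simpa using this
    simp only [Function.mem_support, fejer]
    have := hx.1
    have h2 : 0 < 1 - Real.cos x := by linarith
    positivity

lemma tendsto_integral_fejer_Icc :
    Tendsto (fun n : ℕ => ∫ x in Set.Icc (-(n : ℝ)) n, fejer x) atTop (𝓝 (∫ x, fejer x)) := by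
  have h : AECover volume atTop (fun n : ℕ => Set.Icc (-(n : ℝ)) n) :=
    aecover_Icc (tendsto_neg_atTop_atBot.comp tendsto_natCast_atTop_atTop)
      tendsto_natCast_atTop_atTop
  exact h.integral_tendsto_of_countably_generated integrable_fejer

lemma integral_tent_mul_cos {L x : ℝ} (hL : 0 < L) (hx : x ≠ 0) :
    ∫ τ in (0:ℝ)..L, ((1 - τ / L : ℝ) : ℂ) *
      (Complex.exp (x * τ * Complex.I) + Complex.exp (-(x * τ * Complex.I))) =
      ((L * fejer (L * x) : ℝ) : ℂ) := by
  have h1 : ∀ τ : ℝ, ((1 - τ / L : ℝ) : ℂ) *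
      (Complex.exp (x * τ * Complex.I) + Complex.exp (-(x * τ * Complex.I))) =
      (((1 - τ / L) * (2 * Real.cos (x * τ)) : ℝ) : ℂ) := by
    intro τ
    push_cast
    rw [Complex.two_cos]; simp
  simp_rw [h1]
  rw [intervalIntegral.integral_ofReal]
  congr 1
  have h2 : ∀ τ ∈ Set.uIcc 0 L, HasDerivAt
      (fun τ => 2 * ((1 - τ / L) * Real.sin (x * τ) / x - Real.cos (x * τ) / (L * x ^ 2)))
      ((1 - τ / L) * (2 * Real.cos (x * τ))) τ := by
    intro τ _
    have a1 : HasDerivAt (fun τ : ℝ => x * τ) x τ := by simpa using (hasDerivAt_id τ).const_mul x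
    have a2 : HasDerivAt (fun τ : ℝ => 1 - τ / L) (-(1 / L)) τ := by
      simpa using ((hasDerivAt_id τ).div_const L).const_sub 1
    refine ((((a2.fun_mul a1.sin).div_const x).fun_sub
      (a1.cos.div_const (L * x ^ 2))).const_mul 2).congr_deriv ?_
    field_simp
    ring
  rw [intervalIntegral.integral_eq_sub_of_hasDerivAt h2
    (by apply Continuous.intervalIntegrable; fun_prop)]
  unfold fejer
  simp
  field_simp
  ring

lemma tendsto_intervalIntegral_mul_exp (h : ℝ → ℂ) {L : ℝ} (hL : 0 ≤ L) :
    Tendsto (fun u : ℝ => ∫ τ in (0:ℝ)..L, h τ * Complex.exp (u * τ * Complex.I))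
      (cocompact ℝ) (𝓝 0) := by
  have h1 := Real.tendsto_integral_exp_smul_cocompact (Set.indicator (Set.Ioc 0 L) h)
  have h2 : Tendsto (fun u : ℝ => u * (-(2 * Real.pi)⁻¹)) (cocompact ℝ) (cocompact ℝ) := by
    have h0 : (-(2 * Real.pi)⁻¹) ≠ 0 := by simp [Real.pi_ne_zero]
    exact (Homeomorph.mulRight₀ _ h0).isClosedEmbedding.tendsto_cocompact
  refine (h1.comp h2).congr fun u => ?_
  rw [intervalIntegral.integral_of_le hL, ← integral_indicator measurableSet_Ioc]
  simp only [Function.comp]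
  congr 1
  ext v
  by_cases hv : v ∈ Set.Ioc 0 L
  · simp only [Set.indicator_of_mem hv, Circle.smul_def, Real.fourierChar_apply, smul_eq_mul]
    rw [mul_comm]
    congr 2
    push_cast
    have : (Real.pi : ℂ) ≠ 0 := by exact_mod_cast Real.pi_ne_zero
    field_simp
  · simp [Set.indicator_of_notMem hv]

lemma tendsto_tent_integral (G₁ G₂ : ℝ → ℂ) {L : ℝ} (hL : 0 < L) (h₁ : ContinuousOn G₁ (Set.Icc 0 L))
    (h₂ : ContinuousOn G₂ (Set.Icc 0 L)) :
    Tendsto (fun u : ℝ => ∫ τ in (0:ℝ)..L, ((1 - τ / L : ℝ) : ℂ) *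
      (Complex.exp (u * τ * Complex.I) * G₁ τ + Complex.exp (-(u * τ * Complex.I)) * G₂ τ))
      atTop (𝓝 0) := by
  have a1 := (tendsto_intervalIntegral_mul_exp (fun τ => ((1 - τ / L : ℝ) : ℂ) * G₁ τ) hL.le).comp
    (tendsto_id.mono_right atTop_le_cocompact : Tendsto (fun u : ℝ => u) atTop (cocompact ℝ))
  have a2 := (tendsto_intervalIntegral_mul_exp (fun τ => ((1 - τ / L : ℝ) : ℂ) * G₂ τ) hL.le).comp
    (tendsto_neg_atTop_atBot.mono_right atBot_le_cocompact :
      Tendsto (fun u : ℝ => -u) atTop (cocompact ℝ))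
  have a3 := a1.add a2
  rw [add_zero] at a3
  refine a3.congr fun u => ?_
  simp only [Function.comp, id]
  rw [← intervalIntegral.integral_add]
  · congr 1
    ext τ
    push_cast
    rw [neg_mul, neg_mul]
    ring
  · apply ContinuousOn.intervalIntegrable
    rw [Set.uIcc_of_le hL.le]
    fun_prop
  · apply ContinuousOn.intervalIntegrable
    rw [Set.uIcc_of_le hL.le]
    fun_prop

lemma integral_mul_fejer {φ : ℝ → ℂ} (hφ : IntegrableOn φ (Set.Ioi 0)) {L : ℝ} (hL : 0 < L)
    (u : ℝ) :
    ∫ t in Set.Ioi (0:ℝ), φ t * ((L * fejer (L * (u - t)) : ℝ) : ℂ) =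
    ∫ τ in (0:ℝ)..L, ((1 - τ / L : ℝ) : ℂ) *
      (Complex.exp (u * τ * Complex.I) *
          (∫ t in Set.Ioi (0:ℝ), φ t * Complex.exp (-(τ * Complex.I) * t)) +
        Complex.exp (-(u * τ * Complex.I)) *
          (∫ t in Set.Ioi (0:ℝ), φ t * Complex.exp ((τ * Complex.I) * t))) := by
  have hexp : ∀ x : ℝ, ‖Complex.exp (x * Complex.I)‖ ≤ 1 := fun x =>
    (Complex.norm_exp_ofReal_mul_I x).le
  have e1 : ∀ τ : ℝ, Integrable (fun t : ℝ => φ t * Complex.exp (-(τ * Complex.I) * t))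
      (volume.restrict (Set.Ioi 0)) := by
    intro τ
    simp_rw [mul_comm (φ _)]
    refine hφ.bdd_mul (c := 1) (by fun_prop) (Eventually.of_forall fun t => ?_)
    have e : -(τ * Complex.I) * t = ((-(τ * t) : ℝ) : ℂ) * Complex.I := by push_cast; ring
    rw [e]
    exact hexp _
  have e2 : ∀ τ : ℝ, Integrable (fun t : ℝ => φ t * Complex.exp ((τ * Complex.I) * t))
      (volume.restrict (Set.Ioi 0)) := by
    intro τ
    have := e1 (-τ)
    push_cast at this
    simpa using this
  have h1 : ∫ t in Set.Ioi (0:ℝ), φ t * ((L * fejer (L * (u - t)) : ℝ) : ℂ) =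
      ∫ t in Set.Ioi (0:ℝ), ∫ τ in Set.Ioc 0 L, φ t * (((1 - τ / L : ℝ) : ℂ) *
      (Complex.exp ((u - t : ℝ) * τ * Complex.I) + Complex.exp (-((u - t : ℝ) * τ * Complex.I)))) := by
    refine setIntegral_congr_ae measurableSet_Ioi ?_
    have : ∀ᵐ t : ℝ, t ≠ u := by simp [ae_iff]
    filter_upwards [this] with t ht _
    rw [integral_const_mul, ← intervalIntegral.integral_of_le hL.le,
      integral_tent_mul_cos hL (sub_ne_zero.2 ht.symm)]
  rw [h1, integral_integral_swap, intervalIntegral.integral_of_le hL.le]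
  · refine setIntegral_congr_fun measurableSet_Ioc fun τ _ => ?_
    rw [← integral_const_mul, ← integral_const_mul, ← integral_add ((e1 τ).const_mul _)
      ((e2 τ).const_mul _), ← integral_const_mul]
    congr 1
    ext t
    have a1 : Complex.exp ((u - t : ℝ) * τ * Complex.I) =
        Complex.exp (u * τ * Complex.I) * Complex.exp (-(τ * Complex.I) * t) := by
      rw [← Complex.exp_add]; congr 1; push_cast; ring
    have a2 : Complex.exp (-((u - t : ℝ) * τ * Complex.I)) =
        Complex.exp (-(u * τ * Complex.I)) * Complex.exp (τ * Complex.I * t) := by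
      rw [← Complex.exp_add]; congr 1; push_cast; ring
    rw [a1, a2]
    ring
  · have i1 : Integrable (fun τ : ℝ => ((1 - τ / L : ℝ) : ℂ)) (volume.restrict (Set.Ioc 0 L)) := by
      have : Continuous (fun τ : ℝ => ((1 - τ / L : ℝ) : ℂ)) := by fun_prop
      exact (this.integrableOn_Icc (a := 0) (b := L)).mono_set Set.Ioc_subset_Icc_self
    have i2 := Integrable.mul_prod (μ := volume.restrict (Set.Ioi (0:ℝ))) hφ i1
    refine (i2.bdd_mul (f := fun z : ℝ × ℝ =>
      (Complex.exp ((u - z.1 : ℝ) * z.2 * Complex.I) +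
        Complex.exp (-((u - z.1 : ℝ) * z.2 * Complex.I)))) (c := 2) ?_ ?_).congr ?_
    · fun_prop
    · refine Eventually.of_forall fun z => (norm_add_le _ _).trans ?_
      have b1 := hexp ((u - z.1) * z.2)
      have b2 := hexp (-((u - z.1) * z.2))
      push_cast at b1 b2 ⊢
      rw [neg_mul] at b2
      linarith
    · refine Eventually.of_forall fun z => ?_
      simp only [Function.uncurry]
      ring

/-- The rescaled Fejér kernel centred at `u`. -/
noncomputable def fejerAt (L u t : ℝ) : ℝ := L * fejer (L * (u - t))

lemma fejerAt_nonneg {L : ℝ} (hL : 0 < L) (u t : ℝ) : 0 ≤ fejerAt L u t :=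
  mul_nonneg hL.le (fejer_nonneg _)

lemma measurable_fejerAt (L u : ℝ) : Measurable (fejerAt L u) := by
  have := measurable_fejer
  unfold fejerAt
  fun_prop

lemma integral_fejerAt_mul {L : ℝ} (hL : 0 < L) (u : ℝ) (g : ℝ → ℝ) :
    ∫ t, g t * fejerAt L u t = ∫ x, g (u - x / L) * fejer x := by
  rw [← integral_sub_left_eq_self _ _ u]
  have h := Measure.integral_comp_mul_left (fun x => g (u - x / L) * (L * fejer x)) L
  rw [abs_of_pos (inv_pos.2 hL), smul_eq_mul, ← integral_const_mul] at h
  trans ∫ t, g (u - L * t / L) * (L * fejer (L * t))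
  · refine integral_congr_ae (Eventually.of_forall fun t => ?_)
    simp only [fejerAt, sub_sub_cancel]
    rw [mul_div_cancel_left₀ _ hL.ne']
  · rw [h]
    refine integral_congr_ae (Eventually.of_forall fun t => ?_)
    field_simp

lemma integrable_fejerAt {L : ℝ} (hL : 0 < L) (u : ℝ) : Integrable (fejerAt L u) :=
  ((integrable_fejer.comp_mul_left' hL.ne').comp_sub_left u).const_mul L

lemma integral_fejerAt {L : ℝ} (hL : 0 < L) (u : ℝ) : ∫ t, fejerAt L u t = ∫ x, fejer x := by
  simpa using integral_fejerAt_mul hL u (fun _ => 1)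

lemma setIntegral_fejerAt {L : ℝ} (hL : 0 < L) (u : ℝ) {s : Set ℝ} (hs : MeasurableSet s) :
    ∫ t in s, fejerAt L u t = ∫ x in (fun x => u - x / L) ⁻¹' s, fejer x := by
  have h := integral_fejerAt_mul hL u (s.indicator 1)
  have hs' : MeasurableSet ((fun x : ℝ => u - x / L) ⁻¹' s) := by
    apply measurableSet_preimage _ hs
    fun_prop
  rw [← integral_indicator hs, ← integral_indicator hs']
  refine Eq.trans (integral_congr_ae (Eventually.of_forall fun t => ?_))
    (h.trans (integral_congr_ae (Eventually.of_forall fun t => ?_)))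
  · simp [Set.indicator]
  · simp [Set.indicator, Set.mem_preimage]
    rfl

lemma setIntegral_fejerAt_Icc {L : ℝ} (hL : 0 < L) (u ε : ℝ) :
    ∫ t in Set.Icc (u - ε) (u + ε), fejerAt L u t =
      ∫ x in Set.Icc (-(L * ε)) (L * ε), fejer x := by
  rw [setIntegral_fejerAt hL u measurableSet_Icc]
  congr 2
  ext x
  simp only [Set.mem_preimage, Set.mem_Icc]
  have : x = L * (x / L) := by field_simp
  constructor
  · rintro ⟨h1, h2⟩
    constructor <;> nlinarith
  · rintro ⟨h1, h2⟩
    rw [this] at h1 h2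
    have h1' : -ε ≤ x / L := by
      apply le_of_mul_le_mul_left _ hL
      linarith
    have h2' := le_of_mul_le_mul_left h2 hL
    constructor <;> linarith

lemma tendsto_setIntegral_fejerAt_Ioi {L : ℝ} (hL : 0 < L) :
    Tendsto (fun u => ∫ t in Set.Ioi (0:ℝ), fejerAt L u t) atTop (𝓝 (∫ x, fejer x)) := by
  have h : AECover volume atTop (fun u : ℝ => Set.Iio (L * u)) :=
    aecover_Iio (tendsto_id.const_mul_atTop hL)
  refine (h.integral_tendsto_of_countably_generated integrable_fejer).congr fun u => ?_
  rw [setIntegral_fejerAt hL u measurableSet_Ioi]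
  congr 2
  ext x
  simp only [Set.mem_preimage, Set.mem_Ioi, Set.mem_Iio, sub_pos, div_lt_iff₀ hL]
  rw [mul_comm]


lemma tendsto_laplace_fejer {S : ℝ → ℝ} {c : ℝ} {G : ℂ → ℂ}
    (hSint : ∀ δ : ℝ, 0 < δ → IntegrableOn (fun t => S t * Real.exp (-t) * Real.exp (-δ * t))
      (Set.Ioi 0))
    (hG : ContinuousOn G {s | 0 ≤ s.re})
    (hGF : ∀ s : ℂ, 0 < s.re → G s = ∫ t in Set.Ioi (0:ℝ),
      ((S t * Real.exp (-t) - c : ℝ) : ℂ) * Complex.exp (-s * t))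
    {L : ℝ} (hL : 0 < L) (u : ℝ) {δ : ℕ → ℝ} (hδ : ∀ n, 0 < δ n) (hδ0 : Tendsto δ atTop (𝓝 0))
    (hδ1 : ∀ n, δ n ≤ 1) :
    Tendsto (fun n => ∫ t in Set.Ioi (0:ℝ), S t * Real.exp (-t) * Real.exp (-δ n * t) *
        fejerAt L u t) atTop
      (𝓝 ((∫ τ in (0:ℝ)..L, ((1 - τ / L : ℝ) : ℂ) *
        (Complex.exp (u * τ * Complex.I) * G (τ * Complex.I) +
          Complex.exp (-(u * τ * Complex.I)) * G (-(τ * Complex.I)))).re +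
        c * ∫ t in Set.Ioi (0:ℝ), fejerAt L u t)) := by
  have hexpint : ∀ n, IntegrableOn (fun t => Real.exp (-δ n * t)) (Set.Ioi 0) := fun n => by
    exact exp_neg_integrableOn_Ioi 0 (hδ n)
  have hφ : ∀ n, IntegrableOn (fun t : ℝ => (((S t * Real.exp (-t) - c) *
      Real.exp (-δ n * t) : ℝ) : ℂ)) (Set.Ioi 0) := by
    intro n
    have h := ((hSint _ (hδ n)).sub ((hexpint n).const_mul c)).ofReal (𝕜 := ℂ)
    refine h.congr (Eventually.of_forall fun t => ?_)
    simp [sub_mul]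
  have hK : Integrable (fejerAt L u) (volume.restrict (Set.Ioi 0)) :=
    (integrable_fejerAt hL u).integrableOn
  -- boundedness of the kernel
  have hKb : ∀ t, ‖fejerAt L u t‖ ≤ 5 * L := by
    intro t
    rw [Real.norm_of_nonneg (fejerAt_nonneg hL u t)]
    have := fejer_le (L * (u - t))
    have h2 : (1 + (L * (u - t)) ^ 2)⁻¹ ≤ 1 := inv_le_one_of_one_le₀ (by nlinarith [sq_nonneg (L * (u - t))])
    unfold fejerAt
    nlinarith
  have main : ∀ n, ((∫ t in Set.Ioi (0:ℝ), S t * Real.exp (-t) * Real.exp (-δ n * t) *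
        fejerAt L u t) - c * ∫ t in Set.Ioi (0:ℝ), Real.exp (-δ n * t) * fejerAt L u t) =
      (∫ τ in (0:ℝ)..L, ((1 - τ / L : ℝ) : ℂ) *
        (Complex.exp (u * τ * Complex.I) * G (δ n + τ * Complex.I) +
          Complex.exp (-(u * τ * Complex.I)) * G (δ n - τ * Complex.I))).re := by
    intro n
    have h := integral_mul_fejer (hφ n) hL u
    have h3 : ∫ t in Set.Ioi (0:ℝ), (((S t * Real.exp (-t) - c) * Real.exp (-δ n * t) : ℝ) : ℂ) *
        ((L * fejer (L * (u - t)) : ℝ) : ℂ) = ((∫ t in Set.Ioi (0:ℝ), ((S t * Real.exp (-t) - c) *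
        Real.exp (-δ n * t) * fejerAt L u t) : ℝ) : ℂ) := by
      rw [← integral_complex_ofReal]
      congr 1
      ext t
      simp [fejerAt]
    rw [h3] at h
    have h4 : ∫ t in Set.Ioi (0:ℝ), ((S t * Real.exp (-t) - c) *
        Real.exp (-δ n * t) * fejerAt L u t) = ((∫ t in Set.Ioi (0:ℝ), S t * Real.exp (-t) *
        Real.exp (-δ n * t) * fejerAt L u t) -
        c * ∫ t in Set.Ioi (0:ℝ), Real.exp (-δ n * t) * fejerAt L u t) := by
      rw [← integral_const_mul, ← integral_sub]
      · congr 1; ext t; ring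
      · simp_rw [mul_comm _ (fejerAt L u _)]
        exact (hSint _ (hδ n)).bdd_mul (measurable_fejerAt L u).aestronglyMeasurable
          (Eventually.of_forall hKb)
      · apply Integrable.const_mul
        simp_rw [mul_comm _ (fejerAt L u _)]
        exact (hexpint n).bdd_mul (measurable_fejerAt L u).aestronglyMeasurable
          (Eventually.of_forall hKb)
    rw [← h4, ← Complex.ofReal_re (∫ t in Set.Ioi (0:ℝ), _), h]
    congr 1
    refine intervalIntegral.integral_congr fun τ _ => ?_
    rw [hGF _ (by simpa using hδ n), hGF _ (by simpa using hδ n)]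
    congr 3
    · congr 1
      ext t
      push_cast
      rw [mul_assoc, ← Complex.exp_add]
      congr 2
      ring
    · congr 1
      ext t
      push_cast
      rw [mul_assoc, ← Complex.exp_add]
      congr 2
      ring
  have lim1 : Tendsto (fun n => ∫ t in Set.Ioi (0:ℝ), Real.exp (-δ n * t) * fejerAt L u t) atTop
      (𝓝 (∫ t in Set.Ioi (0:ℝ), fejerAt L u t)) := by
    refine tendsto_integral_of_dominated_convergence (fejerAt L u) ?_ hK ?_ ?_
    · intro n
      have := measurable_fejerAt L u
      exact Measurable.aestronglyMeasurable (by fun_prop)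
    · intro n
      filter_upwards [ae_restrict_mem measurableSet_Ioi] with t ht
      have ht' : 0 < t := ht
      rw [Real.norm_of_nonneg (mul_nonneg (Real.exp_pos _).le (fejerAt_nonneg hL u t))]
      apply mul_le_of_le_one_left (fejerAt_nonneg hL u t)
      rw [Real.exp_le_one_iff]
      nlinarith [hδ n]
    · refine Eventually.of_forall fun t => ?_
      have : Tendsto (fun n => Real.exp (-δ n * t) * fejerAt L u t) atTop
          (𝓝 (Real.exp (-0 * t) * fejerAt L u t)) := by
        apply Tendsto.mul_const
        exact (Real.continuous_exp.tendsto _).comp ((hδ0.neg).mul_const t)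
      simpa using this
  have lim2 : Tendsto (fun n => ∫ τ in (0:ℝ)..L, ((1 - τ / L : ℝ) : ℂ) *
        (Complex.exp (u * τ * Complex.I) * G (δ n + τ * Complex.I) +
          Complex.exp (-(u * τ * Complex.I)) * G (δ n - τ * Complex.I))) atTop
      (𝓝 (∫ τ in (0:ℝ)..L, ((1 - τ / L : ℝ) : ℂ) *
        (Complex.exp (u * τ * Complex.I) * G (τ * Complex.I) +
          Complex.exp (-(u * τ * Complex.I)) * G (-(τ * Complex.I))))) := by
    obtain ⟨M, hM⟩ : ∃ M, ∀ d ∈ Set.Icc (0:ℝ) 1, ∀ τ ∈ Set.Icc (-L) L,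
        ‖G (d + τ * Complex.I)‖ ≤ M := by
      have hc : IsCompact (Set.Icc (0:ℝ) 1 ×ˢ Set.Icc (-L) L) := isCompact_Icc.prod isCompact_Icc
      have hcont : ContinuousOn (fun p : ℝ × ℝ => G (p.1 + p.2 * Complex.I))
          (Set.Icc (0:ℝ) 1 ×ˢ Set.Icc (-L) L) := by
        apply hG.comp (by fun_prop)
        rintro ⟨d, τ⟩ ⟨hd, _⟩
        simpa using hd.1
      obtain ⟨M, hM⟩ := hc.exists_bound_of_continuousOn hcont
      exact ⟨M, fun d hd τ hτ => hM (d, τ) ⟨hd, hτ⟩⟩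
    have hG' : ∀ τ : ℝ, Tendsto (fun n => G (δ n + τ * Complex.I)) atTop
        (𝓝 (G (τ * Complex.I))) := by
      intro τ
      have h0 := hG (τ * Complex.I) (by simp)
      refine h0.tendsto.comp (tendsto_nhdsWithin_iff.2 ⟨?_, ?_⟩)
      · have : Tendsto (fun n => ((δ n : ℝ) : ℂ) + τ * Complex.I) atTop
            (𝓝 (((0:ℝ) : ℂ) + τ * Complex.I)) :=
          ((Complex.continuous_ofReal.tendsto _).comp hδ0).add_const _
        simpa using this
      · refine Eventually.of_forall fun n => ?_
        simpa using (hδ n).le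
    refine intervalIntegral.tendsto_integral_filter_of_dominated_convergence
      (fun _ => 2 * M) ?_ ?_ ?_ ?_
    · refine Eventually.of_forall fun n => ?_
      have : Continuous (fun τ : ℝ => G (δ n + τ * Complex.I)) := by
        rw [← continuousOn_univ]
        apply hG.comp (by fun_prop)
        intro τ _
        simpa using (hδ n).le
      have h' : Continuous (fun τ : ℝ => G (δ n - τ * Complex.I)) := by
        have := this.comp continuous_neg
        simpa [Function.comp_def, sub_eq_add_neg] using this
      apply Continuous.aestronglyMeasurable
      exact Continuous.mul (by fun_prop) (((by fun_prop : Continuous fun τ : ℝ =>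
        Complex.exp (u * τ * Complex.I)).mul this).add ((by fun_prop : Continuous fun τ : ℝ =>
        Complex.exp (-(u * τ * Complex.I))).mul h'))
    · refine Eventually.of_forall fun n => Eventually.of_forall fun τ hτ => ?_
      rw [Set.uIoc_of_le hL.le] at hτ
      have hd : δ n ∈ Set.Icc (0:ℝ) 1 := ⟨(hδ n).le, hδ1 n⟩
      have g1 := hM _ hd τ ⟨by linarith [hτ.1], hτ.2⟩
      have g2 := hM _ hd (-τ) ⟨by linarith [hτ.2], by linarith [hτ.1]⟩
      have e1 : ‖Complex.exp (u * τ * Complex.I)‖ = 1 := by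
        simpa using Complex.norm_exp_ofReal_mul_I (u * τ)
      have e2 : ‖Complex.exp (-(u * τ * Complex.I))‖ = 1 := by
        simpa using Complex.norm_exp_ofReal_mul_I (-(u * τ))
      have e3 : ‖((1 - τ / L : ℝ) : ℂ)‖ ≤ 1 := by
        rw [Complex.norm_real, Real.norm_eq_abs, abs_le]
        have q1 : 0 ≤ τ / L := div_nonneg hτ.1.le hL.le
        have q2 : τ / L ≤ 1 := (div_le_one hL).2 hτ.2
        constructor <;> linarith
      rw [norm_mul]
      push_cast at g2
      rw [neg_mul, ← sub_eq_add_neg] at g2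
      calc _ ≤ 1 * (1 * ‖G (δ n + τ * Complex.I)‖ + 1 * ‖G (δ n - τ * Complex.I)‖) := by
            apply mul_le_mul e3 _ (norm_nonneg _) zero_le_one
            refine (norm_add_le _ _).trans ?_
            rw [norm_mul, norm_mul, e1, e2]
        _ ≤ 2 * M := by linarith
    · exact intervalIntegrable_const
    · refine Eventually.of_forall fun τ _ => ?_
      apply Tendsto.const_mul
      refine ((hG' τ).const_mul _).add (Tendsto.const_mul _ ?_)
      simpa [sub_eq_add_neg] using hG' (-τ)
  have lim3 := ((Complex.continuous_re.tendsto _).comp lim2).add (lim1.const_mul c)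
  refine lim3.congr fun n => ?_
  simp only [Function.comp]
  rw [← main n]
  ring

lemma tendsto_fejer_smoothing {S : ℝ → ℝ} {c : ℝ} {G : ℂ → ℂ}
    (hS : ∀ t, 0 ≤ S t)
    (hSint : ∀ δ : ℝ, 0 < δ → IntegrableOn (fun t => S t * Real.exp (-t) * Real.exp (-δ * t))
      (Set.Ioi 0))
    (hG : ContinuousOn G {s | 0 ≤ s.re})
    (hGF : ∀ s : ℂ, 0 < s.re → G s = ∫ t in Set.Ioi (0:ℝ),
      ((S t * Real.exp (-t) - c : ℝ) : ℂ) * Complex.exp (-s * t))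
    {L : ℝ} (hL : 0 < L) :
    (∀ u, IntegrableOn (fun t => S t * Real.exp (-t) * fejerAt L u t) (Set.Ioi 0)) ∧
    Tendsto (fun u => ∫ t in Set.Ioi (0:ℝ), S t * Real.exp (-t) * fejerAt L u t) atTop
      (𝓝 (c * ∫ x, fejer x)) := by
  let δ : ℕ → ℝ := fun n => 1 / ((n : ℝ) + 1)
  have hδ : ∀ n, 0 < δ n := fun n => by positivity
  have hδ0 : Tendsto δ atTop (𝓝 0) := tendsto_one_div_add_atTop_nhds_zero_nat
  have hδ1 : ∀ n, δ n ≤ 1 := fun n => by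
    simp only [δ]
    rw [div_le_one (by positivity)]
    have : (0:ℝ) ≤ n := Nat.cast_nonneg n
    linarith
  have hanti : Antitone δ := by
    intro m n hmn
    simp only [δ]
    gcongr
  have key : ∀ u, IntegrableOn (fun t => S t * Real.exp (-t) * fejerAt L u t) (Set.Ioi 0) ∧
      ∫ t in Set.Ioi (0:ℝ), S t * Real.exp (-t) * fejerAt L u t =
      (∫ τ in (0:ℝ)..L, ((1 - τ / L : ℝ) : ℂ) *
        (Complex.exp (u * τ * Complex.I) * G (τ * Complex.I) +
          Complex.exp (-(u * τ * Complex.I)) * G (-(τ * Complex.I)))).re +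
        c * ∫ t in Set.Ioi (0:ℝ), fejerAt L u t := by
    intro u
    have h := tendsto_laplace_fejer hSint hG hGF hL u hδ hδ0 hδ1
    set V := (∫ τ in (0:ℝ)..L, ((1 - τ / L : ℝ) : ℂ) *
        (Complex.exp (u * τ * Complex.I) * G (τ * Complex.I) +
          Complex.exp (-(u * τ * Complex.I)) * G (-(τ * Complex.I)))).re +
        c * ∫ t in Set.Ioi (0:ℝ), fejerAt L u t with hV
    have hKb : ∀ t, ‖fejerAt L u t‖ ≤ 5 * L := by
      intro t
      rw [Real.norm_of_nonneg (fejerAt_nonneg hL u t)]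
      have := fejer_le (L * (u - t))
      have h2 : (1 + (L * (u - t)) ^ 2)⁻¹ ≤ 1 :=
        inv_le_one_of_one_le₀ (by nlinarith [sq_nonneg (L * (u - t))])
      unfold fejerAt
      nlinarith
    have hpos : ∀ a t, 0 ≤ S t * Real.exp (-t) * Real.exp a * fejerAt L u t := fun a t =>
      mul_nonneg (mul_nonneg (mul_nonneg (hS t) (Real.exp_pos _).le) (Real.exp_pos _).le)
        (fejerAt_nonneg hL u t)
    have hFint : ∀ n, IntegrableOn (fun t => S t * Real.exp (-t) * Real.exp (-δ n * t) *
        fejerAt L u t) (Set.Ioi 0) := by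
      intro n
      simp_rw [mul_comm _ (fejerAt L u _)]
      exact (hSint _ (hδ n)).bdd_mul (measurable_fejerAt L u).aestronglyMeasurable
          (Eventually.of_forall hKb)
    have hptw : ∀ t, Tendsto (fun n => S t * Real.exp (-t) * Real.exp (-δ n * t) *
        fejerAt L u t) atTop (𝓝 (S t * Real.exp (-t) * fejerAt L u t)) := by
      intro t
      have : Tendsto (fun n => S t * Real.exp (-t) * Real.exp (-δ n * t) * fejerAt L u t) atTop
          (𝓝 (S t * Real.exp (-t) * Real.exp (-0 * t) * fejerAt L u t)) := by
        apply Tendsto.mul_const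
        apply Tendsto.const_mul
        exact (Real.continuous_exp.tendsto _).comp ((hδ0.neg).mul_const t)
      simpa using this
    have hl := lintegral_tendsto_of_tendsto_of_monotone (μ := volume.restrict (Set.Ioi (0:ℝ)))
      (f := fun n t => ENNReal.ofReal (S t * Real.exp (-t) * Real.exp (-δ n * t) * fejerAt L u t))
      (F := fun t => ENNReal.ofReal (S t * Real.exp (-t) * fejerAt L u t))
      (fun n => (hFint n).aestronglyMeasurable.aemeasurable.ennreal_ofReal)
      (by
        filter_upwards [ae_restrict_mem measurableSet_Ioi] with t ht m n hmn
        apply ENNReal.ofReal_le_ofReal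
        apply mul_le_mul_of_nonneg_right _ (fejerAt_nonneg hL u t)
        apply mul_le_mul_of_nonneg_left _ (mul_nonneg (hS t) (Real.exp_pos _).le)
        rw [Real.exp_le_exp]
        have ht' : 0 < t := ht
        have := hanti hmn
        nlinarith)
      (Eventually.of_forall fun t => (ENNReal.continuous_ofReal.tendsto _).comp (hptw t))
    have hl2 : ∀ n, ∫⁻ t in Set.Ioi (0:ℝ), ENNReal.ofReal (S t * Real.exp (-t) *
        Real.exp (-δ n * t) * fejerAt L u t) = ENNReal.ofReal (∫ t in Set.Ioi (0:ℝ), S t *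
        Real.exp (-t) * Real.exp (-δ n * t) * fejerAt L u t) := fun n =>
      (ofReal_integral_eq_lintegral_ofReal (hFint n) (Eventually.of_forall fun t => hpos _ t)).symm
    simp_rw [hl2] at hl
    have hl3 := tendsto_nhds_unique hl ((ENNReal.continuous_ofReal.tendsto _).comp h)
    have hV0 : 0 ≤ V := ge_of_tendsto' h fun n => integral_nonneg fun t => hpos _ t
    have hmeas : AEStronglyMeasurable (fun t => S t * Real.exp (-t) * fejerAt L u t)
        (volume.restrict (Set.Ioi 0)) :=
      aestronglyMeasurable_of_tendsto_ae atTop (fun n => (hFint n).aestronglyMeasurable)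
        (Eventually.of_forall hptw)
    have hnn : ∀ t, 0 ≤ S t * Real.exp (-t) * fejerAt L u t := fun t =>
      mul_nonneg (mul_nonneg (hS t) (Real.exp_pos _).le) (fejerAt_nonneg hL u t)
    refine ⟨⟨hmeas, ?_⟩, ?_⟩
    · rw [hasFiniteIntegral_iff_ofReal (Eventually.of_forall hnn), hl3]
      exact ENNReal.ofReal_lt_top
    · rw [integral_eq_lintegral_of_nonneg_ae (Eventually.of_forall hnn) hmeas, hl3,
        ENNReal.toReal_ofReal hV0]
  refine ⟨fun u => (key u).1, ?_⟩
  have hc1 : ContinuousOn (fun τ : ℝ => G (τ * Complex.I)) (Set.Icc 0 L) :=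
    hG.comp (by fun_prop) (fun τ _ => by simp)
  have hc2 : ContinuousOn (fun τ : ℝ => G (-(τ * Complex.I))) (Set.Icc 0 L) :=
    hG.comp (by fun_prop) (fun τ _ => by simp)
  have l1 := (Complex.continuous_re.tendsto _).comp (tendsto_tent_integral _ _ hL hc1 hc2)
  have l2 := l1.add ((tendsto_setIntegral_fejerAt_Ioi hL).const_mul c)
  rw [Complex.zero_re, zero_add] at l2
  exact l2.congr fun u => (key u).2.symm

/-- **Wiener–Ikehara theorem**, in Laplace transform form. -/
theorem wiener_ikehara {S : ℝ → ℝ} {c : ℝ} {G : ℂ → ℂ} (hmono : Monotone S)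
    (hS : ∀ t, 0 ≤ S t)
    (hSint : ∀ δ : ℝ, 0 < δ → IntegrableOn (fun t => S t * Real.exp (-t) * Real.exp (-δ * t))
      (Set.Ioi 0))
    (hG : ContinuousOn G {s | 0 ≤ s.re})
    (hGF : ∀ s : ℂ, 0 < s.re → G s = ∫ t in Set.Ioi (0:ℝ),
      ((S t * Real.exp (-t) - c : ℝ) : ℂ) * Complex.exp (-s * t)) :
    Tendsto (fun t => S t * Real.exp (-t)) atTop (𝓝 c) := by
  set κ := ∫ x, fejer x with hκ
  have hκ0 : 0 < κ := integral_fejer_pos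
  let q : ℕ → ℝ := fun n => ∫ x in Set.Icc (-(n : ℝ)) n, fejer x
  have hq : Tendsto q atTop (𝓝 κ) := tendsto_integral_fejer_Icc
  have hg0 : ∀ t, 0 ≤ S t * Real.exp (-t) := fun t => mul_nonneg (hS t) (Real.exp_pos _).le
  have key := fun {L : ℝ} (hL : 0 < L) => tendsto_fejer_smoothing hS hSint hG hGF hL
  have hinv : Tendsto (fun n : ℕ => 2 * (1 / (n : ℝ))) atTop (𝓝 0) := by
    simpa using tendsto_one_div_atTop_nhds_zero_nat.const_mul (2:ℝ)
  have hqwin : ∀ (n : ℕ), 0 < n → ∀ u : ℝ,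
      ∫ t in Set.Icc (u - 1 / n) (u + 1 / n), fejerAt ((n : ℝ) ^ 2) u t = q n := by
    intro n hn u
    have hn' : (0:ℝ) < n := by exact_mod_cast hn
    rw [setIntegral_fejerAt_Icc (by positivity)]
    have : (n : ℝ) ^ 2 * (1 / n) = n := by field_simp
    rw [this]
  -- the upper bound
  have hup : ∀ b, c < b → ∀ᶠ u in atTop, S u * Real.exp (-u) < b := by
    intro b hb
    have lim : Tendsto (fun n : ℕ => Real.exp (2 * (1 / (n : ℝ))) * (c * κ) / q n) atTop
        (𝓝 (Real.exp 0 * (c * κ) / κ)) :=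
      (((Real.continuous_exp.tendsto _).comp hinv).mul_const _).div hq hκ0.ne'
    have hc : Real.exp 0 * (c * κ) / κ = c := by rw [Real.exp_zero]; field_simp
    rw [hc] at lim
    obtain ⟨n, hn1, hn2, hn3⟩ := ((lim.eventually_lt_const hb).and
      ((hq.eventually_const_lt hκ0).and (eventually_gt_atTop 0))).exists
    have hn' : (0:ℝ) < n := by exact_mod_cast hn3
    have hL : (0:ℝ) < (n : ℝ) ^ 2 := by positivity
    obtain ⟨hi, hl⟩ := key hL
    have hl' := hl.comp (tendsto_atTop_add_const_right atTop (1 / (n : ℝ)) tendsto_id)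
    have hl2 := (hl'.const_mul (Real.exp (2 * (1 / (n : ℝ))))).div_const (q n)
    filter_upwards [hl2.eventually_lt_const hn1, eventually_gt_atTop 0] with u hu hu0
    refine lt_of_le_of_lt ?_ hu
    rw [le_div_iff₀ hn2]
    simp only [Function.comp, id]
    set v := u + 1 / (n : ℝ) with hv
    have hsub : Set.Icc (v - 1 / n) (v + 1 / n) ⊆ Set.Ioi (0:ℝ) := by
      intro t ht
      have := ht.1
      simp only [Set.mem_Ioi]
      rw [hv] at this
      linarith
    have hK := integrable_fejerAt hL v
    have b1 : S u * Real.exp (-u) * Real.exp (-(2 * (1 / (n : ℝ)))) * q n ≤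
        ∫ t in Set.Ioi (0:ℝ), S t * Real.exp (-t) * fejerAt ((n : ℝ) ^ 2) v t := by
      rw [← hqwin n hn3 v, ← integral_const_mul]
      calc _ ≤ ∫ t in Set.Icc (v - 1 / n) (v + 1 / n),
              S t * Real.exp (-t) * fejerAt ((n : ℝ) ^ 2) v t := by
            refine setIntegral_mono_on (hK.integrableOn.const_mul _) ((hi v).mono_set hsub)
              measurableSet_Icc fun t ht => ?_
            apply mul_le_mul_of_nonneg_right _ (fejerAt_nonneg hL v t)
            rw [mul_assoc, ← Real.exp_add]
            have h1 := ht.1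
            have h2 := ht.2
            rw [hv] at h1 h2
            apply mul_le_mul (hmono (by linarith)) _ (Real.exp_pos _).le (hS t)
            rw [Real.exp_le_exp]
            linarith
        _ ≤ _ := by
            refine setIntegral_mono_set (hi v) ?_ (LE.le.eventuallyLE hsub)
            exact Eventually.of_forall fun t => mul_nonneg (hg0 t) (fejerAt_nonneg hL v t)
    calc S u * Real.exp (-u) * q n = Real.exp (2 * (1 / (n : ℝ))) *
          (S u * Real.exp (-u) * Real.exp (-(2 * (1 / (n : ℝ)))) * q n) := by
          rw [Real.exp_neg (2 * (1 / (n:ℝ)))]; field_simp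
      _ ≤ _ := mul_le_mul_of_nonneg_left b1 (Real.exp_pos _).le
  -- a global bound
  obtain ⟨M, hM⟩ : ∃ M, ∀ t, 0 < t → S t * Real.exp (-t) ≤ M := by
    obtain ⟨T, hT⟩ := eventually_atTop.1 (hup (c + 1) (by linarith))
    refine ⟨max (c + 1) (S T), fun t ht => ?_⟩
    rcases le_total T t with h | h
    · exact (hT t h).le.trans (le_max_left _ _)
    · refine le_trans ?_ (le_max_right _ _)
      calc S t * Real.exp (-t) ≤ S T * 1 := by
            apply mul_le_mul (hmono h) _ (Real.exp_pos _).le (hS T)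
            rw [Real.exp_le_one_iff]; linarith
        _ = S T := mul_one _
  have hM0 : 0 ≤ M := (hg0 1).trans (hM 1 one_pos)
  -- the lower bound
  have hlow : ∀ b, b < c → ∀ᶠ u in atTop, b < S u * Real.exp (-u) := by
    intro b hb
    have lim : Tendsto (fun n : ℕ => Real.exp (-(2 * (1 / (n : ℝ)))) * ((c * κ - M * (κ - q n)) / q n))
        atTop (𝓝 (Real.exp (-0) * ((c * κ - M * (κ - κ)) / κ))) := by
      refine Tendsto.mul ((Real.continuous_exp.tendsto _).comp hinv.neg) ?_
      exact (((hq.const_sub κ).const_mul M).const_sub (c * κ)).div hq hκ0.ne'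
    have hc : Real.exp (-0) * ((c * κ - M * (κ - κ)) / κ) = c := by
      rw [neg_zero, Real.exp_zero]; field_simp; ring
    rw [hc] at lim
    obtain ⟨n, hn1, hn2, hn3⟩ := ((lim.eventually_const_lt hb).and
      ((hq.eventually_const_lt hκ0).and (eventually_gt_atTop 0))).exists
    have hn' : (0:ℝ) < n := by exact_mod_cast hn3
    have hL : (0:ℝ) < (n : ℝ) ^ 2 := by positivity
    obtain ⟨hi, hl⟩ := key hL
    have hl' := hl.comp (tendsto_atTop_add_const_right atTop (-(1 / (n : ℝ))) tendsto_id)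
    have hl2 := ((hl'.sub_const (M * (κ - q n))).div_const (q n)).const_mul
      (Real.exp (-(2 * (1 / (n : ℝ)))))
    filter_upwards [hl2.eventually_const_lt hn1, eventually_gt_atTop (2 * (1 / (n : ℝ)))]
      with u hu hu0
    refine hu.trans_le ?_
    simp only [Function.comp, id]
    set v := u + -(1 / (n : ℝ)) with hv
    set A := S u * Real.exp (-u) * Real.exp (2 * (1 / (n : ℝ))) with hA
    have hA0 : 0 ≤ A := mul_nonneg (hg0 u) (Real.exp_pos _).le
    have hK := integrable_fejerAt hL v
    have b1 : ∫ t in Set.Ioi (0:ℝ), S t * Real.exp (-t) * fejerAt ((n : ℝ) ^ 2) v t ≤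
        A * q n + M * (κ - q n) := by
      have hI2 : Integrable ((Set.Icc (v - 1 / n) (v + 1 / n)).indicator
          (fun t => (A - M) * fejerAt ((n : ℝ) ^ 2) v t)) :=
        (hK.const_mul (A - M)).indicator measurableSet_Icc
      calc _ ≤ ∫ t in Set.Ioi (0:ℝ), (M * fejerAt ((n : ℝ) ^ 2) v t +
              (Set.Icc (v - 1 / n) (v + 1 / n)).indicator
                (fun t => (A - M) * fejerAt ((n : ℝ) ^ 2) v t) t) := by
            refine setIntegral_mono_on (hi v) ((hK.const_mul M).add hI2).integrableOn
              measurableSet_Ioi fun t ht => ?_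
            by_cases h : t ∈ Set.Icc (v - 1 / n) (v + 1 / n)
            · rw [Set.indicator_of_mem h, ← add_mul]
              apply mul_le_mul_of_nonneg_right _ (fejerAt_nonneg hL v t)
              rw [add_sub_cancel, hA, mul_assoc, ← Real.exp_add]
              have h1 := h.1
              have h2 := h.2
              rw [hv] at h1 h2
              apply mul_le_mul (hmono (by linarith)) _ (Real.exp_pos _).le (hS u)
              rw [Real.exp_le_exp]
              linarith
            · rw [Set.indicator_of_notMem h, add_zero]
              exact mul_le_mul_of_nonneg_right (hM t ht) (fejerAt_nonneg hL v t)
        _ ≤ ∫ t, (M * fejerAt ((n : ℝ) ^ 2) v t +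
              (Set.Icc (v - 1 / n) (v + 1 / n)).indicator
                (fun t => (A - M) * fejerAt ((n : ℝ) ^ 2) v t) t) := by
            refine setIntegral_le_integral ((hK.const_mul M).add hI2)
              (Eventually.of_forall fun t => ?_)
            by_cases h : t ∈ Set.Icc (v - 1 / n) (v + 1 / n)
            · simp only [Pi.zero_apply, Set.indicator_of_mem h]
              rw [← add_mul, add_sub_cancel]
              exact mul_nonneg hA0 (fejerAt_nonneg hL v t)
            · simp only [Pi.zero_apply, Set.indicator_of_notMem h, add_zero]
              exact mul_nonneg hM0 (fejerAt_nonneg hL v t)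
        _ = M * κ + (A - M) * q n := by
            rw [integral_add (hK.const_mul M) hI2, integral_const_mul, integral_fejerAt hL,
              integral_indicator measurableSet_Icc, integral_const_mul, hqwin n hn3]
        _ = _ := by ring
    have b2 : ((∫ t in Set.Ioi (0:ℝ), S t * Real.exp (-t) * fejerAt ((n : ℝ) ^ 2) v t) -
        M * (κ - q n)) / q n ≤ A := by
      rw [div_le_iff₀ hn2]
      linarith
    calc _ ≤ Real.exp (-(2 * (1 / (n : ℝ)))) * A := mul_le_mul_of_nonneg_left b2 (Real.exp_pos _).le
      _ = _ := by rw [hA, Real.exp_neg (2 * (1 / (n:ℝ)))]; field_simp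
  exact tendsto_order.2 ⟨hlow, hup⟩

/-- The Laplace transform of a function of exponential growth is holomorphic. -/
theorem differentiableOn_laplace {E : ℝ → ℂ} {C a : ℝ}
    (hE : AEStronglyMeasurable E (volume.restrict (Set.Ioi 0)))
    (hb : ∀ t, 0 < t → ‖E t‖ ≤ C * Real.exp (a * t)) :
    DifferentiableOn ℂ (fun s : ℂ => ∫ t in Set.Ioi (0:ℝ), E t * Complex.exp (-s * t))
      {s | a < s.re} := by
  intro s hs
  simp only [Set.mem_ofPred_eq] at hs
  apply DifferentiableAt.differentiableWithinAt
  obtain ⟨ε, hε⟩ : ∃ ε, ε = (s.re - a) / 2 := ⟨_, rfl⟩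
  have hε0 : 0 < ε := by rw [hε]; linarith
  have hC : 0 ≤ C := by
    have := (norm_nonneg _).trans (hb 1 one_pos)
    exact nonneg_of_mul_nonneg_left this (Real.exp_pos _)
  have hmeas : ∀ z : ℂ, AEStronglyMeasurable (fun t : ℝ => E t * Complex.exp (-z * t))
      (volume.restrict (Set.Ioi 0)) := fun z =>
    hE.mul (by fun_prop : Continuous fun t : ℝ => Complex.exp (-z * t)).aestronglyMeasurable
  have hn : ∀ z : ℂ, a + ε ≤ z.re → ∀ t : ℝ, 0 < t → ‖E t * Complex.exp (-z * t)‖ ≤ C * Real.exp (-ε * t) := by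
    intro z hz t ht
    rw [norm_mul, Complex.norm_exp]
    calc _ ≤ C * Real.exp (a * t) * Real.exp ((-z * t).re) := by gcongr; exact hb t ht
      _ = C * Real.exp (a * t + (-z * t).re) := by rw [Real.exp_add, mul_assoc]
      _ ≤ _ := by
        gcongr
        simp only [Complex.mul_re, Complex.neg_re, Complex.ofReal_re, Complex.ofReal_im, mul_zero, sub_zero]
        nlinarith
  have hSint : Integrable (fun t : ℝ => C * Real.exp (-ε * t)) (volume.restrict (Set.Ioi 0)) :=
    (exp_neg_integrableOn_Ioi 0 hε0).const_mul C
  have hSint' : Integrable (fun t : ℝ => (2 * C / ε) * Real.exp (-(ε / 2) * t)) (volume.restrict (Set.Ioi 0)) :=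
    (exp_neg_integrableOn_Ioi 0 (half_pos hε0)).const_mul _
  refine (hasDerivAt_integral_of_dominated_loc_of_deriv_le (s := {z : ℂ | a + ε < z.re})
    (F := fun z t => E t * Complex.exp (-z * t))
    (F' := fun z t => E t * (Complex.exp (-z * t) * (-t)))
    (bound := fun t => (2 * C / ε) * Real.exp (-(ε / 2) * t)) ?_ ?_ ?_ ?_ ?_ hSint' ?_).2.differentiableAt
  · apply (isOpen_lt continuous_const Complex.continuous_re).mem_nhds
    simp only [Set.mem_ofPred_eq]; linarith
  · exact Eventually.of_forall hmeas
  · refine hSint.mono' (hmeas s) ?_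
    filter_upwards [ae_restrict_mem measurableSet_Ioi] with t ht
    exact hn s (by linarith) t ht
  · exact hE.mul (by fun_prop : Continuous fun t : ℝ => Complex.exp (-s * t) * (-t)).aestronglyMeasurable
  · filter_upwards [ae_restrict_mem measurableSet_Ioi] with t ht z hz
    have ht' : (0:ℝ) < t := ht
    have h1 := hn z (le_of_lt hz) t ht
    rw [← mul_assoc, norm_mul, norm_neg, Complex.norm_real, Real.norm_of_nonneg ht'.le]
    have h2 : Real.exp (-ε * t) = Real.exp (-(ε/2) * t) * Real.exp (-(ε/2) * t) := by
      rw [← Real.exp_add]; congr 1; ring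
    have h3 : t * Real.exp (-(ε/2) * t) ≤ 2 / ε := by
      have : ε / 2 * t ≤ Real.exp (ε / 2 * t) := by
        have := Real.add_one_le_exp (ε / 2 * t); linarith
      rw [neg_mul, Real.exp_neg, ← div_eq_mul_inv, div_le_iff₀ (Real.exp_pos _)]
      calc t = 2 / ε * (ε / 2 * t) := by field_simp
        _ ≤ _ := by gcongr
    calc _ ≤ C * Real.exp (-ε * t) * t := by gcongr
      _ = C * Real.exp (-(ε/2) * t) * (t * Real.exp (-(ε/2) * t)) := by rw [h2]; ring
      _ ≤ C * Real.exp (-(ε/2) * t) * (2 / ε) := by gcongr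
      _ = _ := by ring
  · refine Eventually.of_forall fun t z _ => ?_
    have h : HasDerivAt (fun z : ℂ => -z * t) (-t : ℂ) z := by
      simpa using (hasDerivAt_id z).neg.mul_const (t : ℂ)
    exact (h.cexp).const_mul (E t)

/-- The summatory function of the generalized Dirichlet series with coefficients `c` and
exponents `lam`. -/
noncomputable def summatory {ι : Type*} (lam : ι → ℝ) (c : ι → ℂ) (t : ℝ) : ℂ :=
  ∑' i, if lam i ≤ t then c i else 0

/-- The generalized Dirichlet series with coefficients `c` and exponents `lam`. -/
noncomputable def dirSeries {ι : Type*} (lam : ι → ℝ) (c : ι → ℂ) (s : ℂ) : ℂ :=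
  ∑' i, c i * Complex.exp (-s * lam i)

section dir
variable {ι : Type*} {lam : ι → ℝ} {c : ι → ℂ} {σ : ℝ}

theorem norm_dir_term (s : ℂ) (i : ι) :
    ‖c i * Complex.exp (-s * lam i)‖ = ‖c i‖ * Real.exp (-s.re * lam i) := by
  rw [norm_mul, Complex.norm_exp]; simp

theorem summatory_term_bound (hσ : 0 ≤ σ) (t : ℝ) (i : ι) :
    ‖(if lam i ≤ t then c i else 0)‖ ≤ ‖c i‖ * Real.exp (-σ * lam i) * Real.exp (σ * t) := by
  split_ifs with h
  · rw [mul_assoc, ← Real.exp_add]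
    have : 1 ≤ Real.exp (-σ * lam i + σ * t) := Real.one_le_exp (by nlinarith)
    nlinarith [norm_nonneg (c i)]
  · rw [norm_zero]; positivity

theorem summable_summatory (hσ : 0 ≤ σ) (hs : Summable fun i => ‖c i‖ * Real.exp (-σ * lam i)) (t : ℝ) :
    Summable fun i => if lam i ≤ t then c i else 0 :=
  Summable.of_norm_bounded (hs.mul_right _) (summatory_term_bound hσ t)

theorem norm_summatory_le (hσ : 0 ≤ σ) (hs : Summable fun i => ‖c i‖ * Real.exp (-σ * lam i)) (t : ℝ) :
    ‖summatory lam c t‖ ≤ (∑' i, ‖c i‖ * Real.exp (-σ * lam i)) * Real.exp (σ * t) :=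
  tsum_of_norm_bounded (hs.hasSum.mul_right _) (summatory_term_bound hσ t)

theorem measurable_summatory [Countable ι] (hσ : 0 ≤ σ)
    (hs : Summable fun i => ‖c i‖ * Real.exp (-σ * lam i)) : Measurable (summatory lam c) := by
  refine measurable_of_tendsto_metrizable' (atTop : Filter (Finset ι))
    (f := fun F t => ∑ i ∈ F, if lam i ≤ t then c i else 0) (fun F => ?_) ?_
  · refine Finset.measurable_sum _ fun i _ => ?_
    exact Measurable.ite (measurableSet_le measurable_const measurable_id) measurable_const measurable_const
  · rw [tendsto_pi_nhds]
    intro t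
    exact (summable_summatory hσ hs t).hasSum

theorem summable_mono_exp (hlam : ∀ i, 0 ≤ lam i) {τ : ℝ} (h : σ ≤ τ)
    (hs : Summable fun i => ‖c i‖ * Real.exp (-σ * lam i)) :
    Summable fun i => ‖c i‖ * Real.exp (-τ * lam i) := by
  refine Summable.of_nonneg_of_le (fun i => by positivity) (fun i => ?_) hs
  gcongr
  exact hlam i

theorem dirSeries_eq_integral [Countable ι] (hlam : ∀ i, 0 ≤ lam i) (hσ : 0 ≤ σ)
    (hs : Summable fun i => ‖c i‖ * Real.exp (-σ * lam i)) {s : ℂ} (h : σ < s.re) :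
    dirSeries lam c s = s * ∫ t in Set.Ioi (0:ℝ), summatory lam c t * Complex.exp (-s * t) := by
  have hs0 : s ≠ 0 := by rintro rfl; simp at h; linarith
  have hsre : 0 < s.re := by linarith
  have hind : ∀ i, (fun t : ℝ => (if lam i ≤ t then c i else 0) * Complex.exp (-s * t)) =
      (Set.Ici (lam i)).indicator (fun t : ℝ => c i * Complex.exp (-s * t)) := by
    intro i; ext t
    by_cases ht : lam i ≤ t
    · rw [Set.indicator_of_mem (by exact ht), if_pos ht]
    · rw [Set.indicator_of_notMem (by exact ht), if_neg ht, zero_mul]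
  have hset : ∀ i, (Set.Ioi (0:ℝ) ∩ Set.Ici (lam i) : Set ℝ) =ᵐ[volume] Set.Ioi (lam i) := by
    intro i
    have h1 : (Set.Ioi (0:ℝ) : Set ℝ) =ᵐ[volume] Set.Ici 0 := Ioi_ae_eq_Ici
    have h2 : (Set.Ici (lam i) : Set ℝ) =ᵐ[volume] Set.Ioi (lam i) := Ioi_ae_eq_Ici.symm
    have h3 : (Set.Ici (0:ℝ) ∩ Set.Ici (lam i)) = Set.Ici (lam i) := by
      rw [Set.Ici_inter_Ici, sup_eq_right.2 (hlam i)]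
    have h4 : (Set.Ioi (0:ℝ) ∩ Set.Ici (lam i) : Set ℝ) =ᵐ[volume]
        (Set.Ici (0:ℝ) ∩ Set.Ici (lam i) : Set ℝ) := h1.inter (ae_eq_refl _)
    rw [h3] at h4
    exact h4.trans h2
  have hre : (-s).re < 0 := by simpa using hsre
  have hterm : ∀ i, ∫ t in Set.Ioi (0:ℝ), (if lam i ≤ t then c i else 0) * Complex.exp (-s * t) =
      c i * Complex.exp (-s * lam i) / s := by
    intro i
    rw [hind, setIntegral_indicator measurableSet_Ici, setIntegral_congr_set (hset i),
      integral_const_mul, integral_exp_mul_complex_Ioi hre]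
    field_simp
  have hnterm : ∀ i, ∫ t in Set.Ioi (0:ℝ), ‖(if lam i ≤ t then c i else 0) * Complex.exp (-s * t)‖ =
      ‖c i‖ * Real.exp (-s.re * lam i) / s.re := by
    intro i
    have : (fun t : ℝ => ‖(if lam i ≤ t then c i else 0) * Complex.exp (-s * t)‖) =
      (Set.Ici (lam i)).indicator (fun t : ℝ => ‖c i‖ * Real.exp (-s.re * t)) := by
      ext t
      have := congrFun (hind i) t
      rw [this, norm_indicator_eq_indicator_norm]
      congr 1
      ext t
      rw [norm_mul, Complex.norm_exp]; simp
    rw [this, setIntegral_indicator measurableSet_Ici, setIntegral_congr_set (hset i),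
      integral_const_mul, integral_exp_mul_Ioi (by linarith)]
    field_simp
  have hI : ∀ i, Integrable (fun t : ℝ => (if lam i ≤ t then c i else 0) * Complex.exp (-s * t))
      (volume.restrict (Set.Ioi 0)) := by
    intro i
    rw [hind]
    exact ((integrableOn_exp_mul_complex_Ioi hre 0).const_mul _).indicator measurableSet_Ici
  have key := hasSum_integral_of_summable_integral_norm hI (by
    simp_rw [hnterm]
    exact (summable_mono_exp hlam h.le hs).div_const _)
  have h4 : ∀ t : ℝ, ∑' i, (if lam i ≤ t then c i else 0) * Complex.exp (-s * t) =
      summatory lam c t * Complex.exp (-s * t) := fun t => tsum_mul_right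
  simp_rw [hterm, h4] at key
  rw [← key.tsum_eq, tsum_div_const, dirSeries]
  field_simp

theorem hasDerivAt_dirSeries (hlam : ∀ i, 0 ≤ lam i)
    (hs : ∀ τ > σ, Summable fun i => ‖c i‖ * Real.exp (-τ * lam i)) {s : ℂ} (h : σ < s.re) :
    HasDerivAt (dirSeries lam c) (-dirSeries lam (fun i => lam i * c i) s) s := by
  obtain ⟨τ, h1, h2⟩ := exists_between h
  have hopen : IsOpen {z : ℂ | τ < z.re} := isOpen_lt continuous_const Complex.continuous_re
  have hd : ∀ (i : ι) (z : ℂ), HasDerivAt (fun z : ℂ => c i * Complex.exp (-z * lam i))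
      (-(lam i * c i * Complex.exp (-z * lam i))) z := by
    intro i z
    have h : HasDerivAt (fun z : ℂ => -z * lam i) (-(lam i) : ℂ) z := by
      simpa using (hasDerivAt_id z).neg.mul_const (lam i : ℂ)
    exact ((h.cexp).const_mul (c i)).congr_deriv (by ring)
  have hb : ∀ (i : ι), ∀ w ∈ {z : ℂ | τ < z.re}, ‖c i * Complex.exp (-w * lam i)‖ ≤
      ‖c i‖ * Real.exp (-τ * lam i) := by
    intro i w hw
    rw [norm_dir_term]
    have : τ < w.re := hw
    gcongr
    exact hlam i
  have hdiff : ∀ (i : ι), DifferentiableOn ℂ (fun z : ℂ => c i * Complex.exp (-z * lam i)) {z : ℂ | τ < z.re} :=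
    fun i z _ => (hd i z).differentiableAt.differentiableWithinAt
  have k1 := Complex.hasSum_deriv_of_summable_norm (hs τ h1) hdiff hopen hb h2
  have k2 := Complex.differentiableOn_tsum_of_summable_norm (hs τ h1) hdiff hopen hb
  have k3 := (k2.differentiableAt (hopen.mem_nhds h2)).hasDerivAt
  rw [← k1.tsum_eq] at k3
  refine k3.congr_deriv ?_
  simp only [dirSeries]
  rw [← tsum_neg]
  exact tsum_congr fun i => (hd i s).deriv

theorem summable_lam_mul (hlam : ∀ i, 0 ≤ lam i)
    (hs : ∀ τ > σ, Summable fun i => ‖c i‖ * Real.exp (-τ * lam i)) {τ : ℝ} (h : σ < τ) :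
    Summable fun i => ‖(lam i : ℂ) * c i‖ * Real.exp (-τ * lam i) := by
  obtain ⟨ρ, h1, h2⟩ := exists_between h
  refine Summable.of_nonneg_of_le (fun i => by positivity) (fun i => ?_) ((hs ρ h1).mul_left (1 / (τ - ρ)))
  rw [norm_mul, Complex.norm_real, Real.norm_of_nonneg (hlam i)]
  have e1 : Real.exp (-τ * lam i) = Real.exp (-ρ * lam i) * (Real.exp ((τ - ρ) * lam i))⁻¹ := by
    rw [← Real.exp_neg, ← Real.exp_add]; congr 1; ring
  have e2 : (τ - ρ) * lam i ≤ Real.exp ((τ - ρ) * lam i) := by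
    have := Real.add_one_le_exp ((τ - ρ) * lam i); linarith
  have e3 : lam i * (Real.exp ((τ - ρ) * lam i))⁻¹ ≤ 1 / (τ - ρ) := by
    rw [← div_eq_mul_inv, div_le_div_iff₀ (Real.exp_pos _) (by linarith)]
    linarith
  calc _ = ‖c i‖ * Real.exp (-ρ * lam i) * (lam i * (Real.exp ((τ - ρ) * lam i))⁻¹) := by rw [e1]; ring
    _ ≤ ‖c i‖ * Real.exp (-ρ * lam i) * (1 / (τ - ρ)) := by gcongr
    _ = _ := by ring

end dir

theorem summatory_ofReal {ι : Type*} (lam u : ι → ℝ) (t : ℝ) :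
    summatory lam (fun i => (u i : ℂ)) t = ((∑' i, if lam i ≤ t then u i else 0 : ℝ) : ℂ) := by
  rw [summatory, Complex.ofReal_tsum]
  exact tsum_congr fun i => by split_ifs <;> simp

/-- The **Wiener–Ikehara theorem** for generalized Dirichlet series. -/
theorem tendsto_summatory_of_dirSeries {ι : Type*} [Countable ι] {lam u : ι → ℝ} {V : ℂ → ℂ}
    (hlam : ∀ i, 0 ≤ lam i) (hu : ∀ i, 0 ≤ u i)
    (hs : ∀ σ > 1, Summable fun i => ‖(u i : ℂ)‖ * Real.exp (-σ * lam i))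
    (hV : ContinuousOn V {s | 1 ≤ s.re})
    (hVU : ∀ s : ℂ, 1 < s.re → dirSeries lam (fun i => (u i : ℂ)) s = 1 / (s - 1) + V s) :
    Tendsto (fun t => (∑' i, if lam i ≤ t then u i else 0) * Real.exp (-t)) atTop (𝓝 1) := by
  have hsum : ∀ t, Summable fun i => if lam i ≤ t then u i else 0 := by
    intro t
    have h1 := summable_summatory (by norm_num) (hs 2 (by norm_num)) t
    rw [← Complex.summable_ofReal]
    refine h1.congr fun i => ?_
    split_ifs <;> simp
  have hS0 : ∀ t, 0 ≤ ∑' i, if lam i ≤ t then u i else 0 := fun t =>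
    tsum_nonneg fun i => by split_ifs <;> simp [hu]
  have hmeas : Measurable fun t => ∑' i, if lam i ≤ t then u i else 0 := by
    have h := Complex.measurable_re.comp (measurable_summatory (by norm_num) (hs 2 (by norm_num)))
    convert h using 1
    ext t
    simp [summatory_ofReal]
  have hbd : ∀ σ > 1, ∃ C, ∀ t, ∑' i, (if lam i ≤ t then u i else 0) ≤ C * Real.exp (σ * t) := by
    intro σ hσ
    refine ⟨∑' i, ‖(u i : ℂ)‖ * Real.exp (-σ * lam i), fun t => ?_⟩
    have := norm_summatory_le (by linarith) (hs σ hσ) t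
    rw [summatory_ofReal, Complex.norm_real, Real.norm_of_nonneg (hS0 t)] at this
    exact this
  refine wiener_ikehara (G := fun s => (V (1 + s) - 1) / (1 + s)) ?_ hS0 ?_ ?_ ?_
  · intro a b hab
    refine (hsum a).tsum_le_tsum (fun i => ?_) (hsum b)
    split_ifs with h1 h2
    · exact le_rfl
    · exact absurd (h1.trans hab) h2
    · exact hu i
    · exact le_rfl
  · intro δ hδ
    obtain ⟨C, hC⟩ := hbd (1 + δ / 2) (by linarith)
    refine ((exp_neg_integrableOn_Ioi 0 (half_pos hδ)).const_mul C).mono' ?_ ?_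
    · exact ((hmeas.mul (by fun_prop)).mul (by fun_prop)).aestronglyMeasurable
    · refine Eventually.of_forall fun t => ?_
      rw [Real.norm_of_nonneg (by have := hS0 t; positivity)]
      calc _ ≤ C * Real.exp ((1 + δ / 2) * t) * Real.exp (-t) * Real.exp (-δ * t) := by
            gcongr; exact hC t
        _ = C * Real.exp (-(δ / 2) * t) := by
            rw [mul_assoc, mul_assoc, ← Real.exp_add, ← Real.exp_add]; congr 2; ring
  · refine ContinuousOn.div ((hV.comp (by fun_prop) ?_).sub continuousOn_const) (by fun_prop) ?_
    · intro s hs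
      have : 0 ≤ s.re := hs
      simp only [Set.mem_ofPred_eq, Complex.add_re, Complex.one_re]
      linarith
    · intro s hs h
      have : 0 ≤ s.re := hs
      have h2 := congrArg Complex.re h
      simp at h2
      linarith
  · intro s hs0
    have hs1 : 1 < (1 + s).re := by simpa using hs0
    have hsne : s ≠ 0 := by rintro rfl; simp at hs0
    have hsne1 : 1 + s ≠ 0 := by
      intro h
      rw [h] at hs1
      simp at hs1
      linarith
    obtain ⟨τ, hτ1, hτ2⟩ := exists_between hs1
    have e1 := hVU (1 + s) hs1
    rw [dirSeries_eq_integral hlam (by linarith) (hs τ hτ1) hτ2] at e1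
    have hre : (-s).re < 0 := by simpa using hs0
    have i2 := integrableOn_exp_mul_complex_Ioi hre 0
    have i1 : IntegrableOn (fun t : ℝ => summatory lam (fun i => (u i : ℂ)) t * Complex.exp (-(1 + s) * t)) (Set.Ioi 0) := by
      obtain ⟨C, hC⟩ := hbd τ hτ1
      have h0 : 0 < (1 + s).re - τ := by linarith
      refine ((exp_neg_integrableOn_Ioi 0 h0).const_mul C).mono' ?_ ?_
      · exact ((measurable_summatory (by norm_num) (hs 2 (by norm_num))).mul (by fun_prop)).aestronglyMeasurable
      · refine Eventually.of_forall fun t => ?_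
        rw [norm_mul, summatory_ofReal, Complex.norm_real, Real.norm_of_nonneg (hS0 t), Complex.norm_exp]
        calc _ ≤ C * Real.exp (τ * t) * Real.exp ((-(1 + s) * t).re) := by
              gcongr; exact hC t
          _ = _ := by
              rw [mul_assoc, ← Real.exp_add]; congr 2; simp; ring
    have e2 : ∀ t : ℝ, (((∑' i, if lam i ≤ t then u i else 0) * Real.exp (-t) - 1 : ℝ) : ℂ) * Complex.exp (-s * t) =
        summatory lam (fun i => (u i : ℂ)) t * Complex.exp (-(1 + s) * t) - Complex.exp (-s * t) := by
      intro t
      rw [summatory_ofReal]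
      have : Complex.exp (-(1 + s) * t) = Complex.exp (-(t:ℂ)) * Complex.exp (-s * t) := by
        rw [← Complex.exp_add]; congr 1; ring
      rw [this]
      push_cast
      ring
    simp_rw [e2]
    rw [integral_sub i1 i2, integral_exp_mul_complex_Ioi hre]
    have e3 : ∫ t in Set.Ioi (0:ℝ), summatory lam (fun i => (u i : ℂ)) t * Complex.exp (-(1 + s) * t) =
        (1 / s + V (1 + s)) / (1 + s) := by
      rw [eq_div_iff hsne1, mul_comm, e1]
      congr 2
      ring
    rw [e3]
    simp
    field_simp
    ring

/-- Behaviour of the logarithmic derivative when a zero is approached from the right. -/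
theorem exists_tendsto_logDeriv {H : ℂ → ℂ} {z : ℂ} (hH : AnalyticAt ℂ H z)
    (h0 : ¬ ∀ᶠ s in 𝓝 z, H s = 0) :
    ∃ n : ℕ, (n = 0 → H z ≠ 0) ∧
      Tendsto (fun x : ℝ => (x : ℂ) * logDeriv H (z + x)) (𝓝[>] 0) (𝓝 n) := by
  obtain ⟨n, g, hg, hgz, he⟩ := (hH.exists_eventuallyEq_pow_smul_nonzero_iff).2 h0
  refine ⟨n, ?_, ?_⟩
  · rintro rfl
    have := he.self_of_nhds
    simpa [this] using hgz
  have htend : Tendsto (fun x : ℝ => z + (x : ℂ)) (𝓝[>] 0) (𝓝 z) := by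
    have : Continuous fun x : ℝ => z + (x : ℂ) := by fun_prop
    have h := this.tendsto 0
    simp only [Complex.ofReal_zero, add_zero] at h
    exact h.mono_left nhdsWithin_le_nhds
  have he2 := htend.eventually he.eventually_nhds
  have hg2 := htend.eventually (hg.continuousAt.eventually_ne hgz)
  have hg3 := htend.eventually hg.eventually_analyticAt
  have heq : ∀ᶠ x : ℝ in 𝓝[>] 0, (n : ℂ) + x * (deriv g (z + x) / g (z + x)) =
      (x : ℂ) * logDeriv H (z + x) := by
    filter_upwards [he2, hg2, hg3, self_mem_nhdsWithin] with x h1 h2 h3 hx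
    have hx' : (x : ℂ) ≠ 0 := by exact_mod_cast (ne_of_gt hx : x ≠ 0)
    have h4 : logDeriv H (z + x) = logDeriv (fun s => (s - z) ^ n * g s) (z + x) := by
      have h1' : H =ᶠ[𝓝 (z + x)] fun s => (s - z) ^ n * g s := h1
      rw [logDeriv_apply, logDeriv_apply, h1'.deriv_eq, h1'.self_of_nhds]
    rw [h4, logDeriv_mul _ (by simpa using fun h => absurd (by exact_mod_cast h) hx') h2 (by fun_prop) h3.differentiableAt,
      logDeriv_fun_pow (by fun_prop)]
    simp only [logDeriv_apply]
    have : deriv (fun s : ℂ => s - z) (z + x) = 1 := by simp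
    rw [this]
    simp only [add_sub_cancel_left]
    field_simp
  refine Tendsto.congr' heq ?_
  have t1 : Tendsto (fun x : ℝ => deriv g (z + x) / g (z + x)) (𝓝[>] 0) (𝓝 (deriv g z / g z)) :=
    ((hg.deriv.continuousAt.tendsto.comp htend)).div (hg.continuousAt.tendsto.comp htend) hgz
  have t2 : Tendsto (fun x : ℝ => (x : ℂ)) (𝓝[>] 0) (𝓝 0) := by
    have := Complex.continuous_ofReal.tendsto 0
    exact this.mono_left nhdsWithin_le_nhds
  simpa using (t2.mul t1).const_add (n : ℂ)

/-- A commutative semigroup with a logarithmic norm `ℓ`, prime elements `p i`, and a unitary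
character `χ` all of whose powers have summatory functions with a power saving. -/
structure CharSemigroup (M : Type*) [CancelCommMonoid M] where
  ℓ : M → ℝ
  map_mul : ∀ a b, ℓ (a * b) = ℓ a + ℓ b
  pos : ∀ a, a ≠ 1 → 0 < ℓ a
  p : ℕ → M
  p_ne_one : ∀ i, p i ≠ 1
  χ : M →* Circle
  factor : ∀ a, HasSum (fun x : ℕ × ℕ => open Classical in
    if p x.1 ^ (x.2 + 1) ∣ a then ℓ (p x.1) else 0) (ℓ a)
  finite : ∀ t, {a | ℓ a ≤ t}.Finite
  c : ℝ
  c_pos : 0 < c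
  count : ∀ k : ℤ, ∃ C, ∀ t, 0 ≤ t →
    ‖summatory ℓ (fun a => (χ a : ℂ) ^ k) t - (if k = 0 then (c : ℂ) else 0) * Real.exp t‖ ≤
      C * Real.exp (3 / 4 * t)

namespace CharSemigroup
variable {M : Type*} [CancelCommMonoid M] [Countable M] (D : CharSemigroup M)

omit [Countable M] in
theorem map_one : D.ℓ 1 = 0 := by
  have := D.map_mul 1 1
  rw [mul_one] at this
  linarith

omit [Countable M] in
theorem nonneg (a : M) : 0 ≤ D.ℓ a := by
  by_cases h : a = 1
  · rw [h, D.map_one]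
  · exact (D.pos a h).le

/-- The `k`-th power of the character, as a complex-valued function. -/
noncomputable def coef (k : ℤ) (a : M) : ℂ := (D.χ a : ℂ) ^ k

omit [Countable M] in
@[simp] theorem norm_coef (k : ℤ) (a : M) : ‖D.coef k a‖ = 1 := by
  rw [coef, norm_zpow, Circle.norm_coe, one_zpow]

omit [Countable M] in
theorem coef_mul (k : ℤ) (a b : M) : D.coef k (a * b) = D.coef k a * D.coef k b := by
  simp [coef, mul_zpow]

omit [Countable M] in
theorem coef_one (k : ℤ) : D.coef k 1 = 1 := by
  simp [coef]

/-- The coefficient of the main term of the `k`-th summatory function. -/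
noncomputable def main (k : ℤ) : ℂ := if k = 0 then (D.c : ℂ) else 0

theorem summable_exp {σ : ℝ} (hσ : 1 < σ) : Summable fun a => Real.exp (-σ * D.ℓ a) := by
  classical
  obtain ⟨C, hC⟩ := D.count 0
  have hN : ∀ (u : Finset M) (t : ℝ), 0 ≤ t →
      ‖summatory D.ℓ (fun a => if a ∈ u then (1:ℂ) else 0) t‖ ≤ (D.c + C) * Real.exp t := by
    intro u t ht
    have hfin := D.finite t
    have e1 : summatory D.ℓ (fun a => (D.χ a : ℂ) ^ (0:ℤ)) t = (hfin.toFinset.card : ℂ) := by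
      rw [summatory, tsum_eq_sum (s := hfin.toFinset)]
      · rw [Finset.sum_congr rfl (g := fun _ => (1:ℂ))]
        · simp
        · intro a ha
          rw [if_pos (by simpa using ha), zpow_zero]
      · intro a ha
        rw [if_neg (by simpa using ha)]
    have e2 : summatory D.ℓ (fun a => if a ∈ u then (1:ℂ) else 0) t =
        ((hfin.toFinset ∩ u).card : ℂ) := by
      rw [summatory, tsum_eq_sum (s := hfin.toFinset ∩ u)]
      · rw [Finset.sum_congr rfl (g := fun _ => (1:ℂ))]
        · simp
        · intro a ha
          rw [Finset.mem_inter] at ha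
          rw [if_pos (by simpa using ha.1), if_pos ha.2]
      · intro a ha
        simp only [Finset.mem_inter, Set.Finite.mem_toFinset, Set.mem_ofPred_eq] at ha
        split_ifs with h1 h2
        · exact absurd ⟨h1, h2⟩ ha
        · rfl
        · rfl
    have h1 := hC t ht
    rw [e1, if_pos rfl] at h1
    rw [e2, Complex.norm_natCast]
    have h2 : ((hfin.toFinset ∩ u).card : ℝ) ≤ hfin.toFinset.card := by
      exact_mod_cast Finset.card_le_card Finset.inter_subset_left
    have h3 : (hfin.toFinset.card : ℝ) ≤ C * Real.exp (3 / 4 * t) + D.c * Real.exp t := by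
      have := norm_le_norm_add_norm_sub' (hfin.toFinset.card : ℂ) ((D.c : ℂ) * Real.exp t)
      rw [Complex.norm_natCast, norm_mul, Complex.norm_real, Complex.norm_real, Real.norm_of_nonneg D.c_pos.le,
        Real.norm_of_nonneg (Real.exp_pos _).le] at this
      linarith
    have hC0 : 0 ≤ C := by
      have := (norm_nonneg _).trans h1
      exact nonneg_of_mul_nonneg_left this (Real.exp_pos _)
    have h4 : Real.exp (3 / 4 * t) ≤ Real.exp t := Real.exp_le_exp.2 (by linarith)
    nlinarith
  refine summable_of_sum_le (c := σ * ((D.c + C) / (σ - 1))) (fun a => (Real.exp_pos _).le) fun u => ?_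
  have hs : Summable fun a => ‖if a ∈ u then (1:ℂ) else 0‖ * Real.exp (-0 * D.ℓ a) := by
    refine summable_of_ne_finset_zero (s := u) fun a ha => ?_
    simp [ha]
  have key := dirSeries_eq_integral D.nonneg le_rfl hs (s := (σ : ℂ)) (by simp; linarith)
  have e3 : dirSeries D.ℓ (fun a => if a ∈ u then (1:ℂ) else 0) σ =
      ((∑ a ∈ u, Real.exp (-σ * D.ℓ a) : ℝ) : ℂ) := by
    rw [dirSeries, tsum_eq_sum (s := u)]
    · push_cast
      exact Finset.sum_congr rfl fun a ha => by rw [if_pos ha, one_mul]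
    · intro a ha
      rw [if_neg ha, zero_mul]
  rw [e3] at key
  have key2 := congrArg norm key
  rw [Complex.norm_real, Real.norm_of_nonneg (Finset.sum_nonneg fun a _ => (Real.exp_pos _).le),
    norm_mul, Complex.norm_real, Real.norm_of_nonneg (by linarith)] at key2
  rw [key2]
  gcongr
  have hσ1 : 1 - σ < 0 := by linarith
  calc _ ≤ ∫ t in Set.Ioi (0:ℝ), (D.c + C) * Real.exp ((1 - σ) * t) := by
        refine norm_integral_le_of_norm_le ((integrableOn_exp_mul_Ioi hσ1 0).const_mul _) ?_
        filter_upwards [ae_restrict_mem measurableSet_Ioi] with t ht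
        rw [norm_mul, Complex.norm_exp]
        calc _ ≤ (D.c + C) * Real.exp t * Real.exp ((-(σ:ℂ) * t).re) := by
              gcongr; exact hN u t (le_of_lt ht)
          _ = _ := by
              rw [mul_assoc, ← Real.exp_add]; congr 2; simp; ring
    _ = _ := by
        rw [integral_const_mul, integral_exp_mul_Ioi hσ1]
        have : σ - 1 ≠ 0 := by linarith
        have : 1 - σ ≠ 0 := by linarith
        simp
        field_simp
        ring

theorem summable_coef (k : ℤ) : ∀ σ > (1:ℝ), Summable fun a => ‖D.coef k a‖ * Real.exp (-σ * D.ℓ a) := by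
  intro σ hσ
  simpa using D.summable_exp hσ

/-- The `L`-function of the `k`-th power of the character. -/
noncomputable def F (k : ℤ) (s : ℂ) : ℂ := dirSeries D.ℓ (D.coef k) s

/-- The Laplace transform of the error term of the `k`-th summatory function. -/
noncomputable def errL (k : ℤ) (s : ℂ) : ℂ :=
  ∫ t in Set.Ioi (0:ℝ), (summatory D.ℓ (D.coef k) t - D.main k * Real.exp t) * Complex.exp (-s * t)

/-- The `L`-function with its possible pole at `1` removed. -/
noncomputable def H (k : ℤ) (s : ℂ) : ℂ :=
  if k = 0 then s * D.c + s * (s - 1) * D.errL k s else s * D.errL k s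

theorem measurable_err (k : ℤ) :
    Measurable fun t => summatory D.ℓ (D.coef k) t - D.main k * Real.exp t := by
  have := measurable_summatory (by norm_num) (D.summable_coef k 2 (by norm_num))
  fun_prop

theorem differentiableOn_errL (k : ℤ) : DifferentiableOn ℂ (D.errL k) {s | 3 / 4 < s.re} := by
  obtain ⟨C, hC⟩ := D.count k
  exact differentiableOn_laplace (D.measurable_err k).aestronglyMeasurable fun t ht => hC t ht.le

theorem analyticOnNhd_H (k : ℤ) : AnalyticOnNhd ℂ (D.H k) {s | 3 / 4 < s.re} := by
  refine DifferentiableOn.analyticOnNhd ?_ (isOpen_lt continuous_const Complex.continuous_re)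
  have := D.differentiableOn_errL k
  by_cases hk : k = 0
  · have h : D.H k = fun s => s * D.c + s * (s - 1) * D.errL k s := by ext s; simp [H, hk]
    rw [h]
    fun_prop
  · have h : D.H k = fun s => s * D.errL k s := by ext s; simp [H, hk]
    rw [h]
    fun_prop

theorem F_eq (k : ℤ) {s : ℂ} (hs : 1 < s.re) : D.F k s = s * (D.main k / (s - 1) + D.errL k s) := by
  obtain ⟨τ, h1, h2⟩ := exists_between hs
  have hs1 : s - 1 ≠ 0 := by
    intro h
    have := congrArg Complex.re h
    simp at this
    linarith
  rw [F, dirSeries_eq_integral D.nonneg (by linarith) (D.summable_coef k τ h1) h2]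
  congr 1
  have hre : (1 - s).re < 0 := by simpa using hs
  have i1 : IntegrableOn (fun t : ℝ => D.main k * Complex.exp ((1 - s) * t)) (Set.Ioi 0) :=
    (integrableOn_exp_mul_complex_Ioi hre 0).const_mul _
  obtain ⟨C, hC⟩ := D.count k
  have h3 : 0 < s.re - 3 / 4 := by linarith
  have i2 : IntegrableOn (fun t : ℝ => (summatory D.ℓ (D.coef k) t - D.main k * Real.exp t) * Complex.exp (-s * t)) (Set.Ioi 0) := by
    refine ((exp_neg_integrableOn_Ioi 0 h3).const_mul C).mono' ?_ ?_
    · have := D.measurable_err k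
      exact (this.mul (by fun_prop)).aestronglyMeasurable
    · filter_upwards [ae_restrict_mem measurableSet_Ioi] with t ht
      rw [norm_mul, Complex.norm_exp]
      calc _ ≤ C * Real.exp (3 / 4 * t) * Real.exp ((-s * t).re) := by
            gcongr; exact hC t (le_of_lt ht)
        _ = _ := by
            rw [mul_assoc, ← Real.exp_add]; congr 2; simp; ring
  have e : ∀ t : ℝ, summatory D.ℓ (D.coef k) t * Complex.exp (-s * t) =
      D.main k * Complex.exp ((1 - s) * t) +
      (summatory D.ℓ (D.coef k) t - D.main k * Real.exp t) * Complex.exp (-s * t) := by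
    intro t
    have : Complex.exp ((1 - s) * t) = Complex.exp t * Complex.exp (-s * t) := by
      rw [← Complex.exp_add]; congr 1; ring
    rw [this]
    push_cast
    ring
  simp_rw [e]
  rw [integral_add i1 i2, errL, integral_const_mul, integral_exp_mul_complex_Ioi hre]
  congr 1
  have : 1 - s ≠ 0 := by rw [← neg_sub]; exact neg_ne_zero.2 hs1
  simp
  field_simp
  ring

theorem H_eq (k : ℤ) {s : ℂ} (hs : 1 < s.re) :
    D.H k s = (if k = 0 then s - 1 else 1) * D.F k s := by
  have hs1 : s - 1 ≠ 0 := by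
    intro h
    have := congrArg Complex.re h
    simp at this
    linarith
  rw [F_eq D k hs, H, main]
  split_ifs
  · field_simp
  · simp

omit [Countable M] in
theorem H_zero_one : D.H 0 1 = D.c := by simp [H]

/-- The weight of the prime power indexed by `x`. -/
noncomputable def lam (x : ℕ × ℕ) : ℝ := D.ℓ (D.p x.1 ^ (x.2 + 1))

/-- The von Mangoldt coefficient of the prime power indexed by `x`, twisted by the `k`-th
power of the character. -/
noncomputable def vM (k : ℤ) (x : ℕ × ℕ) : ℂ := D.ℓ (D.p x.1) * D.coef k (D.p x.1 ^ (x.2 + 1))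

omit [Countable M] in
theorem lam_nonneg (x : ℕ × ℕ) : 0 ≤ D.lam x := D.nonneg _

omit [Countable M] in
theorem norm_vM (k : ℤ) (x : ℕ × ℕ) : ‖D.vM k x‖ = D.ℓ (D.p x.1) := by
  rw [vM, norm_mul, norm_coef, mul_one, Complex.norm_real, Real.norm_of_nonneg (D.nonneg _)]

omit [Countable M] in
theorem tsum_dvd {E : Type*} [AddCommMonoid E] [TopologicalSpace E] [T2Space E] (q : M) (f : M → E) :
    ∑' a, (open Classical in if q ∣ a then f a else 0) = ∑' b, f (q * b) := by
  classical
  have hinj : Function.Injective fun b : M => q * b := mul_right_injective q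
  rw [← hinj.tsum_eq (f := fun a => if q ∣ a then f a else 0)]
  · exact tsum_congr fun b => by simp
  · intro a ha
    simp only [Function.mem_support, ne_eq, ite_eq_right_iff, Classical.not_imp] at ha
    obtain ⟨b, hb⟩ := ha.1
    exact ⟨b, hb.symm⟩

/-- The terms of the double series expressing minus the derivative of `F` as a product. -/
noncomputable def double (k : ℤ) (s : ℂ) (y : M × (ℕ × ℕ)) : ℂ :=
  open Classical in if D.p y.2.1 ^ (y.2.2 + 1) ∣ y.1 then
    D.ℓ (D.p y.2.1) * (D.coef k y.1 * Complex.exp (-s * D.ℓ y.1)) else 0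

theorem summable_double (k : ℤ) {s : ℂ} (hs : 1 < s.re) : Summable (D.double k s) := by
  classical
  rw [← summable_norm_iff]
  have hn : ∀ y, ‖D.double k s y‖ = (if D.p y.2.1 ^ (y.2.2 + 1) ∣ y.1 then D.ℓ (D.p y.2.1) else 0) *
      Real.exp (-s.re * D.ℓ y.1) := by
    intro y
    rw [double]
    split_ifs
    · rw [norm_mul, norm_mul, norm_coef, Complex.norm_exp, Complex.norm_real, Real.norm_of_nonneg (D.nonneg _)]
      simp
    · simp
  have hf : ∀ a, HasSum (fun x => ‖D.double k s (a, x)‖) (D.ℓ a * Real.exp (-s.re * D.ℓ a)) := by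
    intro a
    simp_rw [hn]
    convert (D.factor a).mul_right (Real.exp (-s.re * D.ℓ a)) using 1
  rw [summable_prod_of_nonneg (fun y => norm_nonneg _)]
  refine ⟨fun a => (hf a).summable, ?_⟩
  simp_rw [fun a => (hf a).tsum_eq]
  have := summable_lam_mul D.nonneg (D.summable_coef k) hs
  simp only [norm_mul, norm_coef, mul_one, Complex.norm_real] at this
  simpa [abs_of_nonneg (D.nonneg _)] using this

omit [Countable M] in
theorem tsum_double (k : ℤ) (s : ℂ) (x : ℕ × ℕ) :
    ∑' a, D.double k s (a, x) = D.vM k x * Complex.exp (-s * D.lam x) * D.F k s := by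
  classical
  simp only [double]
  rw [tsum_dvd, F, dirSeries, ← tsum_mul_left]
  refine tsum_congr fun b => ?_
  rw [D.map_mul, coef_mul, vM, lam]
  have : Complex.exp (-s * ((D.ℓ (D.p x.1 ^ (x.2 + 1)) + D.ℓ b : ℝ) : ℂ)) =
      Complex.exp (-s * (D.ℓ (D.p x.1 ^ (x.2 + 1)) : ℝ)) * Complex.exp (-s * (D.ℓ b : ℝ)) := by
    rw [← Complex.exp_add]; push_cast; congr 1; ring
  rw [this]
  ring

/-- The twisted von Mangoldt Dirichlet series. -/
noncomputable def Z (k : ℤ) (s : ℂ) : ℂ := dirSeries D.lam (D.vM k) s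

theorem dirSeries_mul_eq (k : ℤ) {s : ℂ} (hs : 1 < s.re) :
    dirSeries D.ℓ (fun a => D.ℓ a * D.coef k a) s = D.Z k s * D.F k s := by
  classical
  have h := D.summable_double k hs
  have h1 : ∀ a, ∑' x, D.double k s (a, x) = D.ℓ a * D.coef k a * Complex.exp (-s * D.ℓ a) := by
    intro a
    have := (Complex.hasSum_ofReal.2 (D.factor a)).mul_right (D.coef k a * Complex.exp (-s * D.ℓ a))
    rw [mul_assoc, ← this.tsum_eq]
    refine tsum_congr fun x => ?_
    simp only [double]
    split_ifs <;> simp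
  have h2 : ∑' y, D.double k s y = dirSeries D.ℓ (fun a => D.ℓ a * D.coef k a) s := by
    rw [h.tsum_prod, dirSeries]
    exact tsum_congr h1
  rw [← h2, h.tsum_prod, ← Summable.tsum_comm (f := fun a x => D.double k s (a, x)) h, Z, dirSeries, ← tsum_mul_right]
  exact tsum_congr fun x => D.tsum_double k s x

theorem hasDerivAt_F (k : ℤ) {s : ℂ} (hs : 1 < s.re) :
    HasDerivAt (D.F k) (-(D.Z k s * D.F k s)) s := by
  rw [← D.dirSeries_mul_eq k hs]
  exact hasDerivAt_dirSeries D.nonneg (D.summable_coef k) hs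

theorem summable_vM (k : ℤ) : ∀ σ > (1:ℝ), Summable fun x => ‖D.vM k x‖ * Real.exp (-σ * D.lam x) := by
  intro σ hσ
  have hs : 1 < (σ : ℂ).re := by simpa using hσ
  have h : Summable fun x => ∑' a, D.double 0 σ (a, x) := ((D.summable_double 0 hs).prod_symm).prod
  simp_rw [D.tsum_double] at h
  have hF : D.F 0 σ = ((∑' a, Real.exp (-σ * D.ℓ a) : ℝ) : ℂ) := by
    rw [F, dirSeries, Complex.ofReal_tsum]
    refine tsum_congr fun a => ?_
    simp [coef]
  have hF0 : D.F 0 σ ≠ 0 := by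
    rw [hF]
    have : 0 < ∑' a, Real.exp (-σ * D.ℓ a) := (D.summable_exp hσ).tsum_pos (fun a => (Real.exp_pos _).le) 1 (Real.exp_pos _)
    exact_mod_cast this.ne'
  have h2 := ((summable_mul_right_iff hF0).1 h).norm
  refine h2.congr fun x => ?_
  rw [norm_dir_term, norm_vM, norm_vM]
  simp

end CharSemigroup

namespace CharSemigroup
variable {M : Type*} [CancelCommMonoid M] [Countable M] (D : CharSemigroup M)

theorem tendsto_F (k : ℤ) : Tendsto (fun σ : ℝ => D.F k σ) atTop (𝓝 1) := by
  classical
  have h := tendsto_tsum_of_dominated_convergence (𝓕 := (atTop : Filter ℝ))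
    (f := fun (σ : ℝ) a => D.coef k a * Complex.exp (-σ * D.ℓ a))
    (g := fun a => if a = 1 then (1 : ℂ) else 0) (D.summable_exp (σ := 2) (by norm_num)) ?_ ?_
  · rw [tsum_ite_eq] at h
    exact h
  · intro a
    by_cases ha : a = 1
    · subst ha
      simp [coef_one, D.map_one]
    · rw [if_neg ha, tendsto_zero_iff_norm_tendsto_zero]
      have : ∀ σ : ℝ, ‖D.coef k a * Complex.exp (-σ * D.ℓ a)‖ = Real.exp (-(σ * D.ℓ a)) := by
        intro σ
        rw [norm_dir_term, norm_coef]; simp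
      simp_rw [this]
      exact Real.tendsto_exp_neg_atTop_nhds_zero.comp (tendsto_id.atTop_mul_const (D.pos a ha))
  · filter_upwards [eventually_ge_atTop 2] with σ hσ a
    rw [norm_dir_term, norm_coef, one_mul]
    have := D.nonneg a
    simp only [Complex.ofReal_re]
    gcongr

theorem H_not_eventually_zero (k : ℤ) {z : ℂ} (hz : 3 / 4 < z.re) : ¬ ∀ᶠ s in 𝓝 z, D.H k s = 0 := by
  intro h
  have hpre : IsPreconnected {s : ℂ | 3 / 4 < s.re} := (convex_halfSpace_re_gt _).isPreconnected
  have h0 := (D.analyticOnNhd_H k).eqOn_zero_of_preconnected_of_eventuallyEq_zero hpre hz h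
  have h1 := (D.tendsto_F k).eventually_ne one_ne_zero
  obtain ⟨σ, h2, h3⟩ := (h1.and (eventually_gt_atTop 1)).exists
  have hs : 1 < (σ : ℂ).re := by simpa using h3
  have h4 := h0 (show 3 / 4 < (σ : ℂ).re by linarith)
  rw [D.H_eq k hs] at h4
  have : (if k = 0 then (σ : ℂ) - 1 else 1) ≠ 0 := by
    split_ifs
    · have : σ - 1 ≠ 0 := by linarith
      exact_mod_cast this
    · exact one_ne_zero
  exact (mul_ne_zero this h2) h4

/-- The polar part of `Z`. -/
noncomputable def polar (k : ℤ) (s : ℂ) : ℂ := if k = 0 then 1 / (s - 1) else 0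

theorem logDeriv_H (k : ℤ) {s : ℂ} (hs : 1 < s.re) (h : D.H k s ≠ 0) :
    logDeriv (D.H k) s = polar k s - D.Z k s := by
  have hs1 : s - 1 ≠ 0 := by
    intro h
    have := congrArg Complex.re h
    simp at this
    linarith
  have hev : D.H k =ᶠ[𝓝 s] fun s => (if k = 0 then s - 1 else 1) * D.F k s := by
    filter_upwards [(isOpen_lt continuous_const Complex.continuous_re).mem_nhds hs] with z hz
    exact D.H_eq k hz
  have hF : D.F k s ≠ 0 := by
    intro h0
    rw [D.H_eq k hs, h0, mul_zero] at h
    exact h rfl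
  have hd := D.hasDerivAt_F k hs
  have hlF : logDeriv (D.F k) s = - D.Z k s := by
    rw [logDeriv_apply, hd.deriv]
    field_simp
  rw [logDeriv_apply, hev.deriv_eq, hev.self_of_nhds, ← logDeriv_apply]
  by_cases hk : k = 0
  · subst hk
    simp only [if_true, polar]
    rw [logDeriv_mul (f := fun s : ℂ => s - 1) s hs1 hF (by fun_prop) hd.differentiableAt, hlF, logDeriv_apply]
    simp [sub_eq_add_neg]
  · simp only [hk, if_false, polar, one_mul]
    rw [show logDeriv (fun s => D.F k s) s = _ from hlF, zero_sub]

theorem exists_tendsto_Z (k : ℤ) {z : ℂ} (hz : 1 ≤ z.re) :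
    ∃ n : ℕ, (n = 0 → D.H k z ≠ 0) ∧
      Tendsto (fun x : ℝ => (x : ℂ) * D.Z k (z + x)) (𝓝[>] 0)
        (𝓝 ((if k = 0 ∧ z = 1 then 1 else 0) - n)) := by
  have hz' : 3 / 4 < z.re := by linarith
  obtain ⟨n, h1, h2⟩ := exists_tendsto_logDeriv (D.analyticOnNhd_H k z hz') (D.H_not_eventually_zero k hz')
  refine ⟨n, h1, ?_⟩
  have hpol : Tendsto (fun x : ℝ => (x : ℂ) * polar k (z + x)) (𝓝[>] 0)
      (𝓝 (if k = 0 ∧ z = 1 then 1 else 0)) := by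
    by_cases hk : k = 0
    · by_cases hz1 : z = 1
      · rw [if_pos ⟨hk, hz1⟩]
        refine tendsto_const_nhds.congr' ?_
        filter_upwards [self_mem_nhdsWithin] with x hx
        have hx' : (x : ℂ) ≠ 0 := by exact_mod_cast (ne_of_gt hx : x ≠ 0)
        simp [polar, hk, hz1, hx']
      · rw [if_neg (fun h => hz1 h.2)]
        have hz2 : z - 1 ≠ 0 := sub_ne_zero.2 hz1
        have : ContinuousAt (fun x : ℝ => (x : ℂ) * polar k (z + x)) 0 := by
          simp only [polar, hk, if_true]
          refine ContinuousAt.mul (by fun_prop) (ContinuousAt.div (by fun_prop) (by fun_prop) ?_)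
          simpa using hz2
        have h := this.tendsto
        simp only [Complex.ofReal_zero, zero_mul] at h
        exact h.mono_left nhdsWithin_le_nhds
    · simp [polar, hk]
  refine (hpol.sub h2).congr' ?_
  have hne : ∀ᶠ s in 𝓝[≠] z, D.H k s ≠ 0 := by
    rcases (D.analyticOnNhd_H k z hz').eventually_eq_zero_or_eventually_ne_zero with h | h
    · exact absurd h (D.H_not_eventually_zero k hz')
    · exact h
  have htend : Tendsto (fun x : ℝ => z + (x : ℂ)) (𝓝[>] 0) (𝓝[≠] z) := by
    refine tendsto_nhdsWithin_iff.2 ⟨?_, ?_⟩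
    · have : Continuous fun x : ℝ => z + (x : ℂ) := by fun_prop
      have h := this.tendsto 0
      simp only [Complex.ofReal_zero, add_zero] at h
      exact h.mono_left nhdsWithin_le_nhds
    · filter_upwards [self_mem_nhdsWithin] with x hx
      have hx' : (x : ℂ) ≠ 0 := by exact_mod_cast (ne_of_gt hx : x ≠ 0)
      simpa using hx'
  filter_upwards [htend.eventually hne, self_mem_nhdsWithin] with x hx hx0
  have hx1 : 0 < x := hx0
  rw [D.logDeriv_H k (by simp; linarith) hx]
  ring

theorem re_trig (w : ℂ) (hw : ‖w‖ = 1) : 0 ≤ 3 + 4 * w.re + (w ^ 2).re := by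
  have h : w.re * w.re + w.im * w.im = 1 := by
    have := Complex.sq_norm w
    rw [hw, Complex.normSq_apply] at this
    linarith
  rw [sq, Complex.mul_re]
  nlinarith [sq_nonneg (w.re + 1)]

theorem re_Z_nonneg (k : ℤ) {x : ℝ} (hx : 0 < x) (t : ℝ) :
    0 ≤ (3 * D.Z 0 (1 + x) + 4 * D.Z k (1 + t * Complex.I + x) +
      D.Z (2 * k) (1 + 2 * t * Complex.I + x)).re := by
  have hterm : ∀ k : ℤ, ∀ s : ℂ, s.re = 1 + x → Summable fun y => D.vM k y * Complex.exp (-s * D.lam y) := by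
    intro k s hs
    rw [← summable_norm_iff]
    simp_rw [norm_dir_term, hs]
    exact D.summable_vM k _ (by linarith)
  have h0 := (hterm 0 (1 + x) (by simp)).hasSum
  have h1 := (hterm k (1 + t * Complex.I + x) (by simp)).hasSum
  have h2 := (hterm (2 * k) (1 + 2 * t * Complex.I + x) (by simp)).hasSum
  have h := ((h0.mul_left 3).add (h1.mul_left 4)).add h2
  have h' := Complex.hasSum_re h
  refine h'.nonneg fun y => ?_
  set w : ℂ := D.coef k (D.p y.1 ^ (y.2 + 1)) * Complex.exp (-(t * Complex.I) * D.lam y) with hw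
  have hw1 : ‖w‖ = 1 := by
    rw [hw, norm_mul, norm_coef, Complex.norm_exp]; simp
  have e : 3 * (D.vM 0 y * Complex.exp (-(1 + x) * D.lam y)) +
      4 * (D.vM k y * Complex.exp (-(1 + t * Complex.I + x) * D.lam y)) +
      D.vM (2 * k) y * Complex.exp (-(1 + 2 * t * Complex.I + x) * D.lam y) =
      ((D.ℓ (D.p y.1) * Real.exp (-(1 + x) * D.lam y) : ℝ) : ℂ) * (3 + 4 * w + w ^ 2) := by
    have e1 : Complex.exp (-(1 + t * Complex.I + x) * D.lam y) =
        Complex.exp (-(1 + x) * D.lam y) * Complex.exp (-(t * Complex.I) * D.lam y) := by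
      rw [← Complex.exp_add]; congr 1; ring
    have e2 : Complex.exp (-(1 + 2 * t * Complex.I + x) * D.lam y) =
        Complex.exp (-(1 + x) * D.lam y) * Complex.exp (-(t * Complex.I) * D.lam y) ^ 2 := by
      rw [← Complex.exp_nat_mul, ← Complex.exp_add]; congr 1; push_cast; ring
    have e3 : D.coef (2 * k) (D.p y.1 ^ (y.2 + 1)) = D.coef k (D.p y.1 ^ (y.2 + 1)) ^ 2 := by
      simp only [coef]
      rw [mul_comm, zpow_mul]; rfl
    have e4 : D.coef 0 (D.p y.1 ^ (y.2 + 1)) = 1 := by simp [coef]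
    rw [e1, e2, vM, vM, vM, e3, e4, hw]
    push_cast
    ring
  rw [e, Complex.re_ofReal_mul]
  refine mul_nonneg (mul_nonneg (D.nonneg _) (Real.exp_pos _).le) ?_
  have := re_trig w hw1
  simpa using this

theorem H_ne_zero (k : ℤ) {z : ℂ} (hz : 1 ≤ z.re) : D.H k z ≠ 0 := by
  rcases hz.lt_or_eq with hz | hz
  · obtain ⟨n, h1, h2⟩ := D.exists_tendsto_Z k hz.le
    apply h1
    have hZ : ContinuousAt (D.Z k) z := (hasDerivAt_dirSeries D.lam_nonneg (D.summable_vM k) hz).continuousAt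
    have hz1 : z ≠ 1 := by rintro rfl; simp at hz
    rw [if_neg (fun h => hz1 h.2)] at h2
    have h3 : ContinuousAt (fun x : ℝ => (x : ℂ) * D.Z k (z + x)) 0 := by
      refine ContinuousAt.mul (by fun_prop) (ContinuousAt.comp_of_eq hZ (by fun_prop) (by simp))
    have h4 := h3.tendsto
    simp only [Complex.ofReal_zero, zero_mul] at h4
    have := tendsto_nhds_unique h2 (h4.mono_left nhdsWithin_le_nhds)
    simpa using this
  · obtain ⟨t, ht⟩ : ∃ t : ℝ, z = 1 + t * Complex.I := ⟨z.im, by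
      apply Complex.ext <;> simp [← hz]⟩
    by_cases hk : k = 0 ∧ z = 1
    · rw [hk.1, hk.2, H_zero_one]
      exact_mod_cast D.c_pos.ne'
    · obtain ⟨n, h1, h2⟩ := D.exists_tendsto_Z k hz.le
      rw [if_neg hk] at h2
      obtain ⟨n', -, h2'⟩ := D.exists_tendsto_Z (2 * k) (z := 1 + 2 * t * Complex.I) (by simp)
      have hk' : ¬ (2 * k = 0 ∧ (1 + 2 * t * Complex.I : ℂ) = 1) := by
        rintro ⟨a, b⟩
        refine hk ⟨by omega, ?_⟩
        rw [ht]
        have := congrArg Complex.im b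
        simp at this
        simp [this]
      rw [if_neg hk'] at h2'
      obtain ⟨n0, h10, h20⟩ := D.exists_tendsto_Z 0 (z := 1) (by simp)
      rw [if_pos ⟨rfl, rfl⟩] at h20
      have hlim := Complex.continuous_re.continuousAt.tendsto.comp
        (((h20.const_mul 3).add (h2.const_mul 4)).add h2')
      have hge : 0 ≤ (3 * ((1:ℂ) - n0) + 4 * (0 - n) + (0 - n')).re := by
        refine ge_of_tendsto hlim ?_
        filter_upwards [self_mem_nhdsWithin] with x hx
        have hx1 : 0 < x := hx
        have := D.re_Z_nonneg k hx1 t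
        simp only [Function.comp]
        rw [ht]
        have e : (3 * ((x:ℂ) * D.Z 0 (1 + x)) + 4 * (x * D.Z k (1 + t * Complex.I + x)) +
          x * D.Z (2 * k) (1 + 2 * t * Complex.I + x)) = (x : ℂ) * (3 * D.Z 0 (1 + x) + 4 * D.Z k (1 + t * Complex.I + x) +
          D.Z (2 * k) (1 + 2 * t * Complex.I + x)) := by ring
        rw [e, Complex.re_ofReal_mul]
        positivity
      apply h1
      simp at hge
      by_contra hn
      have : (1:ℝ) ≤ n := by exact_mod_cast Nat.one_le_iff_ne_zero.2 hn
      have h3 : (0:ℝ) ≤ n' := Nat.cast_nonneg _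
      have h4 : (0:ℝ) ≤ n0 := Nat.cast_nonneg _
      linarith

theorem continuousOn_logDeriv_H (k : ℤ) : ContinuousOn (logDeriv (D.H k)) {s | 1 ≤ s.re} := by
  intro z hz
  have hz1 : 1 ≤ z.re := hz
  have ha := D.analyticOnNhd_H k z (show 3 / 4 < z.re by linarith)
  exact (ha.deriv.continuousAt.div ha.continuousAt (D.H_ne_zero k hz1)).continuousWithinAt

theorem Z_eq (k : ℤ) {s : ℂ} (hs : 1 < s.re) : D.Z k s = polar k s - logDeriv (D.H k) s := by
  rw [D.logDeriv_H k hs (D.H_ne_zero k hs.le)]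
  ring

/-- The series with the nonnegative coefficients `Λ (1 + Re (w χ ^ k))`. -/
noncomputable def vR (w : ℂ) (k : ℤ) (x : ℕ × ℕ) : ℝ :=
  D.ℓ (D.p x.1) * (1 + (w * D.coef k (D.p x.1 ^ (x.2 + 1))).re)

omit [Countable M] in
theorem vR_eq (w : ℂ) (k : ℤ) (x : ℕ × ℕ) :
    (D.vR w k x : ℂ) = D.vM 0 x + (w * D.vM k x + starRingEnd ℂ w * D.vM (-k) x) / 2 := by
  have h1 : ∀ a, D.coef (-k) a = starRingEnd ℂ (D.coef k a) := by
    intro a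
    have : (D.coef k a) = ((D.χ a ^ k : Circle) : ℂ) := by simp [coef]
    rw [this, ← Circle.coe_inv_eq_conj]
    simp [coef]
  have h2 : ∀ a, D.coef 0 a = 1 := by intro a; simp [coef]
  rw [vR, vM, vM, vM, h1, h2]
  push_cast
  rw [Complex.re_eq_add_conj, _root_.map_mul]
  ring

theorem tendsto_vR {w : ℂ} (hw : ‖w‖ ≤ 1) {k : ℤ} (hk : k ≠ 0) :
    Tendsto (fun t => (∑' x, if D.lam x ≤ t then D.vR w k x else 0) * Real.exp (-t)) atTop (𝓝 1) := by
  have hb : ∀ a, ‖w * D.coef k a‖ ≤ 1 := fun a => by rw [norm_mul, norm_coef, mul_one]; exact hw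
  have h0 : ∀ x, 0 ≤ D.vR w k x := fun x => by
    refine mul_nonneg (D.nonneg _) ?_
    have := (abs_le.1 ((Complex.abs_re_le_norm _).trans (hb (D.p x.1 ^ (x.2 + 1))))).1
    linarith
  refine tendsto_summatory_of_dirSeries (V := fun s => -logDeriv (D.H 0) s -
    (w * logDeriv (D.H k) s + starRingEnd ℂ w * logDeriv (D.H (-k)) s) / 2) D.lam_nonneg h0 ?_ ?_ ?_
  · intro σ hσ
    refine Summable.of_nonneg_of_le (fun x => by positivity) (fun x => ?_) ((D.summable_vM 0 σ hσ).mul_left 2)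
    rw [Complex.norm_real, Real.norm_of_nonneg (h0 x), norm_vM, ← mul_assoc]
    gcongr
    rw [vR, mul_comm]
    have := (abs_le.1 ((Complex.abs_re_le_norm _).trans (hb (D.p x.1 ^ (x.2 + 1))))).2
    have := D.nonneg (D.p x.1)
    gcongr
    linarith
  · have a0 := D.continuousOn_logDeriv_H 0
    have a1 := D.continuousOn_logDeriv_H k
    have a2 := D.continuousOn_logDeriv_H (-k)
    fun_prop
  · intro s hs
    have hterm : ∀ k : ℤ, Summable fun y => D.vM k y * Complex.exp (-s * D.lam y) := by
      intro k
      rw [← summable_norm_iff]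
      simp_rw [norm_dir_term]
      exact D.summable_vM k _ hs
    have e : dirSeries D.lam (fun x => (D.vR w k x : ℂ)) s =
        D.Z 0 s + (w * D.Z k s + starRingEnd ℂ w * D.Z (-k) s) / 2 := by
      have h := (hterm 0).hasSum.add ((((hterm k).hasSum.mul_left w).add
        ((hterm (-k)).hasSum.mul_left (starRingEnd ℂ w))).div_const 2)
      refine Eq.trans ?_ h.tsum_eq
      refine tsum_congr fun x => ?_
      simp only [vR_eq]
      ring
    rw [e, D.Z_eq 0 hs, D.Z_eq k hs, D.Z_eq (-k) hs]
    simp only [polar, hk, neg_eq_zero, if_true, if_false]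
    ring

theorem tendsto_summatory_vM_zero :
    Tendsto (fun t => (∑' x, if D.lam x ≤ t then D.ℓ (D.p x.1) else 0) * Real.exp (-t)) atTop (𝓝 1) := by
  have := D.tendsto_vR (w := 0) (by simp) one_ne_zero
  simpa [vR] using this

theorem tendsto_summatory_vM {k : ℤ} (hk : k ≠ 0) :
    Tendsto (fun t => summatory D.lam (D.vM k) t * Real.exp (-t)) atTop (𝓝 0) := by
  have hs := fun t => summable_summatory (by norm_num) (D.summable_vM k 2 (by norm_num)) t
  have hs0 : ∀ t, Summable fun x => if D.lam x ≤ t then D.ℓ (D.p x.1) else 0 := by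
    intro t
    have := (summable_summatory (by norm_num) (D.summable_vM k 2 (by norm_num)) t).norm
    refine this.congr fun x => ?_
    split_ifs
    · rw [norm_vM]
    · simp
  have key : ∀ w : ℂ, ‖w‖ ≤ 1 →
      Tendsto (fun t => (w * (summatory D.lam (D.vM k) t * Real.exp (-t))).re) atTop (𝓝 0) := by
    intro w hw
    have h := (D.tendsto_vR hw hk).sub D.tendsto_summatory_vM_zero
    rw [sub_self] at h
    refine h.congr fun t => ?_
    have e : ∑' x, (if D.lam x ≤ t then D.vR w k x else 0) =
        ∑' x, (if D.lam x ≤ t then D.ℓ (D.p x.1) else 0) + (w * summatory D.lam (D.vM k) t).re := by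
      have h1 := (hs0 t).hasSum.add (Complex.hasSum_re ((hs t).hasSum.mul_left w))
      refine Eq.trans ?_ h1.tsum_eq
      refine tsum_congr fun x => ?_
      split_ifs
      · rw [vR, vM, mul_left_comm w, Complex.re_ofReal_mul]
        ring
      · simp
    rw [e, ← mul_assoc, Complex.re_mul_ofReal]
    ring
  have h1 := key 1 (by simp)
  have h2 := key (-Complex.I) (by simp)
  have h3 : Tendsto (fun t => ((((1:ℂ) * (summatory D.lam (D.vM k) t * Real.exp (-t))).re : ℝ) : ℂ) +
      (((-Complex.I * (summatory D.lam (D.vM k) t * Real.exp (-t))).re : ℝ) : ℂ) * Complex.I) atTop (𝓝 (((0:ℝ) : ℂ) + ((0:ℝ) : ℂ) * Complex.I)) :=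
    ((Complex.continuous_ofReal.tendsto 0).comp h1).add
      (((Complex.continuous_ofReal.tendsto 0).comp h2).mul_const Complex.I)
  simp only [Complex.ofReal_zero, zero_mul, add_zero] at h3
  refine h3.congr fun t => ?_
  have e : ∀ v : ℂ, (((1 * v).re : ℝ) : ℂ) + (((-Complex.I * v).re : ℝ) : ℂ) * Complex.I = v := by
    intro v
    apply Complex.ext <;> simp
  exact e _

end CharSemigroup

theorem norm_sum_le_of_weighted {w : ℕ → ℝ} (hw : ∀ i, 0 < w i) (hm : Monotone w) {a : ℕ → ℂ}
    {ε C : ℝ}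
    (hT : ∀ n, ‖∑ i ∈ Finset.range n, (w i : ℂ) * a i‖ ≤ ε * ∑ i ∈ Finset.range n, w i + C) (n : ℕ) :
    ‖∑ i ∈ Finset.range n, a i‖ ≤ ε * n + C / w 0 := by
  set T : ℕ → ℂ := fun n => ∑ i ∈ Finset.range n, (w i : ℂ) * a i with hTdef
  set W : ℕ → ℝ := fun n => ∑ i ∈ Finset.range n, w i with hWdef
  have hT' : ∀ n, ‖T n‖ ≤ ε * W n + C := hT
  have key : ∀ n, ‖∑ i ∈ Finset.range n, a i - T n / w n‖ ≤
      (ε * n - ε * W n / w n) + C * (1 / w 0 - 1 / w n) := by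
    intro n
    induction n with
    | zero => simp [hTdef, hWdef]
    | succ n ih =>
      have hn := (hw n).ne'
      have hn1 := (hw (n + 1)).ne'
      have hnC : (w n : ℂ) ≠ 0 := by exact_mod_cast hn
      have hn1C : (w (n + 1) : ℂ) ≠ 0 := by exact_mod_cast hn1
      have e1 : T (n + 1) = T n + w n * a n := Finset.sum_range_succ _ _
      have e2 : W (n + 1) = W n + w n := Finset.sum_range_succ _ _
      have e3 : ∑ i ∈ Finset.range (n + 1), a i - T (n + 1) / w (n + 1) =
          (∑ i ∈ Finset.range n, a i - T n / w n) + T (n + 1) * ((1 / w n - 1 / w (n + 1) : ℝ) : ℂ) := by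
        rw [Finset.sum_range_succ, e1]
        push_cast
        field_simp
        ring
      have hpos : 0 ≤ 1 / w n - 1 / w (n + 1) :=
        sub_nonneg.2 (one_div_le_one_div_of_le (hw n) (hm (Nat.le_succ n)))
      rw [e3]
      refine (norm_add_le _ _).trans ?_
      rw [norm_mul, Complex.norm_real, Real.norm_of_nonneg hpos]
      refine (add_le_add ih (mul_le_mul_of_nonneg_right (hT' (n + 1)) hpos)).trans (le_of_eq ?_)
      rw [e2]
      push_cast
      field_simp
      ring
  have h1 := norm_le_norm_add_norm_sub' (∑ i ∈ Finset.range n, a i) (T n / w n)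
  have h2 : ‖T n / w n‖ ≤ (ε * W n + C) / w n := by
    rw [norm_div, Complex.norm_real, Real.norm_of_nonneg (hw n).le]
    have := (hw n).le
    gcongr
    exact hT' n
  have h3 := key n
  have e : (ε * W n + C) / w n + ((ε * n - ε * W n / w n) + C * (1 / w 0 - 1 / w n)) = ε * n + C / w 0 := by
    ring
  linarith

theorem tendsto_mean_of_weighted {w : ℕ → ℝ} (hw : ∀ i, 0 < w i) (hm : Monotone w) {a : ℕ → ℂ}
    (ha : ∀ i, ‖a i‖ ≤ 1)
    (hT : ∀ ε > 0, ∀ᶠ n in atTop, ‖∑ i ∈ Finset.range n, (w i : ℂ) * a i‖ ≤ ε * ∑ i ∈ Finset.range n, w i) :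
    Tendsto (fun n : ℕ => (n : ℂ)⁻¹ * ∑ i ∈ Finset.range n, a i) atTop (𝓝 0) := by
  rw [tendsto_zero_iff_norm_tendsto_zero, Metric.tendsto_atTop']
  intro ε hε
  obtain ⟨N, hN⟩ := eventually_atTop.1 (hT (ε / 2) (half_pos hε))
  have hC0 : 0 ≤ ∑ i ∈ Finset.range N, w i := Finset.sum_nonneg fun i _ => (hw i).le
  have hb : ∀ n, ‖∑ i ∈ Finset.range n, (w i : ℂ) * a i‖ ≤
      ε / 2 * ∑ i ∈ Finset.range n, w i + ∑ i ∈ Finset.range N, w i := by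
    intro n
    rcases le_total N n with h | h
    · have := hN n h
      linarith
    · have h0 : 0 ≤ ∑ i ∈ Finset.range n, w i := Finset.sum_nonneg fun i _ => (hw i).le
      calc _ ≤ ∑ i ∈ Finset.range n, w i := by
            refine norm_sum_le_of_le _ fun i _ => ?_
            rw [norm_mul, Complex.norm_real, Real.norm_of_nonneg (hw i).le]
            exact mul_le_of_le_one_right (hw i).le (ha i)
        _ ≤ ∑ i ∈ Finset.range N, w i :=
            Finset.sum_le_sum_of_subset_of_nonneg (Finset.range_mono h) fun i _ _ => (hw i).le
        _ ≤ _ := by nlinarith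
  have key := norm_sum_le_of_weighted hw hm hb
  obtain ⟨n0, hn0⟩ := exists_nat_gt (2 / ε * ((∑ i ∈ Finset.range N, w i) / w 0))
  refine ⟨n0, fun n hn => ?_⟩
  have hn' : (n0 : ℝ) < n := by exact_mod_cast hn
  have hnpos : (0:ℝ) < n := by
    have : (0:ℝ) ≤ n0 := Nat.cast_nonneg _
    linarith
  rw [dist_zero_right, norm_norm, norm_mul, norm_inv, Complex.norm_natCast, inv_mul_lt_iff₀ hnpos]
  refine (key n).trans_lt ?_
  have : 2 / ε * ((∑ i ∈ Finset.range N, w i) / w 0) < n := hn0.trans hn'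
  rw [div_mul_eq_mul_div, div_lt_iff₀ hε] at this
  linarith

theorem tendsto_mean_of_summatory {w : ℕ → ℝ} (hw : ∀ i, 0 < w i) (hm : Monotone w)
    (hfin : ∀ t, {i | w i ≤ t}.Finite) {a : ℕ → ℂ} (ha : ∀ i, ‖a i‖ ≤ 1)
    (hθ : Tendsto (fun t => (∑' i, if w i ≤ t then w i else 0) * Real.exp (-t)) atTop (𝓝 1))
    (hA : Tendsto (fun t => summatory w (fun i => w i * a i) t * Real.exp (-t)) atTop (𝓝 0)) :
    Tendsto (fun n : ℕ => (n : ℂ)⁻¹ * ∑ i ∈ Finset.range n, a i) atTop (𝓝 0) := by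
  refine tendsto_mean_of_weighted hw hm ha fun ε hε => ?_
  have hwt : Tendsto w atTop atTop := by
    rw [tendsto_atTop_atTop]
    intro b
    obtain ⟨n, hn⟩ := (hfin b).exists_notMem
    exact ⟨n, fun m hmn => (le_of_lt (not_le.1 hn)).trans (hm hmn)⟩
  set W : ℕ → ℝ := fun n => ∑ i ∈ Finset.range n, w i with hWdef
  set θ : ℝ → ℝ := fun t => ∑' i, if w i ≤ t then w i else 0 with hθdef
  have hθeq : ∀ t, θ t = ∑ i ∈ (hfin t).toFinset, w i := by
    intro t
    rw [hθdef]
    simp only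
    rw [tsum_eq_sum (s := (hfin t).toFinset)]
    · exact Finset.sum_congr rfl fun i hi => if_pos (by simpa using hi)
    · intro i hi
      exact if_neg (by simpa using hi)
  have hsub : ∀ n, Finset.range n ⊆ (hfin (w n)).toFinset := by
    intro n i hi
    simp only [Set.Finite.mem_toFinset, Set.mem_ofPred_eq]
    exact hm (Finset.mem_range.1 hi).le
  have hW1 : ∀ n, W n ≤ θ (w n) := by
    intro n
    rw [hθeq]
    exact Finset.sum_le_sum_of_subset_of_nonneg (hsub n) fun i _ _ => (hw i).le
  have hW2 : ∀ n, ∀ δ > 0, θ (w n - δ) ≤ W n := by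
    intro n δ hδ
    rw [hθeq]
    refine Finset.sum_le_sum_of_subset_of_nonneg (fun i hi => ?_) fun i _ _ => (hw i).le
    simp only [Set.Finite.mem_toFinset, Set.mem_ofPred_eq] at hi
    rw [Finset.mem_range]
    by_contra h
    have := hm (not_lt.1 h)
    linarith
  have hWlim : Tendsto (fun n => W n * Real.exp (-w n)) atTop (𝓝 1) := by
    have hup := hθ.comp hwt
    refine tendsto_order.2 ⟨fun b hb => ?_, fun b hb => ?_⟩
    · obtain ⟨δ, hδ, hδb⟩ : ∃ δ > 0, b < Real.exp (-δ) := by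
        have : Tendsto (fun δ : ℝ => Real.exp (-δ)) (𝓝[>] 0) (𝓝 1) := by
          have h : Continuous fun δ : ℝ => Real.exp (-δ) := by fun_prop
          have := h.tendsto 0
          simp only [neg_zero, Real.exp_zero] at this
          exact this.mono_left nhdsWithin_le_nhds
        obtain ⟨δ, h1, h2⟩ := ((this.eventually_const_lt hb).and self_mem_nhdsWithin).exists
        exact ⟨δ, h2, h1⟩
      have h1 : Tendsto (fun n => w n - δ) atTop atTop := tendsto_atTop_add_const_right _ _ hwt
      have h2 := (hθ.comp h1).const_mul (Real.exp (-δ))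
      rw [mul_one] at h2
      filter_upwards [h2.eventually_const_lt hδb] with n hn
      refine hn.trans_le ?_
      have : Real.exp (-δ) * (θ (w n - δ) * Real.exp (-(w n - δ))) = θ (w n - δ) * Real.exp (-w n) := by
        rw [mul_left_comm, ← Real.exp_add]; congr 2; ring
      simp only [Function.comp]
      rw [this]
      exact mul_le_mul_of_nonneg_right (hW2 n δ hδ) (Real.exp_pos _).le
    · filter_upwards [hup.eventually_lt_const hb] with n hn
      refine lt_of_le_of_lt ?_ hn
      exact mul_le_mul_of_nonneg_right (hW1 n) (Real.exp_pos _).le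
  have hbound : ∀ n, ‖∑ i ∈ Finset.range n, (w i : ℂ) * a i‖ * Real.exp (-w n) ≤
      ‖summatory w (fun i => w i * a i) (w n) * Real.exp (-w n)‖ +
        (θ (w n) * Real.exp (-w n) - W n * Real.exp (-w n)) := by
    intro n
    rw [norm_mul, Complex.norm_real, Real.norm_of_nonneg (Real.exp_pos _).le, ← sub_mul, ← add_mul]
    refine mul_le_mul_of_nonneg_right ?_ (Real.exp_pos _).le
    have e : summatory w (fun i => w i * a i) (w n) = ∑ i ∈ (hfin (w n)).toFinset, (w i : ℂ) * a i := by
      rw [summatory, tsum_eq_sum (s := (hfin (w n)).toFinset)]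
      · exact Finset.sum_congr rfl fun i hi => if_pos (by simpa using hi)
      · intro i hi
        exact if_neg (by simpa using hi)
    rw [e, hθeq, ← Finset.sum_sdiff (hsub n), ← Finset.sum_sdiff (hsub n) (f := w)]
    have h1 : ‖∑ i ∈ (hfin (w n)).toFinset \ Finset.range n, (w i : ℂ) * a i‖ ≤
        ∑ i ∈ (hfin (w n)).toFinset \ Finset.range n, w i := by
      refine norm_sum_le_of_le _ fun i _ => ?_
      rw [norm_mul, Complex.norm_real, Real.norm_of_nonneg (hw i).le]
      exact mul_le_of_le_one_right (hw i).le (ha i)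
    have h2 := norm_sub_le (∑ i ∈ (hfin (w n)).toFinset \ Finset.range n, (w i : ℂ) * a i +
      ∑ i ∈ Finset.range n, (w i : ℂ) * a i) (∑ i ∈ (hfin (w n)).toFinset \ Finset.range n, (w i : ℂ) * a i)
    rw [add_sub_cancel_left] at h2
    simp only [hWdef, add_sub_cancel_right]
    linarith
  have hlim0 : Tendsto (fun n => ‖∑ i ∈ Finset.range n, (w i : ℂ) * a i‖ * Real.exp (-w n)) atTop (𝓝 0) := by
    have h1 := (hA.comp hwt).norm.add ((hθ.comp hwt).sub hWlim)
    rw [norm_zero, sub_self, add_zero] at h1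
    exact squeeze_zero (fun n => by positivity) hbound h1
  filter_upwards [hlim0.eventually_lt_const (show 0 < ε / 2 by linarith),
    hWlim.eventually_const_lt (show (1/2 : ℝ) < 1 by norm_num)] with n h1 h2
  refine le_of_mul_le_mul_right ?_ (Real.exp_pos (-w n))
  have h3 : ε * (∑ i ∈ Finset.range n, w i) * Real.exp (-w n) = ε * (W n * Real.exp (-w n)) := by
    rw [hWdef]; ring
  rw [h3]
  nlinarith

namespace CharSemigroup
variable {M : Type*} [CancelCommMonoid M] [Countable M] (D : CharSemigroup M)

omit [Countable M] in
theorem map_pow (a : M) (n : ℕ) : D.ℓ (a ^ n) = n * D.ℓ a := by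
  induction n with
  | zero => simp [D.map_one]
  | succ n ih => rw [pow_succ, D.map_mul, ih]; push_cast; ring

theorem summable_higher (k : ℤ) :
    Summable fun x : ℕ × ℕ => ‖D.vM k (x.1, x.2 + 1)‖ * Real.exp (-(3 / 4) * D.lam (x.1, x.2 + 1)) := by
  have h := D.summable_vM 0 (3 / 2) (by norm_num)
  have h1 : Summable fun y : (ℕ × ℕ) × Fin 2 => (‖D.vM 0 y.1‖ * Real.exp (-(3 / 2) * D.lam y.1)) * 1 :=
    h.mul_of_nonneg (g := fun _ : Fin 2 => (1:ℝ)) (Summable.of_finite)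
      (fun x => by positivity) (fun x => zero_le_one)
  have hinj : Function.Injective fun x : ℕ × ℕ =>
      (((x.1, x.2 / 2), ⟨x.2 % 2, Nat.mod_lt _ (by norm_num)⟩) : (ℕ × ℕ) × Fin 2) := by
    rintro ⟨a, b⟩ ⟨a', b'⟩ h
    simp only [Prod.mk.injEq, Fin.mk.injEq] at h
    ext
    · exact h.1.1
    · simp only; omega
  refine Summable.of_nonneg_of_le (fun x => by positivity) (fun x => ?_) (h1.comp_injective hinj)
  simp only [Function.comp, mul_one, norm_vM, lam, D.map_pow]
  have := D.nonneg (D.p x.1)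
  refine mul_le_mul_of_nonneg_left (Real.exp_le_exp.2 ?_) this
  have h2 : ((x.2 / 2 : ℕ) : ℝ) ≤ (x.2 : ℝ) / 2 := Nat.cast_div_le
  push_cast
  nlinarith

theorem tendsto_primes (k : ℤ) {L : ℂ}
    (h : Tendsto (fun t => summatory D.lam (D.vM k) t * Real.exp (-t)) atTop (𝓝 L)) :
    Tendsto (fun t => summatory (fun i => D.ℓ (D.p i)) (fun i => D.ℓ (D.p i) * D.coef k (D.p i)) t *
      Real.exp (-t)) atTop (𝓝 L) := by
  have hs := fun t => summable_summatory (by norm_num) (D.summable_vM k 2 (by norm_num)) t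
  have e : ∀ t, summatory D.lam (D.vM k) t =
      summatory (fun i => D.ℓ (D.p i)) (fun i => D.ℓ (D.p i) * D.coef k (D.p i)) t +
      summatory (fun x : ℕ × ℕ => D.lam (x.1, x.2 + 1)) (fun x => D.vM k (x.1, x.2 + 1)) t := by
    intro t
    have h2 := summable_summatory (by norm_num) (D.summable_higher k) t
    have i1 : Function.Injective fun i : ℕ => (i, 0) := fun a b h => (Prod.mk.inj h).1
    have h1 := (hs t).comp_injective i1
    simp only [summatory]
    rw [(hs t).tsum_prod, h2.tsum_prod]
    have h3 := h1.tsum_add h2.prod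
    simp only [Function.comp] at h3
    have e1 : ∀ i, (if D.lam (i, 0) ≤ t then D.vM k (i, 0) else 0) =
      if D.ℓ (D.p i) ≤ t then D.ℓ (D.p i) * D.coef k (D.p i) else 0 := by
      intro i; simp [lam, vM]
    simp_rw [e1] at h3
    rw [← h3]
    refine tsum_congr fun i => ?_
    have := ((hs t).prod_factor i).tsum_eq_zero_add
    rw [this, e1]
  have hr : Tendsto (fun t => summatory (fun x : ℕ × ℕ => D.lam (x.1, x.2 + 1))
      (fun x => D.vM k (x.1, x.2 + 1)) t * Real.exp (-t)) atTop (𝓝 0) := by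
    set C := ∑' x : ℕ × ℕ, ‖D.vM k (x.1, x.2 + 1)‖ * Real.exp (-(3 / 4) * D.lam (x.1, x.2 + 1)) with hC
    have hz : Tendsto (fun t : ℝ => C * Real.exp (-(1 / 4 * t))) atTop (𝓝 (C * 0)) :=
      (Real.tendsto_exp_neg_atTop_nhds_zero.comp (tendsto_id.const_mul_atTop (by norm_num))).const_mul C
    rw [mul_zero] at hz
    refine squeeze_zero_norm (fun t => ?_) hz
    rw [norm_mul, Complex.norm_real, Real.norm_of_nonneg (Real.exp_pos _).le]
    calc _ ≤ C * Real.exp (3 / 4 * t) * Real.exp (-t) := by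
          gcongr
          exact norm_summatory_le (by norm_num) (D.summable_higher k) t
      _ = _ := by rw [mul_assoc, ← Real.exp_add]; congr 2; ring
  have := h.sub hr
  rw [sub_zero] at this
  refine this.congr fun t => ?_
  rw [e t]
  ring

/-- **Equidistribution of primes**: the means of a nontrivial power of the character over
the primes, ordered by norm, tend to zero. -/
theorem tendsto_mean (hinj : Function.Injective D.p) (hm : Monotone fun i => D.ℓ (D.p i)) {k : ℤ} (hk : k ≠ 0) :
    Tendsto (fun n : ℕ => (n : ℂ)⁻¹ * ∑ i ∈ Finset.range n, (D.χ (D.p i) : ℂ) ^ k) atTop (𝓝 0) := by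
  refine tendsto_mean_of_summatory (w := fun i => D.ℓ (D.p i)) (a := fun i => D.coef k (D.p i))
    (fun i => D.pos _ (D.p_ne_one i)) hm ?_ (fun i => (D.norm_coef k _).le) ?_
    (D.tendsto_primes k (D.tendsto_summatory_vM hk))
  · intro t
    exact (D.finite t).preimage hinj.injOn
  · have h : Tendsto (fun t => summatory D.lam (D.vM 0) t * Real.exp (-t)) atTop (𝓝 ((1 : ℝ) : ℂ)) := by
      refine ((Complex.continuous_ofReal.tendsto 1).comp D.tendsto_summatory_vM_zero).congr fun t => ?_
      have : D.vM 0 = fun x => ((D.ℓ (D.p x.1) : ℝ) : ℂ) := by ext x; simp [vM, coef]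
      rw [this, summatory_ofReal]
      simp
    have h2 := (Complex.continuous_re.tendsto _).comp (D.tendsto_primes 0 h)
    refine h2.congr fun t => ?_
    have : (fun i => (D.ℓ (D.p i) : ℂ) * D.coef 0 (D.p i)) = fun i => ((D.ℓ (D.p i) : ℝ) : ℂ) := by
      ext i; simp [coef]
    simp only [Function.comp]
    rw [this, summatory_ofReal, ← Complex.ofReal_mul, Complex.ofReal_re]

end CharSemigroup

/-- The argument `z / ‖z‖` of a complex number, equal to `0` at `0`. -/
noncomputable def phase (z : ℂ) : ℂ := z / ‖z‖

theorem phase_zero : phase 0 = 0 := by simp [phase]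

theorem norm_phase {z : ℂ} (hz : z ≠ 0) : ‖phase z‖ = 1 := by
  rw [phase, norm_div, Complex.norm_real, norm_norm]
  exact div_self (norm_ne_zero_iff.2 hz)

theorem norm_phase_le (z : ℂ) : ‖phase z‖ ≤ 1 := by
  by_cases hz : z = 0
  · simp [hz, phase_zero]
  · exact (norm_phase hz).le

theorem phase_inv (z : ℂ) : (phase z)⁻¹ = starRingEnd ℂ (phase z) := by
  by_cases hz : z = 0
  · simp [hz, phase_zero]
  · exact Complex.inv_eq_conj (norm_phase hz)

theorem norm_pow_sub_pow_le_mul {a b : ℂ} (ha : ‖a‖ ≤ 1) (hb : ‖b‖ ≤ 1) (n : ℕ) :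
    ‖a ^ n - b ^ n‖ ≤ n * ‖a - b‖ := by
  induction n with
  | zero => simp
  | succ n ih =>
    have e : a ^ (n + 1) - b ^ (n + 1) = (a ^ n - b ^ n) * a + b ^ n * (a - b) := by ring
    rw [e]
    refine (norm_add_le _ _).trans ?_
    rw [norm_mul, norm_mul]
    have h1 : ‖b ^ n‖ ≤ 1 := by rw [norm_pow]; exact pow_le_one₀ (norm_nonneg _) hb
    have h2 := mul_le_of_le_one_right (norm_nonneg (a ^ n - b ^ n)) ha
    have h3 := mul_le_of_le_one_left (norm_nonneg (a - b)) h1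
    push_cast
    linarith

theorem norm_phase_zpow_sub_le (y z : ℂ) (k : ℤ) :
    ‖phase y ^ k - phase z ^ k‖ ≤ |(k : ℝ)| * ‖phase y - phase z‖ := by
  obtain ⟨n, rfl | rfl⟩ := k.eq_nat_or_neg
  · simpa using norm_pow_sub_pow_le_mul (norm_phase_le y) (norm_phase_le z) n
  · have h := norm_pow_sub_pow_le_mul (a := (phase y)⁻¹) (b := (phase z)⁻¹)
      (by rw [phase_inv, RCLike.norm_conj]; exact norm_phase_le y)
      (by rw [phase_inv, RCLike.norm_conj]; exact norm_phase_le z) n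
    rw [phase_inv y, phase_inv z, ← _root_.map_sub, RCLike.norm_conj, ← phase_inv, ← phase_inv] at h
    simpa using h

theorem norm_phase_zpow_le (z : ℂ) (k : ℤ) : ‖phase z ^ k‖ ≤ 1 := by
  by_cases hz : z = 0
  · rw [hz, phase_zero, zero_zpow_eq]
    split_ifs <;> simp
  · rw [norm_zpow, norm_phase hz, one_zpow]

theorem norm_phase_sub_le {y z : ℂ} {d : ℝ} (h : ‖z - y‖ ≤ d) :
    ‖phase z - phase y‖ ≤ (2 * d + 2) / (‖y‖ + 1) := by
  have hy1 : 0 < ‖y‖ + 1 := by positivity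
  have h2 : ‖phase z - phase y‖ ≤ 2 := by
    have := norm_sub_le (phase z) (phase y)
    linarith [norm_phase_le y, norm_phase_le z]
  have h1 : ‖y‖ * ‖phase z - phase y‖ ≤ 2 * d := by
    by_cases hy : y = 0
    · have := (norm_nonneg _).trans h
      simp only [hy, norm_zero, zero_mul]; linarith
    have hy0 : 0 < ‖y‖ := norm_pos_iff.2 hy
    by_cases hz : z = 0
    · rw [hz, phase_zero, zero_sub, norm_neg, norm_phase hy]
      rw [hz, zero_sub, norm_neg] at h
      linarith
    have hz0 : 0 < ‖z‖ := norm_pos_iff.2 hz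
    have e : (‖y‖ : ℂ) * (phase z - phase y) = (z - y) + phase z * ((‖y‖ - ‖z‖ : ℝ) : ℂ) := by
      have h1 : (‖y‖ : ℂ) ≠ 0 := by exact_mod_cast hy0.ne'
      have h2 : (‖z‖ : ℂ) ≠ 0 := by exact_mod_cast hz0.ne'
      simp only [phase]
      push_cast
      field_simp
      ring
    have e2 := congrArg norm e
    rw [norm_mul, Complex.norm_real, norm_norm] at e2
    rw [e2]
    refine (norm_add_le _ _).trans ?_
    rw [norm_mul, norm_phase hz, one_mul, Complex.norm_real, Real.norm_eq_abs]
    have := abs_norm_sub_norm_le y z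
    rw [norm_sub_rev] at this
    linarith
  rw [le_div_iff₀ hy1]
  linarith

/-- The restriction of the `k`-th power of the phase to the disc of radius `R`. -/
noncomputable def discPhase (R : ℝ) (k : ℤ) (z : ℂ) : ℂ := if ‖z‖ ≤ R then phase z ^ k else 0

/-- A radial majorant for the oscillation of `discPhase` on scale `d`. -/
noncomputable def oscBound (R d : ℝ) (k : ℤ) (r : ℝ) : ℝ :=
  (Set.Icc (R - d) (R + d)).indicator 1 r +
    (Set.Iic R).indicator (fun r => |(k : ℝ)| * ((2 * d + 2) / (r + 1))) r

theorem norm_discPhase_le (R : ℝ) (k : ℤ) (z : ℂ) : ‖discPhase R k z‖ ≤ 1 := by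
  rw [discPhase]
  split_ifs
  · exact norm_phase_zpow_le z k
  · simp

theorem norm_discPhase_sub_le {R d : ℝ} (k : ℤ) {y z : ℂ} (h : ‖z - y‖ ≤ d) :
    ‖discPhase R k z - discPhase R k y‖ ≤ oscBound R d k ‖y‖ := by
  have hd : 0 ≤ d := (norm_nonneg _).trans h
  have h1 := abs_le.1 ((abs_norm_sub_norm_le z y).trans h)
  have hnn : 0 ≤ (Set.Iic R).indicator (fun r => |(k : ℝ)| * ((2 * d + 2) / (r + 1))) ‖y‖ := by
    by_cases hy : ‖y‖ ≤ R
    · rw [Set.indicator_of_mem (by exact hy)]; positivity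
    · rw [Set.indicator_of_notMem (by exact hy)]
  have hnn2 : 0 ≤ (Set.Icc (R - d) (R + d)).indicator (1 : ℝ → ℝ) ‖y‖ :=
    Set.indicator_nonneg (fun _ _ => zero_le_one) _
  rw [oscBound]
  by_cases hz : ‖z‖ ≤ R
  · by_cases hy : ‖y‖ ≤ R
    · rw [Set.indicator_of_mem (show ‖y‖ ∈ Set.Iic R from hy)]
      simp only [discPhase, hz, hy, if_true]
      have := (norm_phase_zpow_sub_le z y k).trans
        (mul_le_mul_of_nonneg_left (norm_phase_sub_le h) (abs_nonneg (k:ℝ)))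
      linarith
    · rw [Set.indicator_of_mem (s := Set.Icc (R - d) (R + d)) ⟨by linarith, by linarith⟩]
      have e : discPhase R k y = 0 := if_neg hy
      rw [e, sub_zero, Pi.one_apply]
      linarith [norm_discPhase_le R k z]
  · by_cases hy : ‖y‖ ≤ R
    · rw [Set.indicator_of_mem (s := Set.Icc (R - d) (R + d)) ⟨by linarith, by linarith⟩]
      have e : discPhase R k z = 0 := if_neg hz
      rw [e, zero_sub, norm_neg, Pi.one_apply]
      linarith [norm_discPhase_le R k y]
    · simp only [discPhase, hz, hy, if_false, sub_zero, norm_zero]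
      linarith

theorem measurable_phase : Measurable phase := by
  unfold phase; fun_prop

theorem measurable_discPhase (R : ℝ) (k : ℤ) : Measurable (discPhase R k) := by
  refine Measurable.ite (measurableSet_le measurable_norm measurable_const) ?_ measurable_const
  obtain ⟨n, rfl | rfl⟩ := k.eq_nat_or_neg
  · simp only [zpow_natCast]; exact measurable_phase.pow_const n
  · simp only [zpow_neg, zpow_natCast]; exact (measurable_phase.pow_const n).inv

theorem integrable_discPhase (R : ℝ) (k : ℤ) : Integrable (discPhase R k) := by
  have : Integrable ((Metric.closedBall (0:ℂ) R).indicator fun _ => (1:ℝ)) :=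
    (integrable_indicator_iff Metric.isClosed_closedBall.measurableSet).2
      (integrableOn_const (measure_closedBall_lt_top).ne)
  refine this.mono' (measurable_discPhase R k).aestronglyMeasurable (Eventually.of_forall fun z => ?_)
  by_cases hz : ‖z‖ ≤ R
  · rw [Set.indicator_of_mem (by simpa using hz)]
    exact norm_discPhase_le R k z
  · have e : discPhase R k z = 0 := if_neg hz
    rw [e, norm_zero]
    exact Set.indicator_nonneg (fun _ _ => zero_le_one) _

theorem integral_discPhase_zero {R : ℝ} (hR : 0 ≤ R) : ∫ z, discPhase R 0 z = Real.pi * R ^ 2 := by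
  have : discPhase R 0 = (Metric.closedBall (0:ℂ) R).indicator fun _ => (1:ℂ) := by
    ext z
    simp [discPhase, Set.indicator, Metric.mem_closedBall]
  rw [this, integral_indicator Metric.isClosed_closedBall.measurableSet, setIntegral_const, Measure.real,
    Complex.volume_closedBall]
  simp only [ENNReal.toReal_mul, ENNReal.toReal_pow, ENNReal.toReal_ofReal hR, ENNReal.coe_toReal,
    NNReal.coe_real_pi, Complex.real_smul]
  push_cast
  ring

theorem phase_mul {a : ℂ} (ha : ‖a‖ = 1) (z : ℂ) : phase (a * z) = a * phase z := by
  rw [phase, phase, norm_mul, ha, one_mul, mul_div_assoc]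

theorem integral_discPhase {R : ℝ} {k : ℤ} (hk : k ≠ 0) : ∫ z, discPhase R k z = 0 := by
  set θ : ℝ := Real.pi / k with hθ
  set a : Circle := Circle.exp θ with ha
  have ha1 : ‖(a : ℂ)‖ = 1 := Circle.norm_coe a
  have hk' : (k : ℂ) ≠ 0 := by exact_mod_cast hk
  have hak : (a : ℂ) ^ k = -1 := by
    rw [ha, Circle.coe_exp, ← Complex.exp_int_mul, hθ, ← Complex.exp_pi_mul_I]
    congr 1
    push_cast
    field_simp
  have h := (LinearIsometryEquiv.measurePreserving (rotation a)).integral_comp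
    (rotation a).toHomeomorph.measurableEmbedding (discPhase R k)
  have e : ∀ z, discPhase R k (rotation a z) = -discPhase R k z := by
    intro z
    rw [rotation_apply, discPhase, discPhase, norm_mul, ha1, one_mul, phase_mul ha1, mul_zpow, hak]
    split_ifs <;> simp
  simp_rw [e] at h
  rw [integral_neg] at h
  exact self_eq_neg.1 h.symm

theorem integrable_integral_oscBound {d : ℝ} (hd : 0 ≤ d) (k : ℤ) : ∃ C, ∀ R, 1 ≤ R →
    Integrable (fun z : ℂ => oscBound R d k ‖z‖) ∧ ∫ z : ℂ, oscBound R d k ‖z‖ ≤ C * R := by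
  refine ⟨2 * Real.pi * ((1 + d) * (2 * d) + |(k : ℝ)| * (2 * d + 2)), fun R hR => ?_⟩
  have hmeas : Measurable (oscBound R d k) := by
    refine Measurable.add (measurable_one.indicator measurableSet_Icc) (Measurable.indicator ?_ measurableSet_Iic)
    fun_prop
  have hb : ∀ y ∈ Set.Ioi (0:ℝ), ‖y * oscBound R d k y‖ ≤ (Set.Icc (R - d) (R + d)).indicator (fun _ => R + d) y +
      (Set.Ioc 0 R).indicator (fun _ => |(k : ℝ)| * (2 * d + 2)) y := by
    intro y hy
    have hy0 : 0 < y := hy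
    have hnn : 0 ≤ oscBound R d k y := by
      refine add_nonneg (Set.indicator_nonneg (fun _ _ => zero_le_one) _) (Set.indicator_apply_nonneg fun _ => ?_)
      positivity
    rw [Real.norm_of_nonneg (by positivity), oscBound, mul_add]
    refine add_le_add ?_ ?_
    · by_cases h : y ∈ Set.Icc (R - d) (R + d)
      · simp only [Set.indicator_of_mem h, Pi.one_apply, mul_one]; exact h.2
      · simp [Set.indicator_of_notMem h]
    · by_cases h : y ≤ R
      · rw [Set.indicator_of_mem (show y ∈ Set.Iic R from h), Set.indicator_of_mem (show y ∈ Set.Ioc 0 R from ⟨hy0, h⟩),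
          mul_left_comm]
        gcongr
        rw [mul_div_assoc', div_le_iff₀ (by positivity)]
        nlinarith
      · rw [Set.indicator_of_notMem (show y ∉ Set.Iic R from h), Set.indicator_of_notMem (fun h' => h h'.2)]
        simp
  have i1 : IntegrableOn ((Set.Icc (R - d) (R + d)).indicator (fun _ => R + d)) (Set.Ioi 0) :=
    ((integrable_indicator_iff measurableSet_Icc).2 (integrableOn_const (by simp))).integrableOn
  have i2 : IntegrableOn ((Set.Ioc 0 R).indicator (fun _ => |(k : ℝ)| * (2 * d + 2))) (Set.Ioi 0) :=
    ((integrable_indicator_iff measurableSet_Ioc).2 (integrableOn_const (by simp))).integrableOn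
  have hSint : IntegrableOn (fun y : ℝ => y * oscBound R d k y) (Set.Ioi 0) := by
    refine (i1.add i2).mono' (measurable_id.mul hmeas).aestronglyMeasurable ?_
    filter_upwards [ae_restrict_mem measurableSet_Ioi] with y hy
    exact hb y hy
  constructor
  · refine (integrable_fun_norm_addHaar (volume : Measure ℂ) (f := oscBound R d k)).2 ?_
    simpa [Complex.finrank_real_complex] using hSint
  · rw [integral_fun_norm_addHaar (volume : Measure ℂ) (oscBound R d k)]
    have e : (volume : Measure ℂ).real (Metric.ball 0 1) = Real.pi := by
      rw [Measure.real, Complex.volume_ball]; simp [NNReal.coe_real_pi]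
    rw [e, Complex.finrank_real_complex]
    simp only [Nat.add_one_sub_one, pow_one, smul_eq_mul, nsmul_eq_mul, Nat.cast_ofNat]
    have hle : ∫ y in Set.Ioi (0:ℝ), y * oscBound R d k y ≤ (R + d) * (2 * d) + |(k : ℝ)| * (2 * d + 2) * R := by
      calc _ ≤ ∫ y in Set.Ioi (0:ℝ), ((Set.Icc (R - d) (R + d)).indicator (fun _ => R + d) y +
              (Set.Ioc 0 R).indicator (fun _ => |(k : ℝ)| * (2 * d + 2)) y) := by
            refine setIntegral_mono_on hSint (i1.add i2) measurableSet_Ioi fun y hy => ?_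
            exact (le_abs_self _).trans (hb y hy)
        _ ≤ _ := by
            rw [integral_add i1 i2]
            refine add_le_add ?_ ?_
            · calc _ ≤ ∫ y, (Set.Icc (R - d) (R + d)).indicator (fun _ => R + d) y :=
                    setIntegral_le_integral ((integrable_indicator_iff measurableSet_Icc).2 (integrableOn_const (by simp)))
                      (Eventually.of_forall fun y => Set.indicator_nonneg (fun _ _ => by linarith) _)
                _ = _ := by
                    rw [integral_indicator measurableSet_Icc, setIntegral_const, Real.volume_real_Icc_of_le (by linarith)]
                    simp only [smul_eq_mul]; ring
            · calc _ ≤ ∫ y, (Set.Ioc 0 R).indicator (fun _ => |(k : ℝ)| * (2 * d + 2)) y :=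
                    setIntegral_le_integral ((integrable_indicator_iff measurableSet_Ioc).2 (integrableOn_const (by simp)))
                      (Eventually.of_forall fun y => Set.indicator_nonneg (fun _ _ => by positivity) _)
                _ = _ := by
                    rw [integral_indicator measurableSet_Ioc, setIntegral_const, Real.volume_real_Ioc_of_le (by linarith)]
                    simp only [smul_eq_mul]; ring
    have hpi := Real.pi_pos
    calc _ ≤ 2 * (Real.pi * ((R + d) * (2 * d) + |(k : ℝ)| * (2 * d + 2) * R)) := by gcongr
      _ ≤ 2 * (Real.pi * ((R + d * R) * (2 * d) + |(k : ℝ)| * (2 * d + 2) * R)) := by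
        gcongr
        nlinarith
      _ = _ := by ring

section Lattice

open Submodule ZSpan

variable (b : Module.Basis (Fin 2) ℝ ℂ)

theorem finite_setOf_norm_add_le (z : ℂ) (R : ℝ) :
    {v : span ℤ (Set.range b) | ‖z + v‖ ≤ R}.Finite := by
  have h := setFinite_inter b (Metric.isBounded_closedBall (x := -z) (r := R))
  refine Set.Finite.of_finite_image (f := Subtype.val) (h.subset ?_) Subtype.val_injective.injOn
  rintro _ ⟨v, hv, rfl⟩
  refine ⟨?_, v.2⟩
  rw [Metric.mem_closedBall, dist_eq_norm, sub_neg_eq_add, add_comm]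
  exact hv

theorem norm_le_of_mem_fundamentalDomain {x : ℂ} (hx : x ∈ fundamentalDomain b) :
    ‖x‖ ≤ ∑ i, ‖b i‖ := by
  rw [← fract_eq_self.2 hx]
  exact norm_fract_le b x

theorem summable_setIntegral_fundamentalDomain {E : Type*} [NormedAddCommGroup E] [NormedSpace ℝ E]
    {f : ℂ → E} {R : ℝ} (hf : ∀ z, R < ‖z‖ → f z = 0) (z : ℂ) :
    Summable fun v : span ℤ (Set.range b) => ∫ x in fundamentalDomain b, f (z + (v + x)) := by
  refine summable_of_hasFiniteSupport
    ((finite_setOf_norm_add_le b z (R + ∑ i, ‖b i‖)).subset fun v hv => ?_)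
  by_contra hv'
  refine hv ?_
  refine setIntegral_eq_zero_of_forall_eq_zero fun x hx => hf _ ?_
  have h1 := norm_le_of_mem_fundamentalDomain b hx
  have h2 : R + ∑ i, ‖b i‖ < ‖z + v‖ := lt_of_not_ge hv'
  have h3 : ‖z + v‖ ≤ ‖z + (v + x)‖ + ‖x‖ := by
    have := norm_sub_le (z + (v + x)) x
    rwa [show z + (v + x) - x = z + v by ring] at this
  linarith

theorem tsum_setIntegral_fundamentalDomain {E : Type*} [NormedAddCommGroup E] [NormedSpace ℝ E]
    {f : ℂ → E} (hf : Integrable f) (z : ℂ) :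
    ∑' v : span ℤ (Set.range b), ∫ x in fundamentalDomain b, f (z + (v + x)) = ∫ x, f x := by
  have : VAddInvariantMeasure (span ℤ (Set.range b)) ℂ volume :=
    ⟨fun c s _ => measure_preimage_add volume (c : ℂ) s⟩
  rw [← integral_add_left_eq_self f z,
    (ZSpan.isAddFundamentalDomain b volume).integral_eq_tsum'' _ (hf.comp_add_left z)]
  simp only [Submodule.vadd_def, vadd_eq_add]

theorem exists_tsum_discPhase_lattice : ∃ κ : ℝ, 0 < κ ∧ ∀ (z : ℂ) (k : ℤ), ∃ C, ∀ R : ℝ, 1 ≤ R →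
    ‖∑' v : span ℤ (Set.range b), discPhase R k (z + v) -
      (if k = 0 then (κ : ℂ) else 0) * R ^ 2‖ ≤ C * R := by
  set F := fundamentalDomain b with hF
  set V : ℝ := volume.real F with hV
  have hFfin : volume F ≠ ⊤ := (fundamentalDomain_isBounded b).measure_lt_top.ne
  have hV0 : 0 < V := ENNReal.toReal_pos (measure_fundamentalDomain_ne_zero b) hFfin
  set d : ℝ := ∑ i, ‖b i‖ with hd
  have hd0 : 0 ≤ d := Finset.sum_nonneg fun _ _ => norm_nonneg _
  refine ⟨Real.pi / V, div_pos Real.pi_pos hV0, fun z k => ?_⟩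
  obtain ⟨C, hC⟩ := integrable_integral_oscBound hd0 k
  refine ⟨C / V, fun R hR => ?_⟩
  obtain ⟨hi, hCR⟩ := hC R hR
  have hSint : ∫ x, discPhase R k x = V * ((if k = 0 then ((Real.pi / V : ℝ) : ℂ) else 0) * R ^ 2) := by
    by_cases hk : k = 0
    · have : (V : ℂ) ≠ 0 := by exact_mod_cast hV0.ne'
      subst hk
      rw [integral_discPhase_zero (by linarith), if_pos rfl]
      push_cast
      field_simp
    · rw [integral_discPhase hk, if_neg hk]; simp
  have hdz : ∀ x, R < ‖x‖ → discPhase R k x = 0 := fun x hx => if_neg (not_le.2 hx)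
  have hoz : ∀ x : ℂ, R + d < ‖x‖ → oscBound R d k ‖x‖ = 0 := fun x hx => by
    rw [oscBound, Set.indicator_of_notMem (fun h => absurd h.2 (not_le.2 hx)),
      Set.indicator_of_notMem (fun h => absurd (Set.mem_Iic.1 h) (by linarith)), add_zero]
  have hs1 : Summable fun v : span ℤ (Set.range b) => (V : ℂ) * discPhase R k (z + v) := by
    refine summable_of_hasFiniteSupport ((finite_setOf_norm_add_le b z R).subset fun v hv => ?_)
    by_contra hv'
    refine hv ?_
    simp only [hdz _ (lt_of_not_ge hv'), mul_zero]
  have hs2 := summable_setIntegral_fundamentalDomain b hdz z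
  have hs3 := summable_setIntegral_fundamentalDomain b hoz z
  have hkey : ∀ v : span ℤ (Set.range b),
      ‖(V : ℂ) * discPhase R k (z + v) - ∫ x in F, discPhase R k (z + (v + x))‖ ≤
        ∫ x in F, oscBound R d k ‖z + (v + x)‖ := by
    intro v
    have e1 : (V : ℂ) * discPhase R k (z + v) = ∫ x in F, discPhase R k (z + v) := by
      rw [setIntegral_const, Complex.real_smul]
    have i1 : IntegrableOn (fun _ : ℂ => discPhase R k (z + v)) F := integrableOn_const hFfin
    have i2 : Integrable (fun x => discPhase R k (z + (v + x))) :=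
      ((integrable_discPhase R k).comp_add_left z).comp_add_left (v : ℂ)
    have i3 : Integrable (fun x => oscBound R d k ‖z + (v + x)‖) :=
      (hi.comp_add_left z).comp_add_left (v : ℂ)
    rw [e1, ← integral_sub i1 i2.integrableOn]
    refine norm_integral_le_of_norm_le i3.integrableOn ?_
    filter_upwards [ae_restrict_mem (fundamentalDomain_measurableSet b)] with x hx
    refine norm_discPhase_sub_le k ?_
    rw [show z + v - (z + (v + x)) = -x by ring, norm_neg]
    exact norm_le_of_mem_fundamentalDomain b hx
  have hmain : ‖(V : ℂ) * (∑' v : span ℤ (Set.range b), discPhase R k (z + v) -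
      (if k = 0 then ((Real.pi / V : ℝ) : ℂ) else 0) * R ^ 2)‖ ≤ C * R := by
    rw [mul_sub, ← hSint, ← tsum_mul_left, ← tsum_setIntegral_fundamentalDomain b (integrable_discPhase R k) z,
      ← hs1.tsum_sub hs2]
    refine (tsum_of_norm_bounded hs3.hasSum hkey).trans ?_
    rw [tsum_setIntegral_fundamentalDomain b hi z]
    exact hCR
  rw [norm_mul, Complex.norm_real, Real.norm_of_nonneg hV0.le] at hmain
  rw [div_mul_eq_mul_div, le_div_iff₀ hV0]
  linarith

end Lattice

section Ideals

open Submodule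

variable {K : Type*} [Field K]

theorem exists_im_ne_zero (himag : IsEmpty (K →+* ℝ)) (emb : K →+* ℂ) : ∃ y, (emb y).im ≠ 0 := by
  by_contra! h
  have hr : ComplexEmbedding.IsReal emb := by
    rw [ComplexEmbedding.isReal_iff]
    ext y
    exact Complex.conj_eq_iff_im.2 (h y)
  exact himag.false hr.embedding

theorem top_le_span_emb (himag : IsEmpty (K →+* ℝ)) (emb : K →+* ℂ) :
    ⊤ ≤ span ℝ (Set.range emb) := by
  obtain ⟨y, hy⟩ := exists_im_ne_zero himag emb
  intro z _
  have h1 : (1 : ℂ) ∈ span ℝ (Set.range emb) := subset_span ⟨1, map_one emb⟩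
  have h2 : emb y ∈ span ℝ (Set.range emb) := subset_span ⟨y, rfl⟩
  have e : z = (z.re - z.im / (emb y).im * (emb y).re) • (1 : ℂ) + (z.im / (emb y).im) • emb y := by
    apply Complex.ext
    · simp
    · simp [hy]
  rw [e]
  exact add_mem (smul_mem _ _ h1) (smul_mem _ _ h2)

variable [NumberField K]

theorem emb_mem_span_ideal (emb : K →+* ℂ) {I : Ideal (𝓞 K)} (hI : I ≠ ⊥) (y : K) :
    emb y ∈ span ℝ ((fun a : 𝓞 K => emb a) '' I) := by
  obtain ⟨m, hm, hmy⟩ := ((IsFractionRing.isAlgebraic_iff ℤ ℚ K).2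
    (Algebra.IsAlgebraic.isAlgebraic y)).exists_integral_multiple
  set N : ℕ := Ideal.absNorm I
  have hN : N ≠ 0 := Ideal.absNorm_eq_zero_iff.not.2 hI
  let w : 𝓞 K := ⟨m • y, hmy⟩
  have hw : (w : K) = m * y := by
    change m • y = _
    rw [zsmul_eq_mul]
  have hmem : (N : 𝓞 K) * w ∈ I := I.mul_mem_right _ (Ideal.absNorm_mem I)
  have e : emb y = ((N : ℝ) * m)⁻¹ • emb ((N : 𝓞 K) * w : 𝓞 K) := by
    have h1 : (N : ℂ) ≠ 0 := by exact_mod_cast hN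
    have h2 : (m : ℂ) ≠ 0 := by exact_mod_cast hm
    have e3 : (((N : 𝓞 K) * w : 𝓞 K) : K) = N * (m * y) := by
      rw [← hw]; simp
    rw [e3, Complex.real_smul]
    push_cast
    simp only [map_mul, map_natCast, map_intCast]
    field_simp
  rw [e]
  exact smul_mem _ _ (subset_span ⟨_, hmem, rfl⟩)

theorem exists_tsum_discPhase_ideal (hdeg : Module.finrank ℚ K = 2) (himag : IsEmpty (K →+* ℝ))
    (emb : K →+* ℂ) {I : Ideal (𝓞 K)} (hI : I ≠ ⊥) :
    ∃ κ : ℝ, 0 < κ ∧ ∀ (α : 𝓞 K) (k : ℤ), ∃ C, ∀ R : ℝ, 1 ≤ R →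
      ‖∑' a : I, discPhase R k (emb ((α + a : 𝓞 K) : K)) -
        (if k = 0 then (κ : ℂ) else 0) * R ^ 2‖ ≤ C * R := by
  let B := Ideal.selfBasis (Module.finBasisOfFinrankEq ℤ (𝓞 K) ((RingOfIntegers.rank K).trans hdeg)) I hI
  let φ : 𝓞 K →ₗ[ℤ] ℂ := (emb.comp (algebraMap (𝓞 K) K)).toAddMonoidHom.toIntLinearMap
  have hφ : ∀ a, φ a = emb a := fun a => rfl
  have hφi : Function.Injective φ := emb.injective.comp RingOfIntegers.coe_injective
  have hBI : span ℤ (Set.range fun i => (B i : 𝓞 K)) = I.restrictScalars ℤ := by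
    have := congrArg (Submodule.map (I.subtype.restrictScalars ℤ)) B.span_eq
    rw [Submodule.map_span, ← Set.range_comp, Submodule.map_top] at this
    ext x
    rw [show (fun i => (B i : 𝓞 K)) = (I.subtype.restrictScalars ℤ) ∘ B from rfl, this]
    simp
  set u : Fin 2 → ℂ := fun i => φ (B i) with hu
  have hmap : (I.restrictScalars ℤ).map φ = span ℤ (Set.range u) := by
    rw [← hBI, Submodule.map_span, ← Set.range_comp]; rfl
  have htop : ⊤ ≤ span ℝ (Set.range u) := by
    refine (top_le_span_emb himag emb).trans (span_le.2 ?_)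
    rintro _ ⟨y, rfl⟩
    refine (span_le.2 ?_ : span ℝ ((fun a : 𝓞 K => emb a) '' I) ≤ _) (emb_mem_span_ideal emb hI y)
    rintro _ ⟨a, ha, rfl⟩
    have : φ a ∈ span ℤ (Set.range u) := hmap ▸ Submodule.mem_map_of_mem (p := I.restrictScalars ℤ) ha
    exact span_subset_span ℤ ℝ _ this
  let b : Module.Basis (Fin 2) ℝ ℂ := basisOfTopLeSpanOfCardEqFinrank u htop
    (by simp [Complex.finrank_real_complex])
  have hb : ⇑b = u := coe_basisOfTopLeSpanOfCardEqFinrank u htop _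
  obtain ⟨κ, hκ, h⟩ := exists_tsum_discPhase_lattice b
  refine ⟨κ, hκ, fun α k => ?_⟩
  obtain ⟨C, hC⟩ := h (emb α) k
  refine ⟨C, fun R hR => ?_⟩
  convert hC R hR using 3
  rw [hb]
  let e : I ≃ span ℤ (Set.range u) :=
    (Submodule.equivMapOfInjective φ hφi (I.restrictScalars ℤ)).toEquiv.trans
      (LinearEquiv.ofEq _ _ hmap).toEquiv
  rw [← e.tsum_eq]
  refine tsum_congr fun a => ?_
  have : (e a : ℂ) = emb (a : 𝓞 K) := rfl
  rw [this, ← map_add emb]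
  rfl

end Ideals

section ImaginaryQuadratic

variable {K : Type*} [Field K] [NumberField K]

theorem norm_emb_sq (hdeg : Module.finrank ℚ K = 2) (himag : IsEmpty (K →+* ℝ))
    (φ : K →+* ℂ) (x : K) : ‖φ x‖ ^ 2 = |(Algebra.norm ℚ x : ℚ)| := by
  have hnr : ∀ w : InfinitePlace K, ¬ w.IsReal := fun w hw =>
    himag.false (InfinitePlace.embedding_of_isReal hw)
  have h0 : InfinitePlace.nrRealPlaces K = 0 :=
    nrRealPlaces_eq_zero_iff.2 ((isTotallyComplex_iff K).2 fun w =>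
      InfinitePlace.not_isReal_iff_isComplex.1 (hnr w))
  have h1 := InfinitePlace.card_add_two_mul_card_eq_rank K
  have h2 := InfinitePlace.card_eq_nrRealPlaces_add_nrComplexPlaces K
  have hcard : Fintype.card (InfinitePlace K) = 1 := by omega
  obtain ⟨w, hw⟩ := Fintype.card_eq_one_iff.1 hcard
  have huniv : (Finset.univ : Finset (InfinitePlace K)) = {InfinitePlace.mk φ} := by
    ext v
    simp [hw v, hw (InfinitePlace.mk φ)]
  have h := InfinitePlace.prod_eq_abs_norm x
  rw [huniv, Finset.prod_singleton, InfinitePlace.mult, if_neg (hnr _), InfinitePlace.apply] at h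
  rw [h]

theorem norm_emb_sq_eq_absNorm (hdeg : Module.finrank ℚ K = 2) (himag : IsEmpty (K →+* ℝ))
    (φ : K →+* ℂ) (α : 𝓞 K) : ‖φ α‖ ^ 2 = Ideal.absNorm (Ideal.span {α}) := by
  rw [norm_emb_sq hdeg himag, ← Algebra.coe_norm_int, Ideal.absNorm_span_singleton, Nat.cast_natAbs]
  push_cast
  rfl

theorem finite_units_of_imaginary_quadratic (hdeg : Module.finrank ℚ K = 2)
    (himag : IsEmpty (K →+* ℝ)) : Finite (𝓞 K)ˣ := by
  have h := Embeddings.finite_of_norm_le K ℂ 1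
  refine Set.finite_univ_iff.1 (Set.Finite.of_finite_image (f := fun u : (𝓞 K)ˣ => ((u : 𝓞 K) : K))
    (h.subset ?_) fun u _ v _ huv => Units.ext (RingOfIntegers.coe_injective huv))
  rintro _ ⟨u, -, rfl⟩
  refine ⟨RingOfIntegers.isIntegral_coe _, fun φ => ?_⟩
  have h1 := norm_emb_sq_eq_absNorm hdeg himag φ (u : 𝓞 K)
  rw [Ideal.span_singleton_eq_top.2 u.isUnit, Ideal.absNorm_top, Nat.cast_one] at h1
  exact (pow_le_one_iff_of_nonneg (norm_nonneg _) two_ne_zero).1 h1.le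

end ImaginaryQuadratic

section RayClasses

variable {A : Type*} [CommRing A] [IsDedekindDomain A]

/-- The monoid of nonzero ideals coprime to `𝔑`. -/
def coprimeIdeals (𝔑 : Ideal A) : Submonoid (Ideal A) where
  carrier := {𝔞 | 𝔞 ≠ ⊥ ∧ IsCoprime 𝔞 𝔑}
  mul_mem' ha hb := ⟨mul_ne_zero ha.1 hb.1, ha.2.mul_left hb.2⟩
  one_mem' := ⟨one_ne_zero, isCoprime_one_left⟩

variable {𝔑 : Ideal A}

instance : CancelCommMonoid (coprimeIdeals 𝔑) where
  __ := (inferInstance : CommMonoid (coprimeIdeals 𝔑))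
  mul_left_cancel a _ _ h := Subtype.ext (mul_left_cancel₀ a.2.1 (congrArg Subtype.val h))

theorem coprimeIdeals_le : coprimeIdeals 𝔑 ≤ nonZeroDivisors (Ideal A) := fun _ h =>
  mem_nonZeroDivisors_of_ne_zero h.1

/-- The ideals `𝔞` for which `𝔞 * 𝔟` has a generator congruent to `1` modulo `𝔑`. -/
def rayClass (b : coprimeIdeals 𝔑) : Set (coprimeIdeals 𝔑) :=
  {a | ∃ α : A, α - 1 ∈ 𝔑 ∧ (a * b : Ideal A) = Ideal.span {α}}

theorem rayClass_subset {b c d : coprimeIdeals 𝔑} (h1 : d ∈ rayClass b) (h2 : d ∈ rayClass c) :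
    rayClass b ⊆ rayClass c := by
  rintro a ⟨β, hβ, hab⟩
  obtain ⟨α, hα, hdb⟩ := h1
  obtain ⟨γ, hγ, hdc⟩ := h2
  have hα0 : Ideal.span {α} ≠ 0 := hdb ▸ mul_ne_zero d.2.1 b.2.1
  have e : Ideal.span {α} * (a * c : Ideal A) = Ideal.span {β * γ} := by
    rw [← Ideal.span_singleton_mul_span_singleton, ← hab, ← hdb, ← hdc]
    ring
  have hdvd : α ∣ β * γ :=
    Ideal.span_singleton_le_span_singleton.1 (e.symm.le.trans Ideal.mul_le_left)
  obtain ⟨η, hη⟩ := hdvd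
  refine ⟨η, ?_, ?_⟩
  · have : η - 1 = (β - 1) * γ + (γ - 1) - η * (α - 1) := by linear_combination -hη
    rw [this]
    exact sub_mem (add_mem (𝔑.mul_mem_right _ hβ) hγ) (𝔑.mul_mem_left _ hα)
  · rw [hη, ← Ideal.span_singleton_mul_span_singleton] at e
    exact mul_left_cancel₀ hα0 e

theorem rayClass_eq {b c d : coprimeIdeals 𝔑} (h1 : d ∈ rayClass b) (h2 : d ∈ rayClass c) :
    rayClass b = rayClass c :=
  (rayClass_subset h1 h2).antisymm (rayClass_subset h2 h1)

omit [IsDedekindDomain A] in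
theorem exists_ne_zero_mk_eq (h𝔑 : 𝔑 ≠ ⊥) (r : A ⧸ 𝔑) : ∃ δ : A, δ ≠ 0 ∧ Ideal.Quotient.mk 𝔑 δ = r := by
  obtain ⟨δ, rfl⟩ := Ideal.Quotient.mk_surjective r
  obtain ⟨n, hn, hn0⟩ := Submodule.exists_mem_ne_zero_of_ne_bot h𝔑
  by_cases h : δ = 0
  · exact ⟨n, hn0, by rw [h, map_zero, Ideal.Quotient.eq_zero_iff_mem.2 hn]⟩
  · exact ⟨δ, h, rfl⟩

theorem exists_finset_rayClass [Finite (ClassGroup A)] [Finite (A ⧸ 𝔑)] (h𝔑 : 𝔑 ≠ ⊥) :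
    ∃ S : Set (coprimeIdeals 𝔑), S.Finite ∧ ∀ a, ∃ b ∈ S, a ∈ rayClass b := by
  let cl : coprimeIdeals 𝔑 →* ClassGroup A := ClassGroup.mk0.comp (Submonoid.inclusion coprimeIdeals_le)
  choose δ hδ0 hδ using exists_ne_zero_mk_eq h𝔑
  have hrep : ∀ g, ∃ a : coprimeIdeals 𝔑, g ∈ Set.range cl → cl a = g := fun g => by
    by_cases hg : g ∈ Set.range cl
    · exact ⟨hg.choose, fun _ => hg.choose_spec⟩
    · exact ⟨1, fun h => absurd h hg⟩
  choose R hR using hrep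
  set h := Nat.card (ClassGroup A)
  refine ⟨{b | ∃ x : ClassGroup A × (A ⧸ 𝔑), (R x.1 ^ (h - 1) : Ideal A) * Ideal.span {δ x.2} = b}, ?_, ?_⟩
  · refine Set.Finite.of_finite_image (f := Subtype.val)
      ((Set.finite_range fun x : ClassGroup A × (A ⧸ 𝔑) =>
        (R x.1 ^ (h - 1) : Ideal A) * Ideal.span {δ x.2}).subset ?_) Subtype.val_injective.injOn
    rintro _ ⟨b, ⟨x, hx⟩, rfl⟩
    exact ⟨x, hx⟩
  · intro a
    have h1 : cl (a * R (cl a) ^ (h - 1)) = 1 := by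
      rw [map_mul, map_pow, hR _ ⟨a, rfl⟩, mul_pow_sub_one Nat.card_pos.ne', pow_card_eq_one']
    obtain ⟨γ, hγ⟩ := ((ClassGroup.mk0_eq_one_iff _).1 h1).principal
    change (a * R (cl a) ^ (h - 1) : Ideal A) = Ideal.span {γ} at hγ
    have hco : IsCoprime (Ideal.span {γ}) 𝔑 := hγ ▸ (a * R (cl a) ^ (h - 1)).2.2
    rw [Ideal.isCoprime_iff_sup_eq, Ideal.eq_top_iff_one, Ideal.mem_span_singleton_sup] at hco
    obtain ⟨δ', n, hn, hδn⟩ := hco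
    set r := Ideal.Quotient.mk 𝔑 δ'
    have hr : δ r - δ' ∈ 𝔑 := Ideal.Quotient.eq.1 (hδ r)
    have hγδ : γ * δ r - 1 ∈ 𝔑 := by
      have : γ * δ r - 1 = γ * (δ r - δ') - n := by linear_combination hδn
      rw [this]
      exact sub_mem (𝔑.mul_mem_left _ hr) hn
    have hδc : IsCoprime (Ideal.span {δ r}) 𝔑 := by
      rw [Ideal.isCoprime_iff_sup_eq, Ideal.eq_top_iff_one, Ideal.mem_span_singleton_sup]
      exact ⟨γ, 1 - γ * δ r, by rw [← neg_sub]; exact neg_mem hγδ, by ring⟩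
    let e : coprimeIdeals 𝔑 := ⟨Ideal.span {δ r}, by simpa using hδ0 r, hδc⟩
    refine ⟨R (cl a) ^ (h - 1) * e, ⟨(cl a, r), rfl⟩, γ * δ r, hγδ, ?_⟩
    rw [← Ideal.span_singleton_mul_span_singleton, ← hγ]
    simp only [Submonoid.coe_mul, mul_assoc, e, SubmonoidClass.coe_pow]

end RayClasses

section RayClassCount

variable {K : Type*} [Field K] [NumberField K] {𝔑 : Ideal (𝓞 K)}

/-- The logarithm of the norm of an ideal coprime to `𝔑`. -/
noncomputable def logNorm (a : coprimeIdeals 𝔑) : ℝ := Real.log (Ideal.absNorm (a : Ideal (𝓞 K)))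

theorem absNorm_pos (a : coprimeIdeals 𝔑) : 0 < Ideal.absNorm (a : Ideal (𝓞 K)) :=
  Nat.pos_of_ne_zero (Ideal.absNorm_eq_zero_iff.not.2 a.2.1)

theorem logNorm_mul (a b : coprimeIdeals 𝔑) : logNorm (a * b) = logNorm a + logNorm b := by
  have ha : (Ideal.absNorm (a : Ideal (𝓞 K)) : ℝ) ≠ 0 := by exact_mod_cast (absNorm_pos a).ne'
  have hb : (Ideal.absNorm (b : Ideal (𝓞 K)) : ℝ) ≠ 0 := by exact_mod_cast (absNorm_pos b).ne'
  rw [logNorm, Submonoid.coe_mul, _root_.map_mul, Nat.cast_mul, Real.log_mul ha hb]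
  rfl

theorem logNorm_le_iff (a : coprimeIdeals 𝔑) (t : ℝ) :
    logNorm a ≤ t ↔ (Ideal.absNorm (a : Ideal (𝓞 K)) : ℝ) ≤ Real.exp t :=
  Real.log_le_iff_le_exp (by exact_mod_cast absNorm_pos a)

theorem finite_logNorm_le (t : ℝ) : {a : coprimeIdeals 𝔑 | logNorm a ≤ t}.Finite := by
  refine Set.Finite.of_finite_image (f := Subtype.val)
    ((Ideal.finite_setOfPred_absNorm_le (S := 𝓞 K) ⌊Real.exp t⌋₊).subset ?_) Subtype.val_injective.injOn
  rintro _ ⟨a, ha, rfl⟩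
  exact Nat.le_floor ((logNorm_le_iff a t).1 ha)

theorem ne_zero_of_sub_one_mem {A : Type*} [CommRing A] {𝔑 : Ideal A} (h𝔑 : 𝔑 ≠ ⊤) {α : A}
    (hα : α - 1 ∈ 𝔑) : α ≠ 0 := by
  rintro rfl
  rw [zero_sub, neg_mem_iff] at hα
  exact h𝔑 (𝔑.eq_top_iff_one.2 hα)

theorem isCoprime_span_of_sub_one_mem {A : Type*} [CommRing A] {𝔑 : Ideal A} {α : A}
    (hα : α - 1 ∈ 𝔑) : IsCoprime (Ideal.span {α}) 𝔑 := by
  rw [Ideal.isCoprime_iff_sup_eq, Ideal.eq_top_iff_one, Ideal.mem_span_singleton_sup]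
  exact ⟨1, 1 - α, by rw [← neg_sub]; exact neg_mem hα, by ring⟩

/-- The elements of an ideal that are congruent to `1` modulo `𝔑`. -/
abbrev RayElement (b : coprimeIdeals 𝔑) : Type _ :=
  {α : 𝓞 K // α ∈ (b : Ideal (𝓞 K)) ∧ α - 1 ∈ 𝔑}

theorem exists_rayElement_equiv (h𝔑 : 𝔑 ≠ ⊤) (b : coprimeIdeals 𝔑) :
    ∃ e : rayClass b × {u : (𝓞 K)ˣ // (u : 𝓞 K) - 1 ∈ 𝔑} ≃ RayElement b,
      ∀ x, (x.1.1 * b : Ideal (𝓞 K)) = Ideal.span {(e x : 𝓞 K)} := by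
  choose s hs1 hs using fun c : rayClass b => c.2
  have hspan : ∀ (c : rayClass b) (u : (𝓞 K)ˣ), Ideal.span {(u : 𝓞 K) * s c} = (c.1 * b : Ideal (𝓞 K)) := by
    intro c u
    rw [hs, Ideal.span_singleton_eq_span_singleton]
    exact ⟨u⁻¹, by rw [mul_right_comm, Units.mul_inv, one_mul]⟩
  let f : rayClass b × {u : (𝓞 K)ˣ // (u : 𝓞 K) - 1 ∈ 𝔑} → RayElement b := fun x =>
    ⟨x.2.1 * s x.1, (Ideal.span_singleton_le_iff_mem _).1 ((hspan x.1 x.2.1).le.trans Ideal.mul_le_right), by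
      have : (x.2.1 : 𝓞 K) * s x.1 - 1 = x.2.1 * (s x.1 - 1) + (x.2.1 - 1) := by ring
      rw [this]
      exact add_mem (𝔑.mul_mem_left _ (hs1 _)) x.2.2⟩
  have hf : Function.Bijective f := by
    constructor
    · rintro ⟨c, u⟩ ⟨c', u'⟩ h
      have h1 : (u.1 : 𝓞 K) * s c = u'.1 * s c' := congrArg Subtype.val h
      have h2 : (c.1 * b : Ideal (𝓞 K)) = c'.1 * b := by rw [← hspan c u.1, h1, hspan]
      obtain rfl : c = c' := Subtype.ext (Subtype.ext (mul_right_cancel₀ b.2.1 h2))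
      have h3 := mul_right_cancel₀ (ne_zero_of_sub_one_mem h𝔑 (hs1 c)) h1
      obtain rfl : u = u' := Subtype.ext (Units.ext h3)
      rfl
    · rintro ⟨α, hα, hα1⟩
      obtain ⟨a, ha⟩ := Ideal.dvd_iff_le.2 ((Ideal.span_singleton_le_iff_mem _).2 hα)
      have hα0 := ne_zero_of_sub_one_mem h𝔑 hα1
      have ha0 : a ≠ ⊥ := by
        rintro rfl
        rw [Ideal.mul_bot, Ideal.span_singleton_eq_bot] at ha
        exact hα0 ha
      have hac : IsCoprime a 𝔑 :=
        (isCoprime_span_of_sub_one_mem hα1).of_isCoprime_of_dvd_left (ha ▸ dvd_mul_left a _)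
      let c : rayClass b := ⟨⟨a, ha0, hac⟩, α, hα1, by rw [ha, mul_comm]⟩
      have h1 : Ideal.span {s c} = Ideal.span {α} := by rw [← hs c, ha, mul_comm]
      obtain ⟨u, hu⟩ := Ideal.span_singleton_eq_span_singleton.1 h1
      refine ⟨(c, ⟨u, ?_⟩), Subtype.ext ?_⟩
      · have : (u : 𝓞 K) - 1 = (α - 1) - u * (s c - 1) := by rw [← hu]; ring
        rw [this]
        exact sub_mem hα1 (𝔑.mul_mem_left _ (hs1 c))
      · exact (mul_comm _ _).trans hu
  exact ⟨Equiv.ofBijective f hf, fun x => (hspan x.1 x.2.1).symm⟩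

theorem exists_equiv_rayElement (b : coprimeIdeals 𝔑) :
    ∃ (α : 𝓞 K) (e : (b ⊓ 𝔑 : Ideal (𝓞 K)) ≃ RayElement b), ∀ a, (e a : 𝓞 K) = α + a := by
  have h := b.2.2
  rw [Ideal.isCoprime_iff_sup_eq, Ideal.eq_top_iff_one, Submodule.mem_sup] at h
  obtain ⟨α, hα, n, hn, h1⟩ := h
  have hα1 : α - 1 ∈ 𝔑 := by
    rw [← h1, sub_add_cancel_left]; exact neg_mem hn
  refine ⟨α, ⟨fun a => ⟨α + a, add_mem hα a.2.1, ?_⟩, fun x => ⟨x - α, sub_mem x.2.1 hα, ?_⟩,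
    fun a => ?_, fun x => ?_⟩, fun a => rfl⟩
  · rw [add_sub_right_comm]; exact add_mem hα1 a.2.2
  · rw [← sub_sub_sub_cancel_right _ _ 1]; exact sub_mem x.2.2 hα1
  · simp
  · simp

end RayClassCount

section RayClassCount

variable {K : Type*} [Field K] [NumberField K] {𝔑 : Ideal (𝓞 K)}

theorem discPhase_rayElement (hdeg : Module.finrank ℚ K = 2) (himag : IsEmpty (K →+* ℝ))
    (emb : K →+* ℂ) {l : ℤ} {χ : coprimeIdeals 𝔑 →* Circle}
    (hχ : ∀ (a : coprimeIdeals 𝔑) (α : 𝓞 K), α - 1 ∈ 𝔑 → (a : Ideal (𝓞 K)) = Ideal.span {α} →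
      (χ a : ℂ) = phase (emb (α : K)) ^ l)
    {a b : coprimeIdeals 𝔑} {α : 𝓞 K} (hα : α - 1 ∈ 𝔑) (hab : (a * b : Ideal (𝓞 K)) = Ideal.span {α})
    (k : ℤ) (t : ℝ) :
    discPhase (√(Ideal.absNorm (b : Ideal (𝓞 K)) * Real.exp t)) (l * k) (emb α) =
      (χ b : ℂ) ^ k * if logNorm a ≤ t then (χ a : ℂ) ^ k else 0 := by
  have h1 : (Ideal.absNorm (a : Ideal (𝓞 K)) : ℝ) * Ideal.absNorm (b : Ideal (𝓞 K)) = ‖emb α‖ ^ 2 := by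
    rw [norm_emb_sq_eq_absNorm hdeg himag, ← hab, _root_.map_mul, Nat.cast_mul]
  have hb : (0 : ℝ) < Ideal.absNorm (b : Ideal (𝓞 K)) := by exact_mod_cast absNorm_pos b
  have h2 : ‖emb α‖ ≤ √(Ideal.absNorm (b : Ideal (𝓞 K)) * Real.exp t) ↔ logNorm a ≤ t := by
    rw [Real.le_sqrt (norm_nonneg _), ← h1, logNorm_le_iff, mul_comm, mul_le_mul_iff_right₀ hb]
    positivity
  have h3 := hχ (a * b) α hα hab
  rw [_root_.map_mul, Circle.coe_mul] at h3
  rw [discPhase]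
  simp only [h2]
  split_ifs
  · rw [zpow_mul, ← h3, mul_zpow, mul_comm]
  · rw [mul_zero]

theorem tsum_rayElement (hdeg : Module.finrank ℚ K = 2) (himag : IsEmpty (K →+* ℝ))
    (h𝔑 : 𝔑 ≠ ⊤) (emb : K →+* ℂ) {l : ℤ} {χ : coprimeIdeals 𝔑 →* Circle}
    (hχ : ∀ (a : coprimeIdeals 𝔑) (α : 𝓞 K), α - 1 ∈ 𝔑 → (a : Ideal (𝓞 K)) = Ideal.span {α} →
      (χ a : ℂ) = phase (emb (α : K)) ^ l) (b : coprimeIdeals 𝔑) (k : ℤ) (t : ℝ) :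
    ∑' α : RayElement b, discPhase (√(Ideal.absNorm (b : Ideal (𝓞 K)) * Real.exp t)) (l * k) (emb (α : 𝓞 K)) =
      Nat.card {u : (𝓞 K)ˣ // (u : 𝓞 K) - 1 ∈ 𝔑} * ((χ b : ℂ) ^ k *
        ∑' a : rayClass b, if logNorm a.1 ≤ t then (χ a : ℂ) ^ k else 0) := by
  have := finite_units_of_imaginary_quadratic hdeg himag
  have : Fintype {u : (𝓞 K)ˣ // (u : 𝓞 K) - 1 ∈ 𝔑} := Fintype.ofFinite _
  obtain ⟨e, he⟩ := exists_rayElement_equiv h𝔑 b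
  rw [← e.tsum_eq]
  have h1 : ∀ x, discPhase (√(Ideal.absNorm (b : Ideal (𝓞 K)) * Real.exp t)) (l * k) (emb (e x : 𝓞 K)) =
      (χ b : ℂ) ^ k * if logNorm x.1.1 ≤ t then (χ x.1.1 : ℂ) ^ k else 0 := fun x =>
    discPhase_rayElement hdeg himag emb hχ (e x).2.2 (he x) k t
  simp_rw [h1]
  have hfin : Summable fun x : rayClass b × {u : (𝓞 K)ˣ // (u : 𝓞 K) - 1 ∈ 𝔑} =>
      (χ b : ℂ) ^ k * if logNorm x.1.1 ≤ t then (χ x.1.1 : ℂ) ^ k else 0 := by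
    refine summable_of_hasFiniteSupport ((((finite_logNorm_le t).preimage
      Subtype.val_injective.injOn).prod Set.finite_univ).subset fun x hx => ⟨?_, Set.mem_univ _⟩)
    by_contra h
    have h' : ¬ logNorm x.1.1 ≤ t := h
    exact hx (by simp only [h', if_false, mul_zero])
  rw [hfin.tsum_prod]
  simp only [tsum_const, nsmul_eq_mul]
  rw [tsum_mul_left, tsum_mul_left]

theorem exists_rayClass_count (hdeg : Module.finrank ℚ K = 2) (himag : IsEmpty (K →+* ℝ))
    (h𝔑 : 𝔑 ≠ ⊤) (h𝔑' : 𝔑 ≠ ⊥) (emb : K →+* ℂ) {l : ℤ} (hl : l ≠ 0) {χ : coprimeIdeals 𝔑 →* Circle}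
    (hχ : ∀ (a : coprimeIdeals 𝔑) (α : 𝓞 K), α - 1 ∈ 𝔑 → (a : Ideal (𝓞 K)) = Ideal.span {α} →
      (χ a : ℂ) = phase (emb (α : K)) ^ l) (b : coprimeIdeals 𝔑) :
    ∃ κ : ℝ, 0 < κ ∧ ∀ k : ℤ, ∃ C, ∀ t : ℝ, 0 ≤ t →
      ‖∑' a : rayClass b, (if logNorm a.1 ≤ t then (χ a : ℂ) ^ k else 0) -
        (if k = 0 then (κ : ℂ) else 0) * Real.exp t‖ ≤ C * Real.exp (3 / 4 * t) := by
  have := finite_units_of_imaginary_quadratic hdeg himag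
  have : Nonempty {u : (𝓞 K)ˣ // (u : 𝓞 K) - 1 ∈ 𝔑} := ⟨1, by simp⟩
  set w := Nat.card {u : (𝓞 K)ˣ // (u : 𝓞 K) - 1 ∈ 𝔑} with hw
  have hw0 : (0 : ℝ) < w := by exact_mod_cast Nat.card_pos
  set N := Ideal.absNorm (b : Ideal (𝓞 K)) with hN
  have hN1 : (1 : ℝ) ≤ N := by exact_mod_cast absNorm_pos b
  have hI : (b ⊓ 𝔑 : Ideal (𝓞 K)) ≠ ⊥ := fun h =>
    mul_ne_zero b.2.1 h𝔑' (le_bot_iff.1 (Ideal.mul_le_inf.trans h.le))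
  obtain ⟨κ, hκ, h⟩ := exists_tsum_discPhase_ideal hdeg himag emb hI
  obtain ⟨α, e, he⟩ := exists_equiv_rayElement b
  refine ⟨κ * N / w, by positivity, fun k => ?_⟩
  obtain ⟨C, hC⟩ := h α (l * k)
  refine ⟨|C| * √N / w, fun t ht => ?_⟩
  have hexp : 1 ≤ Real.exp t := Real.one_le_exp ht
  have hR : 1 ≤ √(N * Real.exp t) := Real.one_le_sqrt.2 (one_le_mul_of_one_le_of_one_le hN1 hexp)
  have h1 := hC _ hR
  have h2 : ∑' a : (b ⊓ 𝔑 : Ideal (𝓞 K)), discPhase (√(N * Real.exp t)) (l * k) (emb ((α + a : 𝓞 K) : K)) =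
      ∑' x : RayElement b, discPhase (√(N * Real.exp t)) (l * k) (emb (x : 𝓞 K)) := by
    rw [← e.tsum_eq]
    simp_rw [he]
  rw [h2, tsum_rayElement hdeg himag h𝔑 emb hχ b k t, ← hw] at h1
  set T := ∑' a : rayClass b, if logNorm a.1 ≤ t then (χ a : ℂ) ^ k else 0
  have hsq : ((√(N * Real.exp t) : ℝ) : ℂ) ^ 2 = N * Real.exp t := by
    rw [← Complex.ofReal_pow, Real.sq_sqrt (by positivity)]
    push_cast
    rfl
  have hw0' : (w : ℂ) ≠ 0 := by exact_mod_cast hw0.ne'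
  have h3 : (w : ℂ) * ((χ b : ℂ) ^ k * T) - (if l * k = 0 then (κ : ℂ) else 0) * ((√(N * Real.exp t) : ℝ) : ℂ) ^ 2 =
      (χ b : ℂ) ^ k * (w * (T - (if k = 0 then ((κ * N / w : ℝ) : ℂ) else 0) * Real.exp t)) := by
    rw [hsq]
    by_cases hk : k = 0
    · subst hk
      simp only [mul_zero, if_true, zpow_zero, one_mul]
      push_cast
      field_simp
    · simp only [mul_eq_zero, hl, hk, or_self, if_false, zero_mul, sub_zero]
      ring
  rw [h3, norm_mul, norm_zpow, Circle.norm_coe, one_zpow, one_mul, norm_mul, Complex.norm_natCast] at h1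
  rw [div_mul_eq_mul_div, le_div_iff₀ hw0, mul_comm]
  refine h1.trans ?_
  have h4 : √(Real.exp t) ≤ Real.exp (3 / 4 * t) := by
    rw [← Real.exp_half]
    exact Real.exp_le_exp.2 (by linarith)
  rw [Real.sqrt_mul (by positivity), ← mul_assoc]
  gcongr
  exact le_abs_self C

end RayClassCount

theorem tsum_eq_sum_tsum_of_partition {M : Type*} {P : Finset (Set M)}
    (hd : ∀ p ∈ P, ∀ q ∈ P, ∀ a, a ∈ p → a ∈ q → p = q) (hc : ∀ a, ∃ p ∈ P, a ∈ p)
    {f : M → ℂ} (hf : f.support.Finite) : ∑' a, f a = ∑ p ∈ P, ∑' a : p, f a := by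
  have h1 : f = fun a => ∑ p ∈ P, p.indicator f a := by
    ext a
    obtain ⟨p, hp, hap⟩ := hc a
    rw [Finset.sum_eq_single_of_mem p hp fun q hq hqp =>
      Set.indicator_of_notMem (fun haq => hqp (hd q hq p hp a haq hap)) f, Set.indicator_of_mem hap]
  calc ∑' a, f a = ∑' a, ∑ p ∈ P, p.indicator f a := by rw [← h1]
    _ = ∑ p ∈ P, ∑' a, p.indicator f a := by
      refine Summable.tsum_finsetSum fun p _ => summable_of_hasFiniteSupport (hf.subset ?_)
      rw [Set.support_indicator]
      exact Set.inter_subset_right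
    _ = _ := Finset.sum_congr rfl fun p _ => (tsum_subtype p f).symm

section RayClassCount

variable {K : Type*} [Field K] [NumberField K] {𝔑 : Ideal (𝓞 K)}

theorem exists_coprimeIdeals_count (hdeg : Module.finrank ℚ K = 2) (himag : IsEmpty (K →+* ℝ))
    (h𝔑 : 𝔑 ≠ ⊤) (h𝔑' : 𝔑 ≠ ⊥) (emb : K →+* ℂ) {l : ℤ} (hl : l ≠ 0) {χ : coprimeIdeals 𝔑 →* Circle}
    (hχ : ∀ (a : coprimeIdeals 𝔑) (α : 𝓞 K), α - 1 ∈ 𝔑 → (a : Ideal (𝓞 K)) = Ideal.span {α} →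
      (χ a : ℂ) = phase (emb (α : K)) ^ l) :
    ∃ c : ℝ, 0 < c ∧ ∀ k : ℤ, ∃ C, ∀ t : ℝ, 0 ≤ t →
      ‖summatory logNorm (fun a => (χ a : ℂ) ^ k) t - (if k = 0 then (c : ℂ) else 0) * Real.exp t‖ ≤
        C * Real.exp (3 / 4 * t) := by
  have := Ideal.finiteQuotientOfFreeOfNeBot 𝔑 h𝔑'
  obtain ⟨S, hS, hSc⟩ := exists_finset_rayClass h𝔑'
  set P := (hS.image rayClass).toFinset with hP
  have hmem : ∀ p, p ∈ P ↔ ∃ b ∈ S, rayClass b = p := fun p => by simp [hP]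
  have hcover : ∀ a : coprimeIdeals 𝔑, ∃ p ∈ P, a ∈ p := fun a => by
    obtain ⟨b, hb, hab⟩ := hSc a
    exact ⟨rayClass b, (hmem _).2 ⟨b, hb, rfl⟩, hab⟩
  have hdisj : ∀ p ∈ P, ∀ q ∈ P, ∀ a, a ∈ p → a ∈ q → p = q := by
    intro p hp q hq a hap haq
    obtain ⟨b, -, rfl⟩ := (hmem p).1 hp
    obtain ⟨c, -, rfl⟩ := (hmem q).1 hq
    exact rayClass_eq hap haq
  have hex : ∀ p, ∃ κ : ℝ, p ∈ P → 0 < κ ∧ ∀ k : ℤ, ∃ C, ∀ t : ℝ, 0 ≤ t →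
      ‖∑' a : p, (if logNorm a.1 ≤ t then (χ a : ℂ) ^ k else 0) -
        (if k = 0 then (κ : ℂ) else 0) * Real.exp t‖ ≤ C * Real.exp (3 / 4 * t) := by
    intro p
    by_cases hp : p ∈ P
    · obtain ⟨b, -, rfl⟩ := (hmem p).1 hp
      obtain ⟨κ, hκ⟩ := exists_rayClass_count hdeg himag h𝔑 h𝔑' emb hl hχ b
      exact ⟨κ, fun _ => hκ⟩
    · exact ⟨0, fun h => absurd h hp⟩
  choose κ hκ using hex
  obtain ⟨p₀, hp₀, -⟩ := hcover 1
  refine ⟨∑ p ∈ P, κ p, Finset.sum_pos (fun p hp => (hκ p hp).1) ⟨p₀, hp₀⟩, fun k => ?_⟩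
  have hC : ∀ p, ∃ C, p ∈ P → ∀ t : ℝ, 0 ≤ t →
      ‖∑' a : p, (if logNorm a.1 ≤ t then (χ a : ℂ) ^ k else 0) -
        (if k = 0 then (κ p : ℂ) else 0) * Real.exp t‖ ≤ C * Real.exp (3 / 4 * t) := by
    intro p
    by_cases hp : p ∈ P
    · obtain ⟨C, hC⟩ := (hκ p hp).2 k
      exact ⟨C, fun _ => hC⟩
    · exact ⟨0, fun h => absurd h hp⟩
  choose C hC using hC
  refine ⟨∑ p ∈ P, C p, fun t ht => ?_⟩
  have e1 : summatory logNorm (fun a => (χ a : ℂ) ^ k) t =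
      ∑ p ∈ P, ∑' a : p, if logNorm a.1 ≤ t then (χ a : ℂ) ^ k else 0 := by
    refine tsum_eq_sum_tsum_of_partition hdisj hcover ((finite_logNorm_le t).subset fun a ha => ?_)
    by_contra h
    exact ha (if_neg h)
  have e2 : (if k = 0 then ((∑ p ∈ P, κ p : ℝ) : ℂ) else 0) * Real.exp t =
      ∑ p ∈ P, (if k = 0 then (κ p : ℂ) else 0) * Real.exp t := by
    rw [← Finset.sum_mul]
    split_ifs <;> simp
  rw [e1, e2, ← Finset.sum_sub_distrib, Finset.sum_mul]
  exact (norm_sum_le _ _).trans (Finset.sum_le_sum fun p hp => hC p hp t ht)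

end RayClassCount

section Factorization

open UniqueFactorizationMonoid

variable {K : Type*} [Field K] [NumberField K] {𝔑 : Ideal (𝓞 K)}

theorem coprimeIdeals_dvd_iff (a b : coprimeIdeals 𝔑) : a ∣ b ↔ (a : Ideal (𝓞 K)) ∣ b := by
  refine ⟨fun ⟨c, hc⟩ => ⟨c, congrArg Subtype.val hc⟩, fun ⟨c, hc⟩ => ?_⟩
  refine ⟨⟨c, ?_, b.2.2.of_isCoprime_of_dvd_left (hc ▸ dvd_mul_left c _)⟩, Subtype.ext hc⟩
  rintro rfl
  exact b.2.1 (hc.trans (Ideal.mul_bot _))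

theorem logNorm_eq_sum (a : coprimeIdeals 𝔑) :
    logNorm a = ((normalizedFactors (a : Ideal (𝓞 K))).map fun q => Real.log (Ideal.absNorm q)).sum := by
  have h : ∀ s : Multiset (Ideal (𝓞 K)), (∀ q ∈ s, Ideal.absNorm q ≠ 0) →
      Real.log (Ideal.absNorm s.prod) = (s.map fun q => Real.log (Ideal.absNorm q)).sum := by
    intro s
    induction s using Multiset.induction with
    | empty => simp
    | cons q s ih =>
      intro hs
      have h1 : (Ideal.absNorm q : ℝ) ≠ 0 := by exact_mod_cast hs q (Multiset.mem_cons_self q s)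
      have hs' : ∀ q ∈ s, Ideal.absNorm q ≠ 0 := fun q hq => hs q (Multiset.mem_cons_of_mem hq)
      have h2 : (Ideal.absNorm s.prod : ℝ) ≠ 0 := by
        rw [map_multiset_prod]
        exact_mod_cast Multiset.prod_ne_zero fun h => by
          obtain ⟨q, hq, hq0⟩ := Multiset.mem_map.1 h
          exact hs' q hq hq0
      rw [Multiset.prod_cons, _root_.map_mul, Nat.cast_mul, Real.log_mul h1 h2, ih hs',
        Multiset.map_cons, Multiset.sum_cons]
  rw [← h _ fun q hq => ?_, prod_normalizedFactors_eq a.2.1, normalize_eq]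
  · rfl
  · exact Ideal.absNorm_eq_zero_iff.not.2 (prime_of_normalized_factor q hq).ne_zero

open Classical in
theorem hasSum_logNorm {p : ℕ → coprimeIdeals 𝔑} (hp : ∀ i, (p i : Ideal (𝓞 K)).IsPrime)
    (hinj : Function.Injective p)
    (hsurj : ∀ q : coprimeIdeals 𝔑, (q : Ideal (𝓞 K)).IsPrime → ∃ i, p i = q) (a : coprimeIdeals 𝔑) :
    HasSum (fun x : ℕ × ℕ => if p x.1 ^ (x.2 + 1) ∣ a then logNorm (p x.1) else 0) (logNorm a) := by
  set F := normalizedFactors (a : Ideal (𝓞 K)) with hF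
  have hirr : ∀ i, Irreducible (p i : Ideal (𝓞 K)) := fun i =>
    (Ideal.prime_of_isPrime (p i).2.1 (hp i)).irreducible
  have hdvd : ∀ i n, p i ^ n ∣ a ↔ n ≤ F.count (p i : Ideal (𝓞 K)) := by
    intro i n
    rw [coprimeIdeals_dvd_iff, SubmonoidClass.coe_pow, dvd_iff_normalizedFactors_le_normalizedFactors
      (pow_ne_zero _ (p i).2.1) a.2.1, normalizedFactors_pow, normalizedFactors_irreducible (hirr i),
      normalize_eq, Multiset.nsmul_singleton, Multiset.le_count_iff_replicate_le]
  have hval : Function.Injective fun i => (p i : Ideal (𝓞 K)) := Subtype.val_injective.comp hinj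
  have hJfin : {i | (p i : Ideal (𝓞 K)) ∈ F.toFinset}.Finite :=
    (F.toFinset.finite_toSet).preimage hval.injOn
  set J := hJfin.toFinset with hJ
  have hJimg : J.image (fun i => (p i : Ideal (𝓞 K))) = F.toFinset := by
    ext q
    simp only [Finset.mem_image, hJ, Set.Finite.mem_toFinset, Set.mem_ofPred_eq]
    constructor
    · rintro ⟨i, hi, rfl⟩; exact hi
    · intro hq
      have hqF : q ∈ F := Multiset.mem_toFinset.1 hq
      have hqp := prime_of_normalized_factor q hqF
      obtain ⟨i, hi⟩ := hsurj ⟨q, hqp.ne_zero,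
        a.2.2.of_isCoprime_of_dvd_left (dvd_of_mem_normalizedFactors hqF)⟩ (Ideal.isPrime_of_prime hqp)
      have hi' : (p i : Ideal (𝓞 K)) = q := congrArg Subtype.val hi
      exact ⟨i, hi'.symm ▸ hq, hi'⟩
  have hsum : logNorm a = ∑ x ∈ J ×ˢ Finset.range (Multiset.card F),
      if p x.1 ^ (x.2 + 1) ∣ a then logNorm (p x.1) else 0 := by
    rw [logNorm_eq_sum, Finset.sum_multiset_map_count, ← hJimg, Finset.sum_image hval.injOn,
      Finset.sum_product]
    refine Finset.sum_congr rfl fun i _ => ?_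
    simp_rw [hdvd, ← Finset.sum_filter, Finset.sum_const]
    congr 1
    rw [show (Finset.range (Multiset.card F)).filter (fun j => j + 1 ≤ F.count (p i : Ideal (𝓞 K))) =
      Finset.range (F.count (p i : Ideal (𝓞 K))) from ?_, Finset.card_range]
    ext j
    have := F.count_le_card (p i : Ideal (𝓞 K))
    simp only [Finset.mem_filter, Finset.mem_range]
    omega
  rw [hsum]
  refine hasSum_sum_of_ne_finset_zero fun x hx => if_neg fun hd => hx ?_
  rw [hdvd] at hd
  have := F.count_le_card (p x.1 : Ideal (𝓞 K))
  refine Finset.mem_product.2 ⟨?_, Finset.mem_range.2 (by omega)⟩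
  rw [hJ, Set.Finite.mem_toFinset]
  exact Multiset.mem_toFinset.2 (Multiset.count_pos.1 (by omega))

end Factorization

section Weyl

theorem Circle.exists_zpow_eq_neg_one {k : ℤ} (hk : k ≠ 0) : ∃ a : Circle, (a : ℂ) ^ k = -1 := by
  have hk' : (k : ℂ) ≠ 0 := by exact_mod_cast hk
  refine ⟨Circle.exp (Real.pi / k), ?_⟩
  rw [Circle.coe_exp, ← Complex.exp_int_mul, ← Complex.exp_pi_mul_I]
  congr 1
  push_cast
  field_simp

theorem norm_mean_le {u : ℕ → ℂ} {b : ℝ} (hb : 0 ≤ b) (hu : ∀ i, ‖u i‖ ≤ b) (n : ℕ) :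
    ‖(n : ℂ)⁻¹ * ∑ i ∈ Finset.range n, u i‖ ≤ b := by
  rcases n.eq_zero_or_pos with rfl | hn
  · simpa using hb
  · have hn' : (0:ℝ) < n := by exact_mod_cast hn
    rw [norm_mul, norm_inv, Complex.norm_natCast, inv_mul_le_iff₀ hn']
    refine (norm_sum_le _ _).trans ((Finset.sum_le_sum fun i _ => hu i).trans ?_)
    simp

theorem tendsto_mean_of_mem_closure {X : Type*} [TopologicalSpace X] [CompactSpace X] {S : Submodule ℂ C(X, ℂ)}
    [MeasurableSpace X] [BorelSpace X] {ν : Measure X} [IsProbabilityMeasure ν] {x : ℕ → X}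
    (h : ∀ g ∈ S, Tendsto (fun n : ℕ => (n : ℂ)⁻¹ * ∑ i ∈ Finset.range n, g (x i)) atTop (𝓝 (∫ z, g z ∂ν)))
    {g : C(X, ℂ)} (hg : g ∈ S.topologicalClosure) :
    Tendsto (fun n : ℕ => (n : ℂ)⁻¹ * ∑ i ∈ Finset.range n, g (x i)) atTop (𝓝 (∫ z, g z ∂ν)) := by
  rw [Metric.tendsto_atTop]
  intro ε hε
  obtain ⟨s, hs, hgs⟩ := Metric.mem_closure_iff.1 hg (ε / 3) (by positivity)
  obtain ⟨N, hN⟩ := Metric.tendsto_atTop.1 (h s hs) (ε / 3) (by positivity)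
  refine ⟨N, fun n hn => ?_⟩
  have hb : ∀ z, ‖g z - s z‖ ≤ ε / 3 := fun z => by
    rw [← dist_eq_norm]
    exact (ContinuousMap.dist_apply_le_dist z).trans hgs.le
  have h1 := norm_mean_le (by positivity) (fun i => hb (x i)) n
  have h2 : ‖∫ z, (g z - s z) ∂ν‖ ≤ ε / 3 := by
    simpa using norm_integral_le_of_norm_le_const (μ := ν) (ae_of_all _ hb)
  have hi : ∀ f : C(X, ℂ), Integrable f ν := fun f =>
    f.continuous.integrable_of_hasCompactSupport (HasCompactSupport.of_compactSpace f)
  rw [integral_sub (hi g) (hi s)] at h2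
  rw [Finset.sum_sub_distrib, mul_sub] at h1
  have h3 := hN n hn
  rw [dist_eq_norm] at h3 ⊢
  calc _ = ‖((n : ℂ)⁻¹ * ∑ i ∈ Finset.range n, g (x i) - (n : ℂ)⁻¹ * ∑ i ∈ Finset.range n, s (x i)) +
        ((n : ℂ)⁻¹ * ∑ i ∈ Finset.range n, s (x i) - ∫ z, s z ∂ν) - (∫ z, g z ∂ν - ∫ z, s z ∂ν)‖ := by
          congr 1; ring
    _ < ε := by
      refine (norm_sub_le _ _).trans_lt ?_
      have := norm_add_le ((n : ℂ)⁻¹ * ∑ i ∈ Finset.range n, g (x i) - (n : ℂ)⁻¹ * ∑ i ∈ Finset.range n, s (x i))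
        ((n : ℂ)⁻¹ * ∑ i ∈ Finset.range n, s (x i) - ∫ z, s z ∂ν)
      linarith

theorem tendsto_mean_of_mem_span {X : Type*} [TopologicalSpace X] [CompactSpace X] {S : Set C(X, ℂ)}
    [MeasurableSpace X] [BorelSpace X] {ν : Measure X} [IsProbabilityMeasure ν] {x : ℕ → X}
    (h : ∀ g ∈ S, Tendsto (fun n : ℕ => (n : ℂ)⁻¹ * ∑ i ∈ Finset.range n, g (x i)) atTop (𝓝 (∫ z, g z ∂ν)))
    {g : C(X, ℂ)} (hg : g ∈ Submodule.span ℂ S) :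
    Tendsto (fun n : ℕ => (n : ℂ)⁻¹ * ∑ i ∈ Finset.range n, g (x i)) atTop (𝓝 (∫ z, g z ∂ν)) := by
  have hi : ∀ f : C(X, ℂ), Integrable f ν := fun f =>
    f.continuous.integrable_of_hasCompactSupport (HasCompactSupport.of_compactSpace f)
  induction hg using Submodule.span_induction with
  | mem g hg => exact h g hg
  | zero => simp
  | add f g _ _ hf hg =>
    simp only [ContinuousMap.add_apply, Finset.sum_add_distrib, mul_add]
    rw [integral_add (hi f) (hi g)]
    exact hf.add hg
  | smul a g _ hg =>
    simp only [ContinuousMap.smul_apply, smul_eq_mul, ← Finset.mul_sum, mul_left_comm _ a]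
    rw [integral_const_mul]
    exact hg.const_mul a

variable [MeasurableSpace Circle] [BorelSpace Circle] (μ : Measure Circle) [μ.IsHaarMeasure]

theorem Circle.integral_zpow {k : ℤ} (hk : k ≠ 0) : ∫ z : Circle, (z : ℂ) ^ k ∂μ = 0 := by
  obtain ⟨a, ha⟩ := Circle.exists_zpow_eq_neg_one hk
  have h := integral_mul_left_eq_self (μ := μ) (fun z : Circle => (z : ℂ) ^ k) a
  simp_rw [Circle.coe_mul, mul_zpow, ha, neg_one_mul] at h
  rw [integral_neg] at h
  exact self_eq_neg.1 h.symm

variable [IsProbabilityMeasure μ]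

theorem Circle.tendsto_mean_of_zpow {x : ℕ → Circle}
    (h : ∀ k : ℤ, k ≠ 0 → Tendsto (fun n : ℕ => (n : ℂ)⁻¹ * ∑ i ∈ Finset.range n, (x i : ℂ) ^ k) atTop (𝓝 0))
    (g : C(Circle, ℂ)) :
    Tendsto (fun n : ℕ => (n : ℂ)⁻¹ * ∑ i ∈ Finset.range n, g (x i)) atTop (𝓝 (∫ z, g z ∂μ)) := by
  have : Fact (0 < 2 * Real.pi) := ⟨Real.two_pi_pos⟩
  let e : AddCircle (2 * Real.pi) ≃ₜ Circle := AddCircle.homeomorphCircle'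
  have he : MeasurableEmbedding e.symm := e.symm.measurableEmbedding
  have hν : IsProbabilityMeasure (μ.map e.symm) := Measure.isProbabilityMeasure_map he.measurable.aemeasurable
  have hfour : ∀ (k : ℤ) (z : Circle), fourier k (e.symm z) = (z : ℂ) ^ k := by
    intro k z
    obtain ⟨y, rfl⟩ := e.surjective z
    rw [e.symm_apply_apply, fourier_apply, AddCircle.toCircle_zsmul, Circle.coe_zpow]
    congr 2
    induction y using QuotientAddGroup.induction_on with
    | H y => 
      change AddCircle.toCircle (y : AddCircle (2 * Real.pi)) = Circle.exp y
      rw [AddCircle.toCircle_apply_mk, div_self Real.two_pi_pos.ne', one_mul]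
  have key := tendsto_mean_of_mem_closure (ν := μ.map e.symm) (x := fun i => e.symm (x i))
    (S := Submodule.span ℂ (Set.range (@fourier (2 * Real.pi))))
    (fun f hf => tendsto_mean_of_mem_span (fun f hf => ?_) hf)
    (g := g.comp e) (by rw [span_fourier_closure_eq_top]; trivial)
  · rw [he.integral_map] at key
    simpa using key
  · obtain ⟨k, rfl⟩ := hf
    rw [he.integral_map]
    simp_rw [hfour]
    by_cases hk : k = 0
    · subst hk
      simp only [zpow_zero, Finset.sum_const, Finset.card_range, nsmul_eq_mul, mul_one, integral_const,
        probReal_univ, one_smul]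
      refine tendsto_const_nhds.congr' ?_
      filter_upwards [eventually_ne_atTop 0] with n hn
      rw [inv_mul_cancel₀ (by exact_mod_cast hn)]
    · rw [Circle.integral_zpow μ hk]
      exact h k hk

end Weyl

section HeckeCharacter

theorem phase_mul_phase (z w : ℂ) : phase (z * w) = phase z * phase w := by
  rw [phase, phase, phase, norm_mul, Complex.ofReal_mul, mul_div_mul_comm]

theorem phase_one : phase 1 = 1 := by simp [phase]

theorem phase_pow (z : ℂ) (n : ℕ) : phase (z ^ n) = phase z ^ n := by
  rw [phase, phase, norm_pow, Complex.ofReal_pow, div_pow]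

variable {K : Type*} [Field K] [NumberField K] {𝔑 : Ideal (𝓞 K)}

/-- The phase of a nonvanishing multiplicative function on ideals coprime to `𝔑`. -/
noncomputable def phaseHom (ψ : coprimeIdeals 𝔑 →* ℂ) (hψ : ∀ a, ψ a ≠ 0) : coprimeIdeals 𝔑 →* Circle where
  toFun a := ⟨phase (ψ a), mem_sphere_zero_iff_norm.2 (norm_phase (hψ a))⟩
  map_one' := Subtype.ext (by simp [phase_one])
  map_mul' a b := Subtype.ext ((congrArg phase (map_mul ψ a b)).trans (phase_mul_phase _ _))

theorem norm_sq_eq_absNorm_pow (hdeg : Module.finrank ℚ K = 2) (himag : IsEmpty (K →+* ℝ))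
    (h𝔑 : 𝔑 ≠ ⊥) (emb : K →+* ℂ) {l : ℕ} {ψ : coprimeIdeals 𝔑 →* ℂ} (hψ : ∀ a, ψ a ≠ 0)
    (halg : ∀ (a : coprimeIdeals 𝔑) (α : 𝓞 K), α - 1 ∈ 𝔑 → (a : Ideal (𝓞 K)) = Ideal.span {α} →
      ψ a = emb (α : K) ^ l) (a : coprimeIdeals 𝔑) :
    ‖ψ a‖ ^ 2 = (Ideal.absNorm (a : Ideal (𝓞 K)) : ℝ) ^ l := by
  have := Ideal.finiteQuotientOfFreeOfNeBot 𝔑 h𝔑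
  obtain ⟨S, hS, hcov⟩ := exists_finset_rayClass h𝔑
  choose b hbS hb using fun n : ℕ => hcov (a ^ n)
  have : Finite S := hS
  obtain ⟨m, n, hmn, hbmn⟩ := Finite.exists_ne_map_eq_of_infinite fun n => (⟨b n, hbS n⟩ : S)
  replace hbmn : b m = b n := congrArg Subtype.val hbmn
  have hray : ∀ n, (‖ψ a‖ ^ 2) ^ n * ‖ψ (b n)‖ ^ 2 =
      ((Ideal.absNorm (a : Ideal (𝓞 K)) : ℝ) ^ l) ^ n * (Ideal.absNorm (b n : Ideal (𝓞 K)) : ℝ) ^ l := by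
    intro n
    obtain ⟨α, hα, h⟩ := hb n
    have h1 := halg (a ^ n * b n) α hα h
    have h2 : ‖ψ (a ^ n * b n)‖ ^ 2 = (Ideal.absNorm ((a ^ n * b n : coprimeIdeals 𝔑) : Ideal (𝓞 K)) : ℝ) ^ l := by
      rw [h1, norm_pow, ← pow_mul, mul_comm l 2, pow_mul, norm_emb_sq_eq_absNorm hdeg himag, ← h]
      rfl
    rw [map_mul, map_pow, norm_mul, norm_pow, Submonoid.coe_mul, SubmonoidClass.coe_pow, map_mul, map_pow,
      Nat.cast_mul, Nat.cast_pow] at h2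
    calc _ = (‖ψ a‖ ^ n * ‖ψ (b n)‖) ^ 2 := by ring
      _ = _ := h2
      _ = _ := by ring
  have hm := hray m
  have hn := hray n
  rw [hbmn] at hm
  set A := ‖ψ a‖ ^ 2
  set B := ‖ψ (b n)‖ ^ 2
  set P := (Ideal.absNorm (a : Ideal (𝓞 K)) : ℝ) ^ l
  set Q := (Ideal.absNorm (b n : Ideal (𝓞 K)) : ℝ) ^ l
  have hA : 0 < A := by have := norm_pos_iff.2 (hψ a); positivity
  have hB : 0 < B := by have := norm_pos_iff.2 (hψ (b n)); positivity
  have hP : 0 < P := by have := absNorm_pos a; positivity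
  have hQ : 0 < Q := by have := absNorm_pos (b n); positivity
  have hpow : ∀ n, A ^ n * B = P ^ n * Q → (A / P) ^ n = Q / B := fun n h => by
    rw [div_pow, div_eq_div_iff (by positivity) hB.ne', h, mul_comm]
  have heq := (hpow m hm).trans (hpow n hn).symm
  have h1 : A / P = 1 := by
    by_contra hne
    exact hmn (pow_right_injective₀ (by positivity) hne heq)
  rwa [div_eq_one_iff_eq hP.ne'] at h1

open Classical in
theorem tendsto_mean_phase_zpow (hdeg : Module.finrank ℚ K = 2) (himag : IsEmpty (K →+* ℝ))
    (h𝔑 : 𝔑 ≠ ⊤) (h𝔑' : 𝔑 ≠ ⊥) (emb : K →+* ℂ) {l : ℤ} (hl : l ≠ 0) {χ : coprimeIdeals 𝔑 →* Circle}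
    (hχ : ∀ (a : coprimeIdeals 𝔑) (α : 𝓞 K), α - 1 ∈ 𝔑 → (a : Ideal (𝓞 K)) = Ideal.span {α} →
      (χ a : ℂ) = phase (emb (α : K)) ^ l)
    {p : ℕ → coprimeIdeals 𝔑} (hp : ∀ i, (p i : Ideal (𝓞 K)).IsPrime) (hinj : Function.Injective p)
    (hsurj : ∀ q : coprimeIdeals 𝔑, (q : Ideal (𝓞 K)).IsPrime → ∃ i, p i = q)
    (hmono : Monotone fun i => Ideal.absNorm (p i : Ideal (𝓞 K))) {k : ℤ} (hk : k ≠ 0) :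
    Tendsto (fun n : ℕ => (n : ℂ)⁻¹ * ∑ i ∈ Finset.range n, (χ (p i) : ℂ) ^ k) atTop (𝓝 0) := by
  obtain ⟨c, hc, hcount⟩ := exists_coprimeIdeals_count hdeg himag h𝔑 h𝔑' emb hl hχ
  have : Countable (coprimeIdeals 𝔑) := by
    refine Set.countable_univ_iff.1 ((Set.countable_iUnion fun n : ℕ =>
      (finite_logNorm_le (𝔑 := 𝔑) n).countable).mono fun a _ => ?_)
    obtain ⟨n, hn⟩ := exists_nat_ge (logNorm a)
    exact Set.mem_iUnion.2 ⟨n, hn⟩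
  let D : CharSemigroup (coprimeIdeals 𝔑) :=
    { ℓ := logNorm
      map_mul := logNorm_mul
      pos := fun a ha => by
        refine Real.log_pos ?_
        have h1 := absNorm_pos a
        have h2 : Ideal.absNorm (a : Ideal (𝓞 K)) ≠ 1 := fun h =>
          ha (Subtype.ext ((Ideal.absNorm_eq_one_iff.1 h).trans Ideal.one_eq_top.symm))
        exact_mod_cast (show 1 < Ideal.absNorm (a : Ideal (𝓞 K)) by omega)
      p := p
      p_ne_one := fun i h => (hp i).ne_top ((congrArg Subtype.val h).trans Ideal.one_eq_top)
      χ := χ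
      factor := hasSum_logNorm hp hinj hsurj
      finite := finite_logNorm_le
      c := c
      c_pos := hc
      count := hcount }
  exact D.tendsto_mean hinj (fun i j hij => Real.log_le_log (by exact_mod_cast absNorm_pos (p i))
    (by exact_mod_cast hmono hij)) hk

end HeckeCharacter

/-- **Equidistribution of unitarized values of an algebraic Hecke character.**
Let `K` be an imaginary quadratic field with a fixed complex embedding, `𝔑` a nonzero ideal
of `𝓞 K`, `l ≥ 1`, and `ψ` an algebraic Hecke character of `K` modulo `𝔑` of infinity type
`l`.  If `(𝔭_i)` is an enumeration by norm of the prime ideals coprime to `𝔑`, then the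
sequence `x_i = ψ(𝔭_i)/N(𝔭_i)^{l/2}` is equidistributed on the unit circle with respect to
its Haar probability measure. -/
theorem stmt_10 [MeasurableSpace Circle] [BorelSpace Circle]
    (K : Type*) [Field K] [NumberField K]
    (hdeg : Module.finrank ℚ K = 2) (himag : IsEmpty (K →+* ℝ))
    (emb : K →+* ℂ)
    (𝔑 : Ideal (𝓞 K)) (h𝔑 : 𝔑 ≠ ⊥) (l : ℕ) (hl : 1 ≤ l)
    (ψ : Ideal (𝓞 K) → ℂ)
    (hmul : ∀ 𝔞 𝔟 : Ideal (𝓞 K), IsCoprime 𝔞 𝔑 → IsCoprime 𝔟 𝔑 →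
      ψ (𝔞 * 𝔟) = ψ 𝔞 * ψ 𝔟)
    (hne : ∀ 𝔞 : Ideal (𝓞 K), IsCoprime 𝔞 𝔑 → ψ 𝔞 ≠ 0)
    (halg : ∀ α : 𝓞 K, α - 1 ∈ 𝔑 → ψ (Ideal.span {α}) = emb (α : K) ^ l)
    (𝔭 : ℕ → Ideal (𝓞 K))
    (hprime : ∀ i, (𝔭 i).IsPrime ∧ 𝔭 i ≠ ⊥ ∧ IsCoprime (𝔭 i) 𝔑)
    (hinj : Function.Injective 𝔭)
    (hsurj : ∀ 𝔮 : Ideal (𝓞 K), 𝔮.IsPrime → 𝔮 ≠ ⊥ → IsCoprime 𝔮 𝔑 → ∃ i, 𝔭 i = 𝔮)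
    (hmono : ∀ i j, i ≤ j → Ideal.absNorm (𝔭 i) ≤ Ideal.absNorm (𝔭 j))
    (μ : Measure Circle) [μ.IsHaarMeasure] [IsProbabilityMeasure μ]
    (f : ℂ → ℂ) (hf : Continuous f) :
    Tendsto (fun n : ℕ =>
        (n : ℂ)⁻¹ * ∑ i ∈ Finset.range n,
          f (ψ (𝔭 i) * (Ideal.absNorm (𝔭 i) : ℂ) ^ (-(l : ℂ) / 2)))
      atTop (nhds (∫ z : Circle, f (z : ℂ) ∂μ)) := by
  have h𝔑' : 𝔑 ≠ ⊤ := by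
    rintro rfl
    refine hne (Ideal.span {0}) (Ideal.isCoprime_iff_sup_eq.2 (sup_top_eq _)) ?_
    rw [halg 0 Submodule.mem_top, RingOfIntegers.coe_eq_algebraMap, map_zero, map_zero,
      zero_pow (Nat.one_le_iff_ne_zero.1 hl)]
  have hone : ψ 1 = 1 := by
    have h := hmul 1 1 isCoprime_one_left isCoprime_one_left
    rw [mul_one] at h
    exact (mul_eq_left₀ (hne 1 isCoprime_one_left)).1 h.symm
  let Ψ : coprimeIdeals 𝔑 →* ℂ :=
    { toFun := fun a => ψ a
      map_one' := hone
      map_mul' := fun a b => hmul a b a.2.2 b.2.2 }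
  have hΨ : ∀ a, Ψ a ≠ 0 := fun a => hne a a.2.2
  have hΨalg : ∀ (a : coprimeIdeals 𝔑) (α : 𝓞 K), α - 1 ∈ 𝔑 → (a : Ideal (𝓞 K)) = Ideal.span {α} →
      Ψ a = emb (α : K) ^ l := fun a α hα ha => (congrArg ψ ha).trans (halg α hα)
  let p : ℕ → coprimeIdeals 𝔑 := fun i => ⟨𝔭 i, (hprime i).2⟩
  have hval : ∀ i, ψ (𝔭 i) * (Ideal.absNorm (𝔭 i) : ℂ) ^ (-(l : ℂ) / 2) = (phaseHom Ψ hΨ (p i) : ℂ) := by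
    intro i
    have hN : (0:ℝ) < Ideal.absNorm (𝔭 i) := by exact_mod_cast absNorm_pos (p i)
    have h1 : ‖ψ (𝔭 i)‖ ^ 2 = (Ideal.absNorm (𝔭 i) : ℝ) ^ l :=
      norm_sq_eq_absNorm_pow hdeg himag h𝔑 emb hΨ hΨalg (p i)
    have h2 : ‖ψ (𝔭 i)‖ = (Ideal.absNorm (𝔭 i) : ℝ) ^ ((l : ℝ) / 2) := by
      rw [← Real.sqrt_sq (norm_nonneg (ψ (𝔭 i))), h1, Real.sqrt_eq_rpow, ← Real.rpow_natCast,
        ← Real.rpow_mul hN.le, mul_one_div]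
    change _ = ψ (𝔭 i) / (‖ψ (𝔭 i)‖ : ℂ)
    rw [h2, Complex.ofReal_cpow hN.le, neg_div, Complex.cpow_neg, div_eq_mul_inv]
    push_cast
    rfl
  simp_rw [hval]
  let g : C(Circle, ℂ) := ⟨fun z => f z, hf.comp continuous_subtype_val⟩
  refine Circle.tendsto_mean_of_zpow μ (x := fun i => phaseHom Ψ hΨ (p i)) (fun k hk => ?_) g
  refine tendsto_mean_phase_zpow hdeg himag h𝔑' h𝔑 emb (l := l) (χ := phaseHom Ψ hΨ) (p := p) (by exact_mod_cast (by omega : l ≠ 0))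
    (fun a α hα ha => ?_) (fun i => (hprime i).1) (fun i j h => hinj (congrArg Subtype.val h))
    (fun q hq => ?_) (fun i j hij => hmono i j hij) hk
  · change phase (Ψ a) = _
    rw [hΨalg a α hα ha, phase_pow, zpow_natCast]
  · obtain ⟨i, hi⟩ := hsurj q hq q.2.1 q.2.2
    exact ⟨i, Subtype.ext hi⟩
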